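/- arXiv:1401.7301 — 5 statements merged into one kernel-verified Lean document; each statement's English description precedes it below -/
import Mathlib

section
/- Let M be a loopless matroid of rank r ≥ 2 on E = {1,…,n}, let ω ∈ ℝ^n be a generic weight, and let t', t ∈ ℝ satisfy t' < t ≤ min{0, ω·E}. Then the dimension over ℚ of the reduced simplicial homology group H̃_{r−2}(Δ(L^{>t}); ℚ) is at most the dimension over ℚ of H̃_{r−2}(Δ(L^{>t'}); ℚ). -/
open Function

noncomputable section

/-- The total weight `ω·σ` of a set `σ`. -/
def wsum {n : ℕ} (ω : Fin n → ℝ) (σ : Set (Fin n)) : ℝ := ∑ᶠ i ∈ σ, ω i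

/-- The rank function of a matroid: the largest cardinality of an independent subset of `X`. -/
def mrk {n : ℕ} (M : Matroid (Fin n)) (X : Set (Fin n)) : ℕ :=
  sSup {k | ∃ I, M.Indep I ∧ I ⊆ X ∧ I.ncard = k}

/-- The filtered geometric lattice `L^{>t}`: proper nonempty flats (sets equal to their
closure) of weight `> t`. -/
def Lgt {n : ℕ} (M : Matroid (Fin n)) (ω : Fin n → ℝ) (t : ℝ) : Set (Set (Fin n)) :=
  {F | M.closure F = F ∧ F.Nonempty ∧ F ≠ Set.univ ∧ t < wsum ω F}

/-- The simplices with `q` vertices of the order complex of the subposet `P ⊆ α`: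
strictly increasing enumerations of `q`-element chains contained in `P`. -/
def OCsimplex {α : Type*} [Preorder α] (P : Set α) (q : ℕ) : Type _ :=
  {s : Fin q → α // StrictMono s ∧ ∀ i, s i ∈ P}

/-- The `i`-th face of a simplex of the order complex (deleting the `i`-th vertex). -/
def OCface {α : Type*} [Preorder α] {P : Set α} {q : ℕ} (i : Fin (q + 1))
    (s : OCsimplex P (q + 1)) : OCsimplex P q :=
  ⟨fun j => s.1 (i.succAbove j), s.2.1.comp (Fin.strictMono_succAbove i),
    fun j => s.2.2 (i.succAbove j)⟩

/-- The simplicial boundary map (with the augmentation in degree `0`, so that the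
resulting homology is reduced): `C_{q}` has basis the chains with `q+1` vertices. -/
def OCbd {α : Type*} [Preorder α] (P : Set α) (q : ℕ) :
    (OCsimplex P (q + 1) →₀ ℚ) →ₗ[ℚ] (OCsimplex P q →₀ ℚ) :=
  Finsupp.lsum ℚ fun s => LinearMap.toSpanSingleton ℚ _
    (∑ i : Fin (q + 1), ((-1 : ℚ) ^ (i : ℕ)) • Finsupp.single (OCface i s) (1 : ℚ))

/-- The reduced simplicial homology, with rational coefficients, of the order complex
of `P` in dimension `d` (cycles with `d+1` vertices modulo boundaries). -/
abbrev redHomology {α : Type*} [Preorder α] (P : Set α) (d : ℕ) : Type _ :=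
  ↥(LinearMap.ker (OCbd P d)) ⧸
    (Submodule.comap (LinearMap.ker (OCbd P d)).subtype (LinearMap.range (OCbd P (d + 1))))

/-- An independent subset of a flat can be enlarged by any element outside the flat. -/
theorem exists_indep_ncard_succ {n : ℕ} {M : Matroid (Fin n)} (hE : M.E = Set.univ)
    {F I : Set (Fin n)} (hF : M.closure F = F) (hI : M.Indep I) (hIF : I ⊆ F)
    {x : Fin n} (hx : x ∉ F) : M.Indep (insert x I) ∧ (insert x I).ncard = I.ncard + 1 := by
  have hxI : x ∉ M.closure I := fun h => hx (hF ▸ M.closure_subset_closure hIF h)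
  refine ⟨(hI.insert_indep_iff).2 (Or.inl ⟨by simp [hE], hxI⟩), ?_⟩
  exact Set.ncard_insert_of_notMem (fun h => hx (hIF h)) (Set.toFinite I)

theorem Matroid.Indep.ncard_le_mrk {n : ℕ} {M : Matroid (Fin n)} {I : Set (Fin n)}
    (hI : M.Indep I) : I.ncard ≤ mrk M Set.univ := by
  refine le_csSup ⟨n, ?_⟩ ⟨I, hI, Set.subset_univ I, rfl⟩
  rintro _ ⟨J, -, -, rfl⟩
  simpa using Set.ncard_le_card J

/-- Chains of proper nonempty flats of a loopless matroid have fewer elements than its rank. -/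
theorem isEmpty_OCsimplex_Lgt {n : ℕ} (M : Matroid (Fin n)) (hE : M.E = Set.univ)
    (hLoopless : M.closure ∅ = ∅) (ω : Fin n → ℝ) (t : ℝ) {q : ℕ} (hq : mrk M Set.univ = q + 1) :
    IsEmpty (OCsimplex (Lgt M ω t) (q + 1)) := by
  refine ⟨fun ⟨s, hs, hmem⟩ => ?_⟩
  have key : ∀ i (hi : i < q + 1), ∃ I, M.Indep I ∧ I ⊆ s ⟨i, hi⟩ ∧ I.ncard = i + 1 := by
    intro i
    induction i with
    | zero =>
      intro hi
      obtain ⟨x, hx⟩ := (hmem ⟨0, hi⟩).2.1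
      obtain ⟨h, hcard⟩ := exists_indep_ncard_succ hE hLoopless M.empty_indep subset_rfl
        (Set.notMem_empty x)
      exact ⟨_, h, by simpa using hx, by simp⟩
    | succ i ih =>
      intro hi
      obtain ⟨I, hI, hIs, hcard⟩ := ih (by omega)
      have hlt : s ⟨i, by omega⟩ < s ⟨i + 1, hi⟩ := hs (by simp)
      obtain ⟨x, hx, hx'⟩ := Set.exists_of_ssubset hlt
      obtain ⟨h, hcard'⟩ := exists_indep_ncard_succ hE (hmem _).1 hI hIs hx'
      exact ⟨_, h, Set.insert_subset hx (hIs.trans hlt.le), by rw [hcard', hcard]⟩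
  obtain ⟨I, hI, hIs, hcard⟩ := key q (by omega)
  obtain ⟨x, hx⟩ := (Set.ne_univ_iff_exists_notMem _).1 (hmem ⟨q, by omega⟩).2.2.1
  obtain ⟨h, hcard'⟩ := exists_indep_ncard_succ hE (hmem _).1 hI hIs hx
  have := h.ncard_le_mrk
  omega

/-- The inclusion of order complexes induced by an inclusion of subposets. -/
def OCsimplex.incl {α : Type*} [Preorder α] {P Q : Set α} (h : P ⊆ Q) {q : ℕ}
    (s : OCsimplex P q) : OCsimplex Q q :=
  ⟨s.1, s.2.1, fun i => h (s.2.2 i)⟩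

theorem OCsimplex.incl_injective {α : Type*} [Preorder α] {P Q : Set α} (h : P ⊆ Q) {q : ℕ} :
    Injective (OCsimplex.incl h (q := q)) :=
  fun _ _ e => Subtype.ext (Subtype.mk.inj e)

theorem OCbd_lmapDomain_incl {α : Type*} [Preorder α] {P Q : Set α} (h : P ⊆ Q) (q : ℕ)
    (c : OCsimplex P (q + 1) →₀ ℚ) :
    OCbd Q q (Finsupp.lmapDomain ℚ ℚ (OCsimplex.incl h) c) =
      Finsupp.lmapDomain ℚ ℚ (OCsimplex.incl h) (OCbd P q c) := by
  rw [← LinearMap.comp_apply, ← LinearMap.comp_apply]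
  congr 1
  ext s : 2
  simp [OCbd, Finsupp.mapDomain_single]
  rfl

/-- Top-dimensional reduced homology is monotone in the subposet. -/
theorem rank_redHomology_le_of_subset {α : Type*} [Preorder α] {P Q : Set α} (h : P ⊆ Q) (d : ℕ)
    [IsEmpty (OCsimplex Q (d + 2))] :
    Module.rank ℚ (redHomology P d) ≤ Module.rank ℚ (redHomology Q d) := by
  have hmaps : ∀ c ∈ LinearMap.ker (OCbd P d),
      Finsupp.lmapDomain ℚ ℚ (OCsimplex.incl h) c ∈ LinearMap.ker (OCbd Q d) := by
    intro c hc
    rw [LinearMap.mem_ker] at hc ⊢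
    rw [OCbd_lmapDomain_incl, hc, map_zero]
  have hinj : Injective ((Finsupp.lmapDomain ℚ ℚ (OCsimplex.incl h)).restrict hmaps) := by
    intro a b hab
    exact Subtype.ext (Finsupp.mapDomain_injective (OCsimplex.incl_injective h)
      (congrArg Subtype.val hab))
  have hbot : Submodule.comap (LinearMap.ker (OCbd Q d)).subtype
      (LinearMap.range (OCbd Q (d + 1))) = ⊥ := by
    rw [Subsingleton.elim (OCbd Q (d + 1)) 0, LinearMap.range_zero]
    exact Submodule.ker_subtype _
  calc Module.rank ℚ (redHomology P d)
      ≤ Module.rank ℚ (LinearMap.ker (OCbd P d)) := rank_quotient_le _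
    _ ≤ Module.rank ℚ (LinearMap.ker (OCbd Q d)) := LinearMap.rank_le_of_injective _ hinj
    _ = Module.rank ℚ (redHomology Q d) := (Submodule.quotEquivOfEqBot _ hbot).rank_eq.symm

/-- For a loopless matroid of rank `r ≥ 2`, a generic weight `ω`, and
`t' < t ≤ min {0, ω·E}`, the dimension of `H̃_{r-2}(Δ(L^{>t}); ℚ)` is at most that of
`H̃_{r-2}(Δ(L^{>t'}); ℚ)`. -/
theorem filtered_geometric_lattice_homology_monotone
    {n r : ℕ} (M : Matroid (Fin n)) (hE : M.E = Set.univ)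
    (hLoopless : M.closure ∅ = ∅)
    (hrank : mrk M Set.univ = r) (hr : 2 ≤ r)
    (ω : Fin n → ℝ)
    (hgen : ∀ σ : Set (Fin n), σ.Nonempty → σ ≠ Set.univ → wsum ω σ ≠ 0)
    (t' t : ℝ) (ht't : t' < t) (ht : t ≤ min 0 (wsum ω Set.univ)) :
    Module.rank ℚ (redHomology (Lgt M ω t) (r - 2)) ≤
      Module.rank ℚ (redHomology (Lgt M ω t') (r - 2)) := by
  obtain ⟨d, rfl⟩ : ∃ d, r = d + 2 := ⟨r - 2, by omega⟩
  have := isEmpty_OCsimplex_Lgt M hE hLoopless ω t' hrank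
  have hsub : Lgt M ω t ⊆ Lgt M ω t' :=
    fun F hF => ⟨hF.1, hF.2.1, hF.2.2.1, ht't.trans hF.2.2.2⟩
  exact rank_redHomology_le_of_subset hsub d
end
end

section
/- Let M be a loopless matroid of rank r ≥ 2 on E = {1,…,n}, let ω ∈ ℝ^n be a generic weight, and let t ∈ ℝ satisfy t ≤ min{0, ω·E}. Then the poset L^{>t} is pure of dimension r−2: every maximal chain of L^{>t} (with respect to inclusion) has exactly r−1 elements, namely exactly one flat of each rank 1, 2, …, r−1; in particular L^{>t} is nonempty. -/
open Function

noncomputable section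

lemma wsum_eq_sum {n : ℕ} (ω : Fin n → ℝ) (σ : Set (Fin n)) [DecidablePred (· ∈ σ)] :
    wsum ω σ = ∑ i with i ∈ σ, ω i := by
  rw [wsum, ← finsum_mem_coe_finset]
  simp

lemma coe_mrk {n : ℕ} (M : Matroid (Fin n)) (X : Set (Fin n)) : (mrk M X : ℕ∞) = M.eRk X := by
  obtain ⟨I, hI⟩ := M.exists_isBasis' X
  have h : IsGreatest {k | ∃ I, M.Indep I ∧ I ⊆ X ∧ I.ncard = k} I.ncard := by
    refine ⟨⟨I, hI.indep, hI.subset, rfl⟩, ?_⟩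
    rintro k ⟨J, hJ, hJX, rfl⟩
    have := hJ.encard_le_eRk_of_subset hJX
    rw [hI.eRk_eq_encard, ← J.toFinite.cast_ncard_eq, ← I.toFinite.cast_ncard_eq] at this
    exact_mod_cast this
  rw [mrk, h.csSup_eq, I.toFinite.cast_ncard_eq, hI.eRk_eq_encard]

lemma mrk_mono {n : ℕ} (M : Matroid (Fin n)) {X Y : Set (Fin n)} (h : X ⊆ Y) :
    mrk M X ≤ mrk M Y := by
  have := M.eRk_mono h
  rw [← coe_mrk, ← coe_mrk] at this
  exact_mod_cast this

lemma mrk_empty {n : ℕ} (M : Matroid (Fin n)) : mrk M ∅ = 0 := by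
  have := M.eRk_empty
  rw [← coe_mrk] at this
  exact_mod_cast this

lemma mrk_closure_insert_le {n : ℕ} (M : Matroid (Fin n)) (e : Fin n) (X : Set (Fin n)) :
    mrk M (M.closure (insert e X)) ≤ mrk M X + 1 := by
  have := M.eRk_insert_le_add_one e X
  rw [← M.eRk_closure_eq (insert e X), ← coe_mrk, ← coe_mrk] at this
  exact_mod_cast this

lemma eq_of_subset_of_mrk_le {n : ℕ} {M : Matroid (Fin n)} {F G : Set (Fin n)}
    (hF : M.closure F = F) (hG : M.closure G = G) (h : F ⊆ G) (hr : mrk M G ≤ mrk M F) :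
    F = G := by
  have hr' : M.eRk G ≤ M.eRk F := by
    rw [← coe_mrk, ← coe_mrk]
    exact_mod_cast hr
  rw [← hF, ← hG]
  exact (M.isRkFinite_of_finite F.toFinite).closure_eq_closure_of_subset_of_eRk_ge_eRk h hr'

lemma subset_of_comparable_of_mrk_le {n : ℕ} {M : Matroid (Fin n)} {F G : Set (Fin n)}
    (hF : M.closure F = F) (hG : M.closure G = G) (h : F ⊆ G ∨ G ⊆ F)
    (hr : mrk M F ≤ mrk M G) : F ⊆ G := by
  rcases h with h | h
  · exact h
  · exact (eq_of_subset_of_mrk_le hG hF h hr).ge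

open Classical in
/-- The flats covering `F` below a flat `G` partition `G \ F`; this is the resulting identity
of weights. -/
lemma sum_covers_wsum_sub {n : ℕ} {M : Matroid (Fin n)} (hE : M.E = Set.univ)
    {F G : Set (Fin n)} (hF : M.closure F = F) (hG : M.closure G = G) (hFG : F ⊆ G)
    (ω : Fin n → ℝ) :
    ∑ H ∈ (Finset.univ.filter (· ∈ G \ F)).image (fun e ↦ M.closure (insert e F)),
      (wsum ω H - wsum ω F) = wsum ω G - wsum ω F := by
  have hdiff : ∀ H : Set (Fin n), F ⊆ H → wsum ω H - wsum ω F = ∑ i with i ∈ H \ F, ω i := by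
    intro H hFH
    have hsub : Finset.univ.filter (· ∈ F) ⊆ Finset.univ.filter (· ∈ H) := by
      intro i
      simpa using @hFH i
    rw [wsum_eq_sum, wsum_eq_sum, ← Finset.sum_sdiff hsub, add_sub_cancel_right]
    congr 1
    ext i
    simp
  rw [hdiff G hFG]
  refine (Finset.sum_image' _ fun e he ↦ ?_)
  have he' : e ∈ G \ F := by simpa using he
  have hsub : insert e F ⊆ M.closure (insert e F) :=
    M.subset_closure _ (hE ▸ Set.subset_univ _)
  rw [hdiff _ ((Set.subset_insert e F).trans hsub)]
  have hle : M.closure (insert e F) ⊆ G := by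
    rw [← hG]
    exact M.closure_subset_closure (Set.insert_subset he'.1 hFG)
  congr 1
  ext i
  simp only [Finset.mem_filter, Finset.mem_univ, true_and]
  constructor
  · intro hi
    refine ⟨⟨hle hi.1, hi.2⟩, Matroid.closure_insert_congr ⟨hi.1, ?_⟩⟩
    rw [hF]
    exact hi.2
  · rintro ⟨hi, h⟩
    refine ⟨?_, hi.2⟩
    rw [← h]
    exact M.subset_closure _ (hE ▸ Set.subset_univ _) (Set.mem_insert i F)

lemma exists_flat_between {n : ℕ} {M : Matroid (Fin n)} (hE : M.E = Set.univ)
    {ω : Fin n → ℝ} (hgen : ∀ σ : Set (Fin n), σ.Nonempty → σ ≠ Set.univ → wsum ω σ ≠ 0)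
    {t : ℝ} (ht : t ≤ 0) {F G : Set (Fin n)} (hF : M.closure F = F) (hG : M.closure G = G)
    (hFG : F ⊆ G) (hr : mrk M F + 2 ≤ mrk M G) (hFt : F = ∅ ∨ t < wsum ω F)
    (hGt : t ≤ wsum ω G) :
    ∃ H ∈ Lgt M ω t, F ⊂ H ∧ H ⊂ G := by
  classical
  by_contra! hcon
  set S := (Finset.univ.filter (· ∈ G \ F)).image (fun e ↦ M.closure (insert e F)) with hS
  have hsum := sum_covers_wsum_sub hE hF hG hFG ω
  rw [← hS] at hsum
  have hmem : ∀ e (X : Set (Fin n)), e ∈ M.closure (insert e X) := fun e X ↦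
    M.subset_closure _ (hE ▸ Set.subset_univ _) (Set.mem_insert e X)
  have hSprop : ∀ H ∈ S, M.closure H = H ∧ F ⊂ H ∧ H ⊂ G := by
    intro H hH
    obtain ⟨e, he, rfl⟩ := Finset.mem_image.1 hH
    have he' : e ∈ G \ F := by simpa using he
    refine ⟨M.closure_closure _, ?_, ?_⟩
    · refine Set.ssubset_iff_subset_ne.2 ⟨(Set.subset_insert e F).trans
        (M.subset_closure _ (hE ▸ Set.subset_univ _)), fun h ↦ he'.2 ?_⟩
      rw [h]
      exact hmem e F
    · refine Set.ssubset_iff_subset_ne.2 ⟨?_, fun h ↦ ?_⟩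
      · rw [← hG]
        exact M.closure_subset_closure (Set.insert_subset he'.1 hFG)
      · have := mrk_closure_insert_le M e F
        rw [h] at this
        omega
  have hSt : ∀ H ∈ S, wsum ω H ≤ t ∧ wsum ω H < wsum ω F := by
    intro H hH
    obtain ⟨hcl, hFH, hHG⟩ := hSprop H hH
    have hne : H.Nonempty := Set.nonempty_of_ssubset' hFH
    have hne' : H ≠ Set.univ := (hHG.trans_subset (Set.subset_univ G)).ne
    have hle : wsum ω H ≤ t := by
      by_contra! hlt
      exact hcon H ⟨hcl, hne, hne', hlt⟩ hFH hHG
    refine ⟨hle, ?_⟩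
    rcases hFt with rfl | hFt
    · have h0 : wsum ω ∅ = 0 := by simp [wsum]
      rw [h0]
      exact lt_of_le_of_ne (hle.trans ht) (hgen H hne hne')
    · exact hle.trans_lt hFt
  have hcover : ∀ e ∈ G \ F, M.closure (insert e F) ∈ S := fun e he ↦
    Finset.mem_image_of_mem _ (by simpa using he)
  have hssub : F ⊂ G := by
    refine Set.ssubset_iff_subset_ne.2 ⟨hFG, ?_⟩
    rintro rfl
    omega
  obtain ⟨e, heG, heF⟩ := Set.exists_of_ssubset hssub
  have hH₀ := hcover e ⟨heG, heF⟩
  obtain ⟨e', heG', heH'⟩ := Set.exists_of_ssubset (hSprop _ hH₀).2.2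
  have hH₁ := hcover e' ⟨heG', fun h ↦ heH' ((hSprop _ hH₀).2.1.subset h)⟩
  have hne : M.closure (insert e' F) ≠ M.closure (insert e F) := by
    intro h
    rw [← h] at heH'
    exact heH' (hmem e' F)
  rw [← Finset.add_sum_erase S _ hH₀] at hsum
  have hneg : ∑ H ∈ S.erase (M.closure (insert e F)), (wsum ω H - wsum ω F) < 0 :=
    Finset.sum_neg (fun H hH ↦ sub_neg.2 (hSt H (Finset.mem_of_mem_erase hH)).2)
      ⟨_, Finset.mem_erase.2 ⟨hne, hH₁⟩⟩
  have := (hSt _ hH₀).1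
  linarith

lemma exists_mem_maximal_chain_mrk_eq {n : ℕ} {M : Matroid (Fin n)} (hE : M.E = Set.univ)
    (hLoopless : M.closure ∅ = ∅) {ω : Fin n → ℝ}
    (hgen : ∀ σ : Set (Fin n), σ.Nonempty → σ ≠ Set.univ → wsum ω σ ≠ 0)
    {t : ℝ} (ht : t ≤ min 0 (wsum ω Set.univ)) {C : Set (Set (Fin n))}
    (hC : C ⊆ Lgt M ω t) (hchain : IsChain (· ⊆ ·) C)
    (hmax : ∀ C', C' ⊆ Lgt M ω t → IsChain (· ⊆ ·) C' → C ⊆ C' → C = C')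
    {j : ℕ} (hj : 0 < j) (hjr : j < mrk M Set.univ) : ∃ F ∈ C, mrk M F = j := by
  set D := insert ∅ (insert Set.univ C) with hD
  have hDchain : IsChain (· ⊆ ·) D :=
    (hchain.insert fun K _ _ ↦ Or.inr (Set.subset_univ K)).insert
      fun K _ _ ↦ Or.inl (Set.empty_subset K)
  have huniv : M.closure Set.univ = Set.univ := by rw [← hE, M.closure_ground]
  have hDflat : ∀ K ∈ D, M.closure K = K := by
    rintro K (rfl | rfl | hK)
    exacts [hLoopless, huniv, (hC hK).1]
  have hCD : C ⊆ D := (Set.subset_insert _ _).trans (Set.subset_insert _ _)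
  obtain ⟨G, ⟨hGD, hGj⟩, hGmin⟩ := Set.exists_min_image {K | K ∈ D ∧ j ≤ mrk M K} (mrk M)
    (Set.toFinite _) ⟨Set.univ, Or.inr (Or.inl rfl), hjr.le⟩
  obtain ⟨F, ⟨hFD, hFj⟩, hFmax⟩ := Set.exists_max_image {K | K ∈ D ∧ mrk M K < j} (mrk M)
    (Set.toFinite _) ⟨∅, Or.inl rfl, by rw [mrk_empty]; exact hj⟩
  rcases hGj.eq_or_lt with hGj | hGj
  · rcases hGD with rfl | rfl | hG
    · rw [mrk_empty] at hGj
      omega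
    · omega
    · exact ⟨G, hG, hGj.symm⟩
  have below : ∀ K ∈ D, mrk M K < j → K ⊆ F := fun K hK hKj ↦
    subset_of_comparable_of_mrk_le (hDflat K hK) (hDflat F hFD) (hDchain.total hK hFD)
      (hFmax K ⟨hK, hKj⟩)
  have above : ∀ K ∈ D, j ≤ mrk M K → G ⊆ K := fun K hK hKj ↦
    subset_of_comparable_of_mrk_le (hDflat G hGD) (hDflat K hK) (hDchain.total hGD hK)
      (hGmin K ⟨hK, hKj⟩)
  have hFG : F ⊆ G :=
    subset_of_comparable_of_mrk_le (hDflat F hFD) (hDflat G hGD) (hDchain.total hFD hGD)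
      (by omega)
  have hFt : F = ∅ ∨ t < wsum ω F := by
    rcases hFD with h | rfl | hF
    · exact Or.inl h
    · omega
    · exact Or.inr (hC hF).2.2.2
  have hGt : t ≤ wsum ω G := by
    rcases hGD with rfl | rfl | hG
    · rw [mrk_empty] at hGj
      omega
    · exact ht.trans (min_le_right _ _)
    · exact (hC hG).2.2.2.le
  obtain ⟨H, hH, hFH, hHG⟩ := exists_flat_between hE hgen (ht.trans (min_le_left _ _))
    (hDflat F hFD) (hDflat G hGD) hFG (by omega) hFt hGt
  have hins : C = insert H C := by
    refine hmax _ (Set.insert_subset hH hC) (hchain.insert fun K hK _ ↦ ?_) (Set.subset_insert _ _)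
    rcases lt_or_ge (mrk M K) j with hKj | hKj
    · exact Or.inr ((below K (hCD hK) hKj).trans hFH.subset)
    · exact Or.inl (hHG.subset.trans (above K (hCD hK) hKj))
  have hHD : H ∈ D := hCD (hins ▸ Set.mem_insert H C)
  rcases lt_or_ge (mrk M H) j with hHj | hHj
  · exact absurd (below H hHD hHj) hFH.not_subset
  · exact absurd (above H hHD hHj) hHG.not_subset

/-- **Purity of filtered geometric lattices.** For a loopless matroid of rank `r ≥ 2`,
a generic weight `ω`, and `t ≤ min {0, ω·E}`, every maximal chain of `L^{>t}` has
exactly `r - 1` elements — namely exactly one flat of each rank `1, …, r-1`; in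
particular `L^{>t}` is nonempty. -/
theorem filtered_geometric_lattice_pure
    {n r : ℕ} (M : Matroid (Fin n)) (hE : M.E = Set.univ)
    (hLoopless : M.closure ∅ = ∅)
    (hrank : mrk M Set.univ = r) (hr : 2 ≤ r)
    (ω : Fin n → ℝ)
    (hgen : ∀ σ : Set (Fin n), σ.Nonempty → σ ≠ Set.univ → wsum ω σ ≠ 0)
    (t : ℝ) (ht : t ≤ min 0 (wsum ω Set.univ)) :
    (∀ C : Set (Set (Fin n)),
        C ⊆ Lgt M ω t → IsChain (· ⊆ ·) C →
        (∀ C', C' ⊆ Lgt M ω t → IsChain (· ⊆ ·) C' → C ⊆ C' → C = C') →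
        (C.ncard = r - 1 ∧
          ∀ j : ℕ, 1 ≤ j → j ≤ r - 1 → ∃! F, F ∈ C ∧ mrk M F = j)) ∧
    (Lgt M ω t).Nonempty := by
  have huniv : M.closure Set.univ = Set.univ := by rw [← hE, M.closure_ground]
  refine ⟨fun C hC hchain hmax ↦ ?_, ?_⟩
  · have hinj : Set.InjOn (mrk M) C := fun F hF G hG h ↦
      (subset_of_comparable_of_mrk_le (hC hF).1 (hC hG).1 (hchain.total hF hG) h.le).antisymm
        (subset_of_comparable_of_mrk_le (hC hG).1 (hC hF).1 (hchain.total hG hF) h.ge)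
    have hex : ∀ j, 1 ≤ j → j ≤ r - 1 → ∃ F ∈ C, mrk M F = j := fun j hj hjr ↦
      exists_mem_maximal_chain_mrk_eq hE hLoopless hgen ht hC hchain hmax hj (by omega)
    refine ⟨?_, fun j hj hjr ↦ ?_⟩
    · have himage : mrk M '' C = Set.Icc 1 (r - 1) := by
        ext j
        constructor
        · rintro ⟨F, hF, rfl⟩
          obtain ⟨hcl, hne, hne', -⟩ := hC hF
          constructor
          · by_contra! h
            exact hne.ne_empty (eq_of_subset_of_mrk_le hLoopless hcl (Set.empty_subset F)
              (by omega)).symm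
          · by_contra! h
            exact hne' (eq_of_subset_of_mrk_le hcl huniv (Set.subset_univ F) (by omega))
        · rintro ⟨hj, hjr⟩
          exact hex j hj hjr
      rw [← hinj.ncard_image, himage, ← Finset.coe_Icc, Set.ncard_coe_finset,
        Nat.card_Icc, Nat.add_sub_cancel]
    · obtain ⟨F, hF, hFj⟩ := hex j hj hjr
      exact ⟨F, ⟨hF, hFj⟩, fun G hG ↦ hinj hG.1 hF (hG.2.trans hFj.symm)⟩
  · obtain ⟨H, hH, -⟩ := exists_flat_between hE hgen (ht.trans (min_le_left _ _)) hLoopless huniv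
      (Set.empty_subset _) (by rw [mrk_empty]; omega) (Or.inl rfl) (ht.trans (min_le_right _ _))
    exact ⟨H, hH⟩
end
end

section
/- Let ω ∈ ℝ^n, let σ ⊆ τ ⊆ {1,…,n}, and enumerate τ ∖ σ = {a_1,…,a_k} so that ω_{a_1} ≥ ω_{a_2} ≥ ⋯ ≥ ω_{a_k}. Then for every 0 ≤ j ≤ k, the partial set σ ∪ {a_1,…,a_j} satisfies ω·(σ ∪ {a_1,…,a_j}) ≥ min{ω·σ, ω·τ}. (Consequently, if a pair of nested sets both lie in the weight-filtered Boolean poset B^{>t}, then the entire chain obtained by adding the elements of their difference in decreasing order of weight lies in B^{>t}.) -/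
open Function

noncomputable section

theorem wsum_add_wsum_diff {n : ℕ} (ω : Fin n → ℝ) {s t : Set (Fin n)} (hst : s ⊆ t) :
    wsum ω s + wsum ω (t \ s) = wsum ω t :=
  finsum_mem_add_sdiff hst t.toFinite

theorem wsum_nonneg {n : ℕ} {ω : Fin n → ℝ} {s : Set (Fin n)} (h : ∀ x ∈ s, 0 ≤ ω x) :
    0 ≤ wsum ω s :=
  finsum_nonneg fun x => finsum_nonneg fun hx => h x hx

theorem wsum_nonpos {n : ℕ} {ω : Fin n → ℝ} {s : Set (Fin n)} (h : ∀ x ∈ s, ω x ≤ 0) :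
    wsum ω s ≤ 0 := by
  have := wsum_nonneg (ω := -ω) (s := s) fun x hx => neg_nonneg.2 (h x hx)
  simpa [wsum, finsum_mem_neg_distrib _ s.toFinite] using this

/-- Let `σ ⊆ τ ⊆ {1,…,n}` and enumerate `τ \ σ = {a_1, …, a_k}` in decreasing order of
weight.  Then every partial set `σ ∪ {a_1, …, a_j}` has weight at least
`min {ω·σ, ω·τ}`. -/
theorem weight_of_partial_chain
    {n k : ℕ} (ω : Fin n → ℝ) (σ τ : Set (Fin n)) (hστ : σ ⊆ τ)
    (a : Fin k → Fin n) (ha : Function.Injective a)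
    (hrange : Set.range a = τ \ σ)
    (hsorted : ∀ i j : Fin k, i ≤ j → ω (a j) ≤ ω (a i)) :
    ∀ j : ℕ, j ≤ k →
      min (wsum ω σ) (wsum ω τ) ≤ wsum ω (σ ∪ a '' {i : Fin k | (i : ℕ) < j}) := by
  intro j _
  set ρ := σ ∪ a '' {i : Fin k | (i : ℕ) < j}
  by_cases h : ∀ i : Fin k, (i : ℕ) < j → 0 ≤ ω (a i)
  · refine min_le_of_left_le ?_
    have hnonneg : 0 ≤ wsum ω (ρ \ σ) := by
      refine wsum_nonneg ?_
      rintro x ⟨hx | ⟨i, hi, rfl⟩, hxσ⟩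
      · exact absurd hx hxσ
      · exact h i hi
    linarith [wsum_add_wsum_diff ω (Set.subset_union_left : σ ⊆ ρ)]
  · push Not at h
    obtain ⟨i, hij, hi⟩ := h
    refine min_le_of_right_le ?_
    have hρτ : ρ ⊆ τ := by
      refine Set.union_subset hστ ((Set.image_subset_range _ _).trans ?_)
      exact hrange ▸ Set.sdiff_subset
    have hnonpos : wsum ω (τ \ ρ) ≤ 0 := by
      refine wsum_nonpos ?_
      rintro x ⟨hxτ, hxρ⟩
      obtain ⟨l, rfl⟩ : x ∈ Set.range a :=
        hrange ▸ ⟨hxτ, fun hxσ => hxρ (Or.inl hxσ)⟩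
      have hjl : j ≤ l := not_lt.1 fun hl => hxρ (Or.inr ⟨l, hl, rfl⟩)
      exact (hsorted i l (hij.le.trans hjl)).trans hi.le
    linarith [wsum_add_wsum_diff ω hρτ]
end
end

section
/- Let n ≥ 2, let ω ∈ ℝ^n be generic (ω·σ ≠ 0 for every ∅ ⊊ σ ⊊ {1,…,n}), and let t ∈ ℝ satisfy t ≤ min{0, ω·{1,…,n}}. Let B^{>t} = {σ : ∅ ⊊ σ ⊊ {1,…,n}, ω·σ > t}, ordered by inclusion. Then B^{>t} is homotopy Cohen–Macaulay of dimension n−2; explicitly: (i) every maximal chain of B^{>t} has exactly n−1 elements, and (ii) for every μ ∈ B^{>t} ∪ {∅} and every ν ∈ B^{>t} ∪ {{1,…,n}} with μ ⊊ ν, the geometric realization of the order complex of {σ ∈ B^{>t} : μ ⊊ σ ⊊ ν} is (|ν| − |μ| − 3)-connected. In particular, |Δ(B^{>t})| is (n−3)-connected. -/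
open Function

noncomputable section

/-- The geometric realization of the order complex of the subposet `P` of `α`:
points are convex combinations supported on finite chains contained in `P`. -/
def orderComplex {α : Type*} [Preorder α] (P : Set α) : Set (α → ℝ) :=
  {f | (∀ x, 0 ≤ f x) ∧ (Function.support f).Finite ∧ Function.support f ⊆ P ∧
       IsChain (· ≤ ·) (Function.support f) ∧ ∑ᶠ x, f x = 1}

/-- `k`-connectedness of a topological space, for `k : ℤ`: nonempty, path-connected
when `k ≥ 0`, and trivial homotopy groups `π_i` for `1 ≤ i ≤ k`; by convention every
space is `k`-connected for `k ≤ -2`. -/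
def KConn (X : Type*) [TopologicalSpace X] (k : ℤ) : Prop :=
  k ≤ -2 ∨ (Nonempty X ∧ (0 ≤ k → PathConnectedSpace X) ∧
    ∀ i : ℕ, 1 ≤ i → (i : ℤ) ≤ k → ∀ x : X, Subsingleton (HomotopyGroup (Fin i) X x))

/-- The weight-filtered Boolean poset `B^{>t}`: proper nonempty subsets of `{1,…,n}`
of weight `> t`. -/
def Bgt {n : ℕ} (ω : Fin n → ℝ) (t : ℝ) : Set (Set (Fin n)) :=
  {σ | σ.Nonempty ∧ σ ≠ Set.univ ∧ t < wsum ω σ}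

section Homotopy

open scoped unitInterval

/-- A continuous function on the cube which vanishes on the boundary and equals `1` on the
middle third. -/
def cubeBump {N : Type*} [Fintype N] (y : N → I) : ℝ :=
  ∏ j, min 1 (3 * min (y j : ℝ) (1 - y j))

/-- Expansion of the cube from its centre, interpolating between the identity at `s = 0` and,
at `s = 1`, the map stretching the middle third over the whole cube. -/
def cubeExpand {N : Type*} (s : ℝ) (y : N → I) : N → I :=
  fun j => Set.projIcc (0 : ℝ) 1 zero_le_one ((y j : ℝ) + s * (2 * y j - 1))

theorem cubeBump_nonneg {N : Type*} [Fintype N] (y : N → I) : 0 ≤ cubeBump y :=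
  Finset.prod_nonneg fun j _ => le_min zero_le_one
    (mul_nonneg (by norm_num) (le_min (y j).2.1 (sub_nonneg.2 (y j).2.2)))

theorem cubeBump_le_one {N : Type*} [Fintype N] (y : N → I) : cubeBump y ≤ 1 :=
  Finset.prod_le_one (fun j _ => le_min zero_le_one
    (mul_nonneg (by norm_num) (le_min (y j).2.1 (sub_nonneg.2 (y j).2.2))))
    fun _ _ => min_le_left _ _

theorem continuous_cubeBump {N : Type*} [Fintype N] :
    Continuous (cubeBump : (N → I) → ℝ) := by
  unfold cubeBump
  fun_prop

theorem continuous_cubeExpand {N : Type*} :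
    Continuous fun p : ℝ × (N → I) => cubeExpand p.1 p.2 := by
  unfold cubeExpand
  refine continuous_pi fun j => continuous_projIcc.comp ?_
  fun_prop

theorem cubeBump_eq_zero {N : Type*} [Fintype N] {y : N → I} (hy : y ∈ Cube.boundary N) :
    cubeBump y = 0 := by
  obtain ⟨j, hj⟩ := hy
  refine Finset.prod_eq_zero (Finset.mem_univ j) ?_
  rcases hj with hj | hj <;> simp [hj]

theorem cubeExpand_zero {N : Type*} (y : N → I) : cubeExpand 0 y = y := by
  funext j
  simp [cubeExpand]

theorem cubeExpand_mem_boundary {N : Type*} {y : N → I} (hy : y ∈ Cube.boundary N) {s : ℝ}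
    (hs : 0 ≤ s) : cubeExpand s y ∈ Cube.boundary N := by
  obtain ⟨j, hj⟩ := hy
  refine ⟨j, hj.imp (fun hj => ?_) fun hj => ?_⟩
  · exact Set.projIcc_of_le_left _ (by simp [hj, hs])
  · exact Set.projIcc_of_right_le _ (by simp [hj]; linarith)

theorem cubeExpand_one_mem_boundary {N : Type*} [Fintype N] {y : N → I} (hy : cubeBump y ≠ 1) :
    cubeExpand 1 y ∈ Cube.boundary N := by
  contrapose! hy
  refine Finset.prod_eq_one fun j _ => min_eq_left ?_
  by_contra! h
  apply hy
  rcases min_lt_iff.1 (show min (y j : ℝ) (1 - y j) < 1 / 3 by linarith) with h | h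
  · exact ⟨j, Or.inl (Set.projIcc_of_le_left _ (by linarith))⟩
  · exact ⟨j, Or.inr (Set.projIcc_of_right_le _ (by linarith))⟩

/-- A loop all of whose values can be joined to `v` by a segment in `X` is homotopic, relative to
the boundary of the cube, to a loop depending only on `v` and the base point. -/
theorem GenLoop.homotopic_of_segment_subset {E N : Type*} [TopologicalSpace E] [AddCommGroup E]
    [Module ℝ E] [ContinuousAdd E] [ContinuousSMul ℝ E] [Fintype N] {X : Set E} {x : X} (v : E)
    (f g : GenLoop N X x)
    (hf : ∀ y, ∀ s ∈ Set.Icc (0 : ℝ) 1, (1 - s) • (f y : E) + s • v ∈ X)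
    (hg : ∀ y, ∀ s ∈ Set.Icc (0 : ℝ) 1, (1 - s) • (g y : E) + s • v ∈ X)
    (hx : ∀ s ∈ Set.Icc (0 : ℝ) 1, (1 - s) • (x : E) + s • v ∈ X) :
    GenLoop.Homotopic f g := by
  let e : C(N → I, X) := ⟨fun y => ⟨(1 - cubeBump y) • (x : E) + cubeBump y • v,
    hx _ ⟨cubeBump_nonneg y, cubeBump_le_one y⟩⟩, by
      have := continuous_cubeBump (N := N)
      fun_prop⟩
  suffices h : ∀ f : GenLoop N X x,
      (∀ y, ∀ s ∈ Set.Icc (0 : ℝ) 1, (1 - s) • (f y : E) + s • v ∈ X) →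
      f.1.HomotopicRel e (Cube.boundary N) from (h f hf).trans (h g hg).symm
  intro f hf
  refine ⟨⟨⟨⟨fun p => ⟨(1 - min (p.1 : ℝ) (cubeBump p.2)) • (f (cubeExpand p.1 p.2) : E)
    + min (p.1 : ℝ) (cubeBump p.2) • v, hf _ _ ⟨le_min p.1.2.1 (cubeBump_nonneg _),
      (min_le_left _ _).trans p.1.2.2⟩⟩, ?_⟩, ?_, ?_⟩, ?_⟩⟩
  · have h1 := continuous_cubeBump (N := N)
    have h2 : Continuous fun p : I × (N → I) => f (cubeExpand p.1 p.2) :=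
      f.1.continuous.comp (continuous_cubeExpand.comp
        ((continuous_subtype_val.comp continuous_fst).prodMk continuous_snd))
    refine Continuous.subtype_mk (Continuous.add (Continuous.smul ?_ ?_) ?_) _
    · fun_prop
    · exact continuous_subtype_val.comp h2
    · fun_prop
  · intro y
    ext
    simp [cubeExpand_zero, cubeBump_nonneg]
  · intro y
    ext
    simp only [Set.Icc.coe_one, min_eq_right (cubeBump_le_one y), e, ContinuousMap.coe_mk]
    by_cases h : cubeBump y = 1
    · simp [h]
    · rw [GenLoop.boundary f _ (cubeExpand_one_mem_boundary h)]
  · intro t y hy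
    ext
    have h0 : min (t : ℝ) 0 = 0 := min_eq_right t.2.1
    simp [cubeBump_eq_zero hy, GenLoop.boundary f _ (cubeExpand_mem_boundary hy t.2.1), h0,
      GenLoop.boundary f _ hy]

/-- Straight-line homotopies relative to the boundary. -/
theorem GenLoop.homotopic_of_segment_between {E N : Type*} [TopologicalSpace E] [AddCommGroup E]
    [Module ℝ E] [ContinuousAdd E] [ContinuousSMul ℝ E] {X : Set E} {x : X}
    (f g : GenLoop N X x)
    (h : ∀ y, ∀ s ∈ Set.Icc (0 : ℝ) 1, (1 - s) • (f y : E) + s • (g y : E) ∈ X) :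
    GenLoop.Homotopic f g := by
  refine ⟨⟨⟨⟨fun p => ⟨(1 - (p.1 : ℝ)) • (f p.2 : E) + (p.1 : ℝ) • (g p.2 : E),
    h _ _ p.1.2⟩, ?_⟩, ?_, ?_⟩, ?_⟩⟩
  · have hf : Continuous f := f.1.continuous
    have hg : Continuous g := g.1.continuous
    fun_prop
  · intro y
    ext
    simp
  · intro y
    ext
    simp
  · intro t y hy
    ext
    simp [GenLoop.boundary f y hy, GenLoop.boundary g y hy, ← add_smul]

theorem HomotopyGroup.subsingleton_of_homotopic {N X : Type*} [TopologicalSpace X] {x : X}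
    (h : ∀ f g : GenLoop N X x, GenLoop.Homotopic f g) : Subsingleton (HomotopyGroup N X x) :=
  ⟨by rintro ⟨f⟩ ⟨g⟩; exact Quotient.sound (h f g)⟩

/-- Connectedness in the sense of `KConn` passes to retracts. -/
theorem KConn.of_retract {X Y : Type*} [TopologicalSpace X] [TopologicalSpace Y] (i : C(X, Y))
    (r : C(Y, X)) (hri : ∀ x, r (i x) = x) {k : ℤ} (h : KConn Y k) : KConn X k := by
  refine h.imp_right fun ⟨⟨y⟩, hpath, hpi⟩ => ⟨⟨r y⟩, fun hk => ?_, fun m hm hmk x => ?_⟩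
  · have := hpath hk
    exact (Function.RightInverse.surjective hri).pathConnectedSpace r.continuous
  · refine HomotopyGroup.subsingleton_of_homotopic fun f g => ?_
    let push : GenLoop (Fin m) X x → GenLoop (Fin m) Y (i x) := fun f =>
      ⟨i.comp f.1, fun y hy => congrArg i (f.2 y hy)⟩
    have hsub := hpi m hm hmk (i x)
    have hfg : GenLoop.Homotopic (push f) (push g) :=
      Quotient.exact (Subsingleton.elim (α := HomotopyGroup (Fin m) Y (i x))
        (Quotient.mk _ (push f)) (Quotient.mk _ (push g)))
    have key := ContinuousMap.HomotopicRel.comp_continuousMap hfg r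
    have e : ∀ f : GenLoop (Fin m) X x, r.comp (push f).1 = f.1 := fun f => by
      ext y
      exact hri _
    rwa [e, e] at key

theorem kconn_of_starConvex {E : Type*} [TopologicalSpace E] [AddCommGroup E] [Module ℝ E]
    [ContinuousAdd E] [ContinuousSMul ℝ E] {X : Set E} {v : E} (hv : v ∈ X)
    (hX : ∀ x ∈ X, ∀ s ∈ Set.Icc (0 : ℝ) 1, (1 - s) • x + s • v ∈ X)
    (k : ℤ) : KConn ↥X k := by
  have hstar : StarConvex ℝ v X := by
    intro y hy a b ha hb hab
    have := hX y hy a ⟨ha, by linarith⟩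
    rwa [show 1 - a = b by linarith, add_comm] at this
  refine Or.inr ⟨⟨⟨v, hv⟩⟩, fun _ => ?_, fun m _ _ x => ?_⟩
  · exact isPathConnected_iff_pathConnectedSpace.1 (hstar.isPathConnected hv)
  · exact HomotopyGroup.subsingleton_of_homotopic fun f g =>
      GenLoop.homotopic_of_segment_subset v f g (fun y => hX _ (f y).2) (fun y => hX _ (g y).2)
        (hX _ x.2)

end Homotopy

section SubspaceComplement

open scoped unitInterval Topology

variable {E : Type*} [NormedAddCommGroup E] [NormedSpace ℝ E]

/-- A compact set inside the complement of a closed set stays in it under small perturbations. -/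
theorem exists_pos_forall_dist_lt_notMem {E : Type*} [PseudoMetricSpace E] {K L : Set E}
    (hK : IsCompact K) (hL : IsClosed L)
    (h : Disjoint K L) : ∃ ε > 0, ∀ z ∈ K, ∀ w, dist w z < ε → w ∉ L := by
  obtain ⟨ε, hε, hd⟩ := h.exists_thickenings hK hL
  refine ⟨ε, hε, fun z hz w hw hwL => ?_⟩
  exact Set.disjoint_left.1 hd (Metric.mem_thickening_iff.2 ⟨z, hz, hw⟩)
    (Metric.self_subset_thickening hε L hwL)

/-- Any loop can be perturbed, relative to the boundary, into the restriction of a smooth map. -/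
theorem GenLoop.exists_contDiff_approx {N : Type*} [Fintype N] {X : Set E} {x : X}
    (f : GenLoop N X x) {ε : ℝ} (hε : 0 < ε) :
    ∃ g : (N → ℝ) → E, ContDiff ℝ 1 g ∧ (∀ y : N → I, dist (g fun j => y j) (f y : E) < ε) ∧
      ∀ y ∈ Cube.boundary N, g (fun j => y j) = x := by
  let F : (N → ℝ) → E := fun z => f fun j => Set.projIcc (0 : ℝ) 1 zero_le_one (z j)
  have hF : Continuous F := continuous_subtype_val.comp (f.1.continuous.comp
    (continuous_pi fun j => continuous_projIcc.comp (continuous_apply j)))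
  have hFI : ∀ y : N → I, F (fun j => y j) = f y := fun y => by simp [F]
  set δ := ε / 4 with hδ
  have hδ0 : 0 < δ := by positivity
  let χ : E → ℝ := fun z => min 1 (max 0 (dist z x / δ - 1))
  let G : (N → ℝ) → E := fun z => (x : E) + χ (F z) • (F z - x)
  have hG : Continuous G := by
    simp only [G, χ]
    fun_prop
  have hGF : ∀ z, dist (G z) (F z) ≤ 2 * δ := fun z => by
    have e : G z - F z = (χ (F z) - 1) • (F z - x) := by simp only [G]; module
    rw [dist_eq_norm, e, norm_smul, Real.norm_eq_abs, ← dist_eq_norm]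
    have h1 : χ (F z) ≤ 1 := min_le_left _ _
    have h0 : 0 ≤ χ (F z) := le_min zero_le_one (le_max_left _ _)
    rw [abs_of_nonpos (by linarith)]
    rcases le_or_gt (2 * δ) (dist (F z) x) with h | h
    · have : χ (F z) = 1 := by
        have : 1 ≤ dist (F z) x / δ - 1 := by
          rw [le_sub_iff_add_le, le_div_iff₀ hδ0]; linarith
        exact min_eq_left (this.trans (le_max_right _ _))
      rw [this]; simp; positivity
    · nlinarith [dist_nonneg (x := F z) (y := (x : E))]
  have hGx : ∀ z, dist (F z) x < δ → G z = x := fun z hz => by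
    have : χ (F z) = 0 := by
      have : dist (F z) x / δ - 1 ≤ 0 := by
        rw [sub_nonpos, div_le_one hδ0]; exact hz.le
      simp [χ, max_eq_left this]
    simp [G, this]
  obtain ⟨g, hg, hgG, hgS, -⟩ := hG.exists_contDiff_approx_and_eqOn (ε := fun _ => δ) 1
    continuous_const (fun _ => hδ0) (S := {z | F z = x}) (U := {z | dist (F z) x < δ})
    (isClosed_eq hF continuous_const)
    ((isOpen_lt (hF.dist continuous_const) continuous_const).mem_nhdsSet.2
      fun z (hz : F z = x) => by simp [hz, hδ0])
    ((contDiffOn_const (c := (x : E))).congr fun z hz => hGx z hz)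
  refine ⟨g, by exact_mod_cast hg, fun y => ?_, fun y hy => ?_⟩
  · rw [← hFI]
    have := dist_triangle (g fun j => y j) (G fun j => y j) (F fun j => y j)
    linarith [hgG fun j => y j, hGF fun j => y j]
  · have hFx : F (fun j => y j) = x := by rw [hFI, GenLoop.boundary f y hy]
    rw [hgS hFx, hGx _ (by simp [hFx, hδ0])]

/-- The homotopy groups of the complement of a linear subspace of codimension `c` vanish in
degrees less than `c - 1`. -/
theorem subsingleton_homotopyGroup_compl_submodule [FiniteDimensional ℝ E] (L : Submodule ℝ E)
    {m : ℕ} (hm0 : 1 ≤ m) (hm : m + Module.finrank ℝ L + 1 < Module.finrank ℝ E)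
    (x : ↥((L : Set E)ᶜ)) :
    Subsingleton (HomotopyGroup (Fin m) ↥((L : Set E)ᶜ) x) := by
  suffices h : ∀ f : GenLoop (Fin m) ↥((L : Set E)ᶜ) x, GenLoop.Homotopic f GenLoop.const from
    HomotopyGroup.subsingleton_of_homotopic fun f g => (h f).trans (h g).symm
  intro f
  have hL : IsClosed (L : Set E) := L.closed_of_finiteDimensional
  obtain ⟨ε, hε, hfL⟩ := exists_pos_forall_dist_lt_notMem
    (isCompact_range (continuous_subtype_val.comp f.1.continuous)) hL
    (Set.disjoint_left.2 (by rintro _ ⟨y, rfl⟩; exact (f y).2))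
  obtain ⟨p, hp, hpf, hpx⟩ := GenLoop.exists_contDiff_approx f hε
  have hpL : ∀ y : Fin m → I, p (fun j => y j) ∉ L := fun y => hfL _ ⟨y, rfl⟩ _ (hpf y)
  let g : GenLoop (Fin m) ↥((L : Set E)ᶜ) x := ⟨⟨fun y => ⟨p fun j => y j, hpL y⟩,
    (hp.continuous.comp (by fun_prop)).subtype_mk _⟩, fun y hy => Subtype.ext (hpx y hy)⟩
  have hfg : GenLoop.Homotopic f g := by
    refine GenLoop.homotopic_of_segment_between f g fun y s hs => hfL _ ⟨y, rfl⟩ _ ?_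
    have e : (1 - s) • (f y : E) + s • (g y : E) - f y = s • ((g y : E) - f y) := by module
    refine lt_of_le_of_lt ?_ (hpf y)
    change dist ((1 - s) • (f y : E) + s • (g y : E)) (f y : E) ≤ dist (g y : E) (f y : E)
    rw [dist_eq_norm, e, norm_smul, Real.norm_of_nonneg hs.1, dist_eq_norm]
    exact mul_le_of_le_one_left (norm_nonneg _) hs.2
  obtain ⟨v, hv⟩ : ∃ v : E, v ∉ Set.range fun q : (ℝ × L) × (Fin m → ℝ) =>
      q.1.1 • p q.2 + (q.1.2 : E) := by
    have hsm : ContDiff ℝ 1 fun q : (ℝ × L) × (Fin m → ℝ) => q.1.1 • p q.2 + (q.1.2 : E) := by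
      have h1 : ContDiff ℝ 1 fun q : (ℝ × L) × (Fin m → ℝ) => (q.1.2 : E) :=
        L.subtypeL.contDiff.comp (by fun_prop)
      fun_prop
    refine (hsm.dense_compl_range_of_finrank_lt_finrank ?_).nonempty
    simp only [Module.finrank_prod, Module.finrank_self, Module.finrank_fin_fun]
    omega
  have key : ∀ y : Fin m → I, ∀ s ∈ Set.Icc (0 : ℝ) 1,
      (1 - s) • (g y : E) + s • v ∈ (L : Set E)ᶜ := by
    intro y s hs hmem
    rcases eq_or_ne s 0 with rfl | hs0
    · exact (g y).2 (by simpa using hmem)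
    · refine hv ⟨((-(s⁻¹ * (1 - s)), ⟨_, L.smul_mem s⁻¹ hmem⟩), fun j => y j), ?_⟩
      change -(s⁻¹ * (1 - s)) • (g y : E) + s⁻¹ • ((1 - s) • (g y : E) + s • v) = v
      rw [smul_add, smul_smul, smul_smul, inv_mul_cancel₀ hs0, one_smul, neg_smul,
        neg_add_cancel_left]
  have hgx : (g 0 : E) = x := congrArg _ (g.2 0 ⟨⟨0, hm0⟩, Or.inl rfl⟩)
  exact hfg.trans (GenLoop.homotopic_of_segment_subset v g GenLoop.const key
    (fun _ => hgx ▸ key 0) (hgx ▸ key 0))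

theorem kconn_compl_submodule [FiniteDimensional ℝ E] (L : Submodule ℝ E) {k : ℤ}
    (hk : k + Module.finrank ℝ L + 1 < Module.finrank ℝ E) :
    KConn ↥((L : Set E)ᶜ) k := by
  rcases le_or_gt k (-2) with h | h
  · exact Or.inl h
  have hlt : Module.finrank ℝ L < Module.finrank ℝ E := by omega
  refine Or.inr ⟨?_, fun hk0 => ?_, fun m hm hmk x => ?_⟩
  · have hne : L ≠ ⊤ := by
      rintro rfl
      simp at hlt
    obtain ⟨x, hx⟩ := SetLike.exists_not_mem_of_ne_top L hne rfl
    exact ⟨⟨x, hx⟩⟩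
  · refine isPathConnected_iff_pathConnectedSpace.1 (isPathConnected_compl_of_one_lt_codim ?_)
    rw [← Module.finrank_eq_rank]
    have := L.finrank_quotient_add_finrank
    exact_mod_cast (show 1 < Module.finrank ℝ (E ⧸ L) by omega)
  · exact subsingleton_homotopyGroup_compl_submodule L hm (by omega) x

end SubspaceComplement

section OrderComplex

variable {N : Type*}

/-- The amount by which the values of `x` on `S` exceed its values off `S`. For a proper nonempty
set `S` this is the length of the interval of levels `s` with `S = {e | s < x e}`. -/
def levelGap (S : Set N) (x : N → ℝ) : ℝ := ⨅ p : S × ↥Sᶜ, max 0 (x p.1 - x p.2)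

theorem levelGap_nonneg (S : Set N) (x : N → ℝ) : 0 ≤ levelGap S x :=
  Real.iInf_nonneg fun _ => le_max_left _ _

theorem continuous_levelGap [Finite N] (S : Set N) : Continuous (levelGap S) := by
  unfold levelGap
  have := Fintype.ofFinite (S × ↥Sᶜ)
  cases isEmpty_or_nonempty (S × ↥Sᶜ)
  · simp only [Real.iInf_of_isEmpty]
    exact continuous_const
  · simp only [← Finset.inf'_univ_eq_ciInf]
    exact Continuous.finset_inf'_apply _ fun p _ => by fun_prop

theorem levelGap_le [Finite N] {S : Set N} {x : N → ℝ} {a b : N} (ha : a ∈ S) (hb : b ∉ S) :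
    levelGap S x ≤ max 0 (x a - x b) :=
  ciInf_le (Set.finite_range fun p : S × ↥Sᶜ => max 0 (x p.1 - x p.2)).bddBelow
    (⟨a, ha⟩, ⟨b, hb⟩)

theorem le_levelGap {S : Set N} {x : N → ℝ} {c : ℝ} (hS : S.Nonempty) (hS' : Sᶜ.Nonempty)
    (h : ∀ a ∈ S, ∀ b ∉ S, c ≤ x a - x b) : c ≤ levelGap S x := by
  have := hS.to_subtype
  have := hS'.to_subtype
  exact le_ciInf fun p => (h _ p.1.2 _ p.2.2).trans (le_max_right _ _)

theorem lt_of_levelGap_pos [Finite N] {S : Set N} {x : N → ℝ} (h : 0 < levelGap S x)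
    {a b : N} (ha : a ∈ S) (hb : b ∉ S) : x b < x a := by
  have := h.trans_le (levelGap_le ha hb)
  simpa using this

theorem levelGap_pos [Finite N] {S : Set N} {x : N → ℝ} (hS : S.Nonempty) (hS' : Sᶜ.Nonempty)
    (h : ∀ a ∈ S, ∀ b ∉ S, x b < x a) : 0 < levelGap S x := by
  have := hS.to_subtype
  have := hS'.to_subtype
  obtain ⟨p, hp⟩ := exists_eq_ciInf_of_finite
    (f := fun p : S × ↥Sᶜ => max 0 (x p.1 - x p.2))
  rw [levelGap, ← hp]
  exact lt_max_of_lt_right (sub_pos.2 (h _ p.1.2 _ p.2.2))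

variable {α : Type*} [PartialOrder α] [Fintype α]

/-- The convex combination of indicator functions of the sets `T σ` with coefficients `c σ`. -/
def indicatorSum (T : α → Set N) (c : α → ℝ) : N → ℝ :=
  fun e => ∑ σ, (T σ).indicator (fun _ => c σ) e

theorem sum_eq_one_of_mem_orderComplex {Q : Set α} {c : α → ℝ} (hc : c ∈ orderComplex Q) :
    ∑ σ, c σ = 1 := by
  rw [← finsum_eq_sum_of_fintype]
  exact hc.2.2.2.2

theorem exists_pos_of_mem_orderComplex {Q : Set α} {c : α → ℝ} (hc : c ∈ orderComplex Q) :
    ∃ σ ∈ Q, 0 < c σ := by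
  by_contra! h
  have h0 : ∀ σ, c σ = 0 := fun σ => by
    by_contra hσ
    exact hσ (le_antisymm (h σ (hc.2.2.1 hσ)) (hc.1 σ))
  have := sum_eq_one_of_mem_orderComplex hc
  simp [h0] at this

theorem levelGap_indicatorSum [Finite N] {Q : Set α} {T : α → Set N}
    (hT : ∀ σ ∈ Q, ∀ τ ∈ Q, σ ≤ τ ↔ T σ ⊆ T τ) {c : α → ℝ} (hc : c ∈ orderComplex Q) {σ : α}
    (hσ : σ ∈ Q) (hne : (T σ).Nonempty) (hne' : (T σ)ᶜ.Nonempty) :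
    levelGap (T σ) (indicatorSum T c) = c σ := by
  have hcomp : ∀ τ ρ, c τ ≠ 0 → c ρ ≠ 0 → T τ ⊆ T ρ ∨ T ρ ⊆ T τ := fun τ ρ hτ hρ => by
    have h1 := hc.2.2.1 hτ
    have h2 := hc.2.2.1 hρ
    exact (hc.2.2.2.1.total hτ hρ).imp (hT _ h1 _ h2).1 (hT _ h2 _ h1).1
  apply le_antisymm
  · classical
    let z : N → ℝ := fun e => ∑ τ ∈ Finset.univ.erase σ, (T τ).indicator (fun _ => c τ) e
    have hz : ∀ e, indicatorSum T c e = (T σ).indicator (fun _ => c σ) e + z e := fun e =>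
      (Finset.add_sum_erase _ _ (Finset.mem_univ σ)).symm
    obtain ⟨a, ha, hamin⟩ := Set.exists_min_image (T σ) z (Set.toFinite _) hne
    obtain ⟨b, hb, hbmax⟩ := Set.exists_max_image (T σ)ᶜ z (Set.toFinite _) hne'
    refine (levelGap_le ha hb).trans (max_le (hc.1 σ) ?_)
    rw [hz, hz, Set.indicator_of_mem ha, Set.indicator_of_notMem hb]
    suffices z a ≤ z b by linarith
    -- if one set of the chain separates `a` from `b`, then `z` is larger on it than off it
    have hmono : ∀ τ, c τ ≠ 0 → τ ≠ σ → ∀ p ∈ T τ, ∀ q ∉ T τ, z q < z p := by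
      intro τ hτ hτσ p hp q hq
      refine Finset.sum_lt_sum (fun ρ _ => ?_) ⟨τ, Finset.mem_erase.2 ⟨hτσ, Finset.mem_univ _⟩, ?_⟩
      · by_cases hρ : c ρ = 0
        · simp [Set.indicator, hρ]
        by_cases hqρ : q ∈ T ρ
        · have hpρ : p ∈ T ρ :=
            (hcomp τ ρ hτ hρ).elim (fun h => h hp) fun h => absurd (h hqρ) hq
          simp [hqρ, hpρ]
        · rw [Set.indicator_of_notMem hqρ]
          exact Set.indicator_nonneg (fun _ _ => hc.1 ρ) _
      · simpa [hp, hq] using lt_of_le_of_ne (hc.1 τ) (Ne.symm hτ)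
    by_contra! hlt
    obtain ⟨τ, hτ, hτlt⟩ := Finset.exists_lt_of_sum_lt hlt
    have hτσ := Finset.ne_of_mem_erase hτ
    have haτ : a ∈ T τ := by
      by_contra h
      rw [Set.indicator_of_notMem h] at hτlt
      exact absurd hτlt (not_lt.2 (Set.indicator_nonneg (fun _ _ => hc.1 τ) _))
    have hcτ : c τ ≠ 0 := by
      intro h
      simp [Set.indicator, h] at hτlt
    have hbτ : b ∉ T τ := by
      intro h
      simp [haτ, h] at hτlt
    have hτQ := hc.2.2.1 hcτ
    refine hτσ (le_antisymm ((hT _ hτQ _ hσ).2 fun q hq => ?_) ((hT _ hσ _ hτQ).2 fun q hq => ?_))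
    · by_contra h
      exact absurd (hmono τ hcτ hτσ q hq b hbτ) (not_lt.2 (hbmax q h))
    · by_contra h
      exact absurd (hmono τ hcτ hτσ a haτ q h) (not_lt.2 (hamin q hq))
  · by_cases h0 : c σ = 0
    · rw [h0]
      exact levelGap_nonneg _ _
    refine le_levelGap hne hne' fun a ha b hb => ?_
    rw [indicatorSum, indicatorSum, ← Finset.sum_sub_distrib]
    have hnn : ∀ τ ∈ Finset.univ, 0 ≤ (T τ).indicator (fun _ => c τ) a
        - (T τ).indicator (fun _ => c τ) b := by
      intro τ _
      rw [sub_nonneg]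
      by_cases hτ : c τ = 0
      · simp [Set.indicator, hτ]
      rcases hcomp σ τ h0 hτ with h | h
      · rw [Set.indicator_of_mem (h ha)]
        exact Set.indicator_le_self' (fun _ _ => hc.1 τ) _
      · rw [Set.indicator_of_notMem fun hb' => hb (h hb')]
        exact Set.indicator_nonneg (fun _ _ => hc.1 τ) _
    refine le_trans ?_ (Finset.single_le_sum hnn (Finset.mem_univ σ))
    simp [ha, hb]

/-- The order complex of a poset of proper nonempty subsets of `N` is a retract of every space of
functions on `N` which contains all the convex combinations of indicators of chains and all of whose
members have a set of the poset among their superlevel sets. -/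
theorem kconn_orderComplex_of_levelGap [Finite N] {Q : Set α} {T : α → Set N}
    (hT : ∀ σ ∈ Q, ∀ τ ∈ Q, σ ≤ τ ↔ T σ ⊆ T τ)
    (hne : ∀ σ ∈ Q, (T σ).Nonempty) (hne' : ∀ σ ∈ Q, (T σ)ᶜ.Nonempty) {Y : Set (N → ℝ)}
    (hY : ∀ x ∈ Y, ∃ σ ∈ Q, 0 < levelGap (T σ) x)
    (hYQ : ∀ c ∈ orderComplex Q, indicatorSum T c ∈ Y) {k : ℤ} (hk : KConn ↥Y k) :
    KConn ↥(orderComplex Q) k := by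
  classical
  let wt : α → (N → ℝ) → ℝ := fun σ x => if σ ∈ Q then levelGap (T σ) x else 0
  have hwt : ∀ σ x, 0 ≤ wt σ x := fun σ x => by
    simp only [wt]
    split_ifs
    exacts [levelGap_nonneg _ _, le_rfl]
  have hwtc : ∀ σ, Continuous (wt σ) := fun σ => by
    simp only [wt]
    split_ifs
    exacts [continuous_levelGap _, continuous_const]
  have hpos : ∀ x ∈ Y, 0 < ∑ σ, wt σ x := fun x hx => by
    obtain ⟨σ, hσ, h⟩ := hY x hx
    exact Finset.sum_pos' (fun σ _ => hwt σ x) ⟨σ, Finset.mem_univ _, by simpa [wt, hσ] using h⟩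
  have hmem : ∀ x : Y, (fun σ => wt σ x / ∑ τ, wt τ x) ∈ orderComplex Q := by
    intro x
    have hsupp : ∀ σ ∈ Function.support (fun σ => wt σ x / ∑ τ, wt τ x),
        σ ∈ Q ∧ 0 < levelGap (T σ) x := by
      intro σ hσ
      have hσ' : wt σ x ≠ 0 := fun h => hσ (by simp [h])
      by_cases hQ : σ ∈ Q
      · exact ⟨hQ, lt_of_le_of_ne (levelGap_nonneg _ _) (by simpa [wt, hQ] using hσ'.symm)⟩
      · simp [wt, hQ] at hσ'
    refine ⟨fun σ => div_nonneg (hwt _ _) (hpos _ x.2).le, Set.toFinite _,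
      fun σ hσ => (hsupp σ hσ).1, ?_, ?_⟩
    · intro σ hσ τ hτ _
      obtain ⟨hσQ, hσ⟩ := hsupp σ hσ
      obtain ⟨hτQ, hτ⟩ := hsupp τ hτ
      change σ ≤ τ ∨ τ ≤ σ
      rw [hT _ hσQ _ hτQ, hT _ hτQ _ hσQ]
      by_contra! h
      obtain ⟨⟨p, hp, hp'⟩, q, hq, hq'⟩ := h.imp Set.not_subset.1 Set.not_subset.1
      exact lt_asymm (lt_of_levelGap_pos hσ hp hq') (lt_of_levelGap_pos hτ hq hp')
    · rw [finsum_eq_sum_of_fintype, ← Finset.sum_div, div_self (hpos _ x.2).ne']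
  refine hk.of_retract
    ⟨fun c => ⟨indicatorSum T c, hYQ c c.2⟩, ?_⟩
    ⟨fun x => ⟨fun σ => wt σ x / ∑ τ, wt τ x, hmem x⟩, ?_⟩ fun c => ?_
  · refine Continuous.subtype_mk (continuous_pi fun e => continuous_finsetSum _ fun σ _ => ?_) _
    by_cases he : e ∈ T σ
    · simp only [Set.indicator_of_mem he]
      exact (continuous_apply σ).comp continuous_subtype_val
    · simp only [Set.indicator_of_notMem he]
      exact continuous_const
  · refine Continuous.subtype_mk (continuous_pi fun σ => Continuous.div ?_ ?_ ?_) _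
    · exact (hwtc σ).comp continuous_subtype_val
    · exact continuous_finsetSum _ fun τ _ => (hwtc τ).comp continuous_subtype_val
    · exact fun x => (hpos _ x.2).ne'
  · have h : ∀ σ, wt σ (indicatorSum T c) = (c : α → ℝ) σ := fun σ => by
      by_cases hσ : σ ∈ Q
      · simpa [wt, hσ] using levelGap_indicatorSum hT c.2 hσ (hne σ hσ) (hne' σ hσ)
      · simp only [wt, hσ, if_false]
        by_contra h
        exact hσ (c.2.2.2.1 (Ne.symm h))
    ext σ
    change wt σ (indicatorSum T c) / ∑ τ, wt τ (indicatorSum T c) = (c : α → ℝ) σ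
    simp only [h, sum_eq_one_of_mem_orderComplex c.2, div_one]

end OrderComplex

section Weights

variable {N : Type*} [Fintype N]

open MeasureTheory in
/-- If a linear function exceeds `t` on average over the levels of `x`, then some superlevel set
of `x` has weight greater than `t`. -/
theorem exists_superlevel_weight_gt {w x : N → ℝ} {t : ℝ} {a b : N} (ha : ∀ e, x a ≤ x e)
    (hb : ∀ e, x e ≤ x b)
    (h : 0 < ∑ e, w e * x e - (∑ e, w e - t) * x a - t * x b) :
    ∃ s, x a < s ∧ s ≤ x b ∧ t < ∑ e, {e | s ≤ x e}.indicator w e := by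
  by_contra! hle
  have hint : ∀ e, IntervalIntegrable ({s | s ≤ x e}.indicator fun _ => w e) volume (x a) (x b) :=
    fun e => by
      rw [intervalIntegrable_iff]
      exact (integrableOn_const (by simp)).indicator measurableSet_Iic
  have hval : ∀ e, ∫ s in x a..x b, {s | s ≤ x e}.indicator (fun _ => w e) s =
      w e * (x e - x a) := fun e => by
    rw [intervalIntegral.integral_indicator ⟨ha e, hb e⟩, intervalIntegral.integral_const,
      smul_eq_mul, mul_comm]
  have hsum : IntervalIntegrable (fun s => ∑ e, {s | s ≤ x e}.indicator (fun _ => w e) s)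
      volume (x a) (x b) := by
    simpa only [Finset.sum_fn] using IntervalIntegrable.sum Finset.univ fun e _ => hint e
  have key : ∫ s in x a..x b, ((∑ e, {s | s ≤ x e}.indicator (fun _ => w e) s) - t) =
      ∑ e, w e * x e - (∑ e, w e - t) * x a - t * x b := by
    rw [intervalIntegral.integral_sub hsum (by simp),
      intervalIntegral.integral_finsetSum fun e _ => hint e]
    simp only [hval, mul_sub, Finset.sum_sub_distrib, ← Finset.sum_mul,
      intervalIntegral.integral_const, smul_eq_mul]
    ring
  rw [← key, intervalIntegral.integral_of_le (ha b)] at h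
  refine absurd h (not_lt.2 (setIntegral_nonpos measurableSet_Ioc fun s hs => ?_))
  have := hle s hs.1 hs.2
  simp only [Set.indicator, Set.mem_ofPred_eq] at this ⊢
  linarith

variable {α : Type*} [PartialOrder α] [Fintype α]

/-- If `Q` is isomorphic to the poset of all proper nonempty subsets of `N`, its order complex
is a sphere, which is highly connected. -/
theorem kconn_orderComplex_of_forall {Q : Set α} {T : α → Set N}
    (hT : ∀ σ ∈ Q, ∀ τ ∈ Q, σ ≤ τ ↔ T σ ⊆ T τ)
    (hne : ∀ σ ∈ Q, (T σ).Nonempty) (hne' : ∀ σ ∈ Q, (T σ)ᶜ.Nonempty)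
    (hQ : ∀ S : Set N, S.Nonempty → Sᶜ.Nonempty → ∃ σ ∈ Q, T σ = S) :
    KConn ↥(orderComplex Q) ((Fintype.card N : ℤ) - 3) := by
  let L : Submodule ℝ (N → ℝ) := Submodule.span ℝ {fun _ => 1}
  have hL : ∀ x, x ∈ L ↔ ∃ r : ℝ, ∀ e, x e = r := fun x => by
    simp only [L, Submodule.mem_span_singleton, funext_iff, Pi.smul_apply, smul_eq_mul, mul_one,
      eq_comm]
  refine kconn_orderComplex_of_levelGap hT hne hne' (Y := (L : Set (N → ℝ))ᶜ) ?_ ?_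
    (kconn_compl_submodule L ?_)
  · intro x hx
    obtain ⟨p, q, hpq⟩ : ∃ p q, x p < x q := by
      by_contra! h
      refine hx ((hL x).2 ?_)
      cases isEmpty_or_nonempty N
      · exact ⟨0, fun e => isEmptyElim e⟩
      · exact ⟨x (Classical.arbitrary N), fun e => le_antisymm (h _ _) (h _ _)⟩
    obtain ⟨σ, hσ, hS⟩ := hQ {e | x p < x e} ⟨q, hpq⟩ ⟨p, lt_irrefl (x p)⟩
    refine ⟨σ, hσ, levelGap_pos (hne σ hσ) (hne' σ hσ) ?_⟩
    rw [hS]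
    exact fun a ha b hb => (not_lt.1 hb).trans_lt ha
  · intro c hc hmem
    obtain ⟨r, hr⟩ := (hL _).1 hmem
    obtain ⟨σ, hσ, hpos⟩ := exists_pos_of_mem_orderComplex hc
    rw [← levelGap_indicatorSum hT hc hσ (hne σ hσ) (hne' σ hσ)] at hpos
    obtain ⟨p, hp⟩ := hne σ hσ
    obtain ⟨q, hq⟩ := hne' σ hσ
    have := lt_of_levelGap_pos hpos hp hq
    rw [hr, hr] at this
    exact lt_irrefl _ this
  · have : Module.finrank ℝ L ≤ 1 := (finrank_span_le_card _).trans (by simp)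
    rw [Module.finrank_fintype_fun_eq_card]
    omega

/-- If some proper nonempty subset of `N` has weight at most `t`, the order complex of the poset of
those of weight greater than `t` is a retract of a star-shaped set. -/
theorem kconn_orderComplex_of_exists_le {Q : Set α} {T : α → Set N} {w : N → ℝ} {t : ℝ}
    (hT : ∀ σ ∈ Q, ∀ τ ∈ Q, σ ≤ τ ↔ T σ ⊆ T τ)
    (hne : ∀ σ ∈ Q, (T σ).Nonempty) (hne' : ∀ σ ∈ Q, (T σ)ᶜ.Nonempty)
    (hQt : ∀ σ ∈ Q, t < ∑ e, (T σ).indicator w e)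
    (hQ : ∀ S : Set N, S.Nonempty → Sᶜ.Nonempty → t < ∑ e, S.indicator w e → ∃ σ ∈ Q, T σ = S)
    (ht0 : t ≤ 0) (htw : t ≤ ∑ e, w e) {P : Set N} (hP : P.Nonempty) (hP' : Pᶜ.Nonempty)
    (hPt : ∑ e, P.indicator w e ≤ t) (hPw : ∑ e, Pᶜ.indicator w e ≠ 0) (k : ℤ) :
    KConn ↥(orderComplex Q) k := by
  let G : N → N → (N → ℝ) → ℝ := fun a b x =>
    ∑ e, w e * x e - (∑ e, w e - t) * x a - t * x b
  let v : N → ℝ := fun e => -P.indicator 1 e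
  have hwv : ∑ e, w e * v e = -∑ e, P.indicator w e := by
    rw [← Finset.sum_neg_distrib]
    refine Finset.sum_congr rfl fun e _ => ?_
    by_cases he : e ∈ P <;> simp [v, he]
  have hv : ∃ a b, 0 < G a b v := by
    obtain ⟨a, ha⟩ := hP
    obtain ⟨b, hb⟩ := hP'
    have hva : v a = -1 := by simp [v, ha]
    have hvb : v b = 0 := by simpa [v] using hb
    refine ⟨a, b, ?_⟩
    have hsplit : ∑ e, P.indicator w e + ∑ e, Pᶜ.indicator w e = ∑ e, w e := by
      rw [← Finset.sum_add_distrib]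
      exact Finset.sum_congr rfl fun e _ => congrFun (Set.indicator_self_add_compl P w) e
    have : 0 < ∑ e, Pᶜ.indicator w e := lt_of_le_of_ne (by linarith) (Ne.symm hPw)
    simp only [G, hva, hvb, hwv]
    linarith
  refine kconn_orderComplex_of_levelGap hT hne hne' (Y := {x | ∃ a b, 0 < G a b x}) ?_ ?_
    (kconn_of_starConvex (v := v) ?_ ?_ k)
  · rintro x ⟨p, q, hpq⟩
    have : Nonempty N := ⟨p⟩
    obtain ⟨a, ha⟩ := Finite.exists_min x
    obtain ⟨b, hb⟩ := Finite.exists_max x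
    have h : 0 < G a b x := by
      simp only [G] at hpq ⊢
      nlinarith [mul_le_mul_of_nonneg_left (ha p) (sub_nonneg.2 htw),
        mul_le_mul_of_nonneg_left (hb q) (neg_nonneg.2 ht0)]
    obtain ⟨s, has, hsb, hs⟩ := exists_superlevel_weight_gt ha hb h
    obtain ⟨σ, hσ, hS⟩ := hQ {e | s ≤ x e} ⟨b, hsb⟩ ⟨a, not_le.2 has⟩ hs
    refine ⟨σ, hσ, levelGap_pos (hne σ hσ) (hne' σ hσ) ?_⟩
    rw [hS]
    exact fun a ha b hb => (not_le.1 hb).trans_le ha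
  · intro c hc
    obtain ⟨ρ, hρ, hρpos⟩ := exists_pos_of_mem_orderComplex hc
    have : Nonempty N := (hne ρ hρ).to_type
    set x := indicatorSum T c with hx
    obtain ⟨a, ha⟩ := Finite.exists_min x
    obtain ⟨b, hb⟩ := Finite.exists_max x
    have hgap : ∀ σ, c σ ≠ 0 → ∀ p ∈ T σ, ∀ q ∉ T σ, x q < x p := fun σ hσ p hp q hq => by
      have hσQ := hc.2.2.1 hσ
      refine lt_of_levelGap_pos ?_ hp hq
      rw [levelGap_indicatorSum hT hc hσQ (hne σ hσQ) (hne' σ hσQ)]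
      exact lt_of_le_of_ne (hc.1 σ) (Ne.symm hσ)
    have hxa : x a = 0 := Finset.sum_eq_zero fun σ _ => by
      by_cases hσ : c σ = 0
      · simp [Set.indicator, hσ]
      refine Set.indicator_of_notMem (fun haσ => ?_) _
      obtain ⟨q, hq⟩ := hne' σ (hc.2.2.1 hσ)
      exact absurd (hgap σ hσ a haσ q hq) (not_lt.2 (ha q))
    have hxb : x b = 1 := by
      rw [← sum_eq_one_of_mem_orderComplex hc]
      refine Finset.sum_congr rfl fun σ _ => ?_
      by_cases hσ : c σ = 0
      · simp [Set.indicator, hσ]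
      refine Set.indicator_of_mem ?_ _
      by_contra hbσ
      obtain ⟨q, hq⟩ := hne σ (hc.2.2.1 hσ)
      exact absurd (hgap σ hσ q hq b hbσ) (not_lt.2 (hb q))
    have hsum : ∑ e, w e * x e = ∑ σ, c σ * ∑ e, (T σ).indicator w e := by
      simp only [hx, indicatorSum, Finset.mul_sum]
      rw [Finset.sum_comm]
      refine Finset.sum_congr rfl fun σ _ => Finset.sum_congr rfl fun e _ => ?_
      by_cases he : e ∈ T σ <;> simp [he, mul_comm]
    have hlt : ∑ σ, c σ * t < ∑ σ, c σ * ∑ e, (T σ).indicator w e := by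
      refine Finset.sum_lt_sum (fun σ _ => ?_)
        ⟨ρ, Finset.mem_univ _, mul_lt_mul_of_pos_left (hQt ρ hρ) hρpos⟩
      by_cases hσ : c σ = 0
      · simp [hσ]
      · exact mul_le_mul_of_nonneg_left (hQt σ (hc.2.2.1 hσ)).le (hc.1 σ)
    rw [← Finset.sum_mul, sum_eq_one_of_mem_orderComplex hc, one_mul, ← hsum] at hlt
    exact ⟨a, b, by simp only [G, hxa, hxb]; linarith⟩
  · exact hv
  · rintro x ⟨a, b, hab⟩ s ⟨hs0, hs1⟩
    rcases hs1.eq_or_lt with rfl | hs1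
    · simpa using hv
    refine ⟨a, b, ?_⟩
    have hlin : ∑ e, w e * ((1 - s) • x + s • v) e =
        (1 - s) * ∑ e, w e * x e + s * ∑ e, w e * v e := by
      simp only [Finset.mul_sum, ← Finset.sum_add_distrib]
      refine Finset.sum_congr rfl fun e _ => ?_
      simp only [Pi.add_apply, Pi.smul_apply, smul_eq_mul]
      ring
    have hadd : G a b ((1 - s) • x + s • v) = (1 - s) * G a b x + s * G a b v := by
      dsimp only [G]
      rw [hlin]
      simp only [Pi.add_apply, Pi.smul_apply, smul_eq_mul]
      ring
    have hva : 0 ≤ -v a := by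
      by_cases h : a ∈ P <;> simp [v, h]
    have hvb : -v b ≤ 1 := by
      by_cases h : b ∈ P <;> simp [v, h]
    have hGv : 0 ≤ G a b v := by
      simp only [G, hwv]
      nlinarith [mul_nonneg (sub_nonneg.2 htw) hva,
        mul_nonneg (neg_nonneg.2 ht0) (sub_nonneg.2 hvb)]
    rw [hadd]
    exact add_pos_of_pos_of_nonneg (mul_pos (sub_pos.2 hs1) hab) (mul_nonneg hs0 hGv)

end Weights

section FilteredLattice

variable {n : ℕ} (ω : Fin n → ℝ)

theorem wsum_empty : wsum ω ∅ = 0 := by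
  simp [wsum]

theorem wsum_singleton (e : Fin n) : wsum ω {e} = ω e := by
  simp [wsum]

theorem wsum_union {σ τ : Set (Fin n)} (h : Disjoint σ τ) :
    wsum ω (σ ∪ τ) = wsum ω σ + wsum ω τ :=
  finsum_mem_union h σ.toFinite τ.toFinite

theorem wsum_image_val {A : Set (Fin n)} [Fintype A] (S : Set A) :
    wsum ω (Subtype.val '' S) = ∑ e, S.indicator (fun e => ω e) e := by
  rw [wsum, finsum_mem_image Subtype.val_injective.injOn, finsum_mem_def,
    finsum_eq_sum_of_fintype]

theorem wsum_union_image_val {μ ν : Set (Fin n)} [Fintype ↥(ν \ μ)] (S : Set ↥(ν \ μ)) :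
    wsum ω (μ ∪ Subtype.val '' S) = wsum ω μ + ∑ e, S.indicator (fun e => ω e) e := by
  rw [wsum_union, wsum_image_val]
  rw [Set.disjoint_right]
  rintro _ ⟨e, -, rfl⟩
  exact e.2.2

variable {ω} {t : ℝ}

theorem le_wsum_of_mem_bot (ht : t ≤ min 0 (wsum ω Set.univ)) {μ : Set (Fin n)}
    (hμ : μ ∈ Bgt ω t ∪ {∅}) : t ≤ wsum ω μ := by
  rcases hμ with hμ | rfl
  · exact hμ.2.2.le
  · rw [wsum_empty]
    exact ht.trans (min_le_left _ _)

theorem le_wsum_of_mem_top (ht : t ≤ min 0 (wsum ω Set.univ)) {ν : Set (Fin n)}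
    (hν : ν ∈ Bgt ω t ∪ {Set.univ}) : t ≤ wsum ω ν := by
  rcases hν with hν | rfl
  · exact hν.2.2.le
  · exact ht.trans (min_le_right _ _)

/-- Open intervals of the filtered Boolean lattice, with bottom and top added, are highly
connected. -/
theorem kconn_orderComplex_interval
    (hgen : ∀ σ : Set (Fin n), σ.Nonempty → σ ≠ Set.univ → wsum ω σ ≠ 0)
    (ht : t ≤ min 0 (wsum ω Set.univ)) {μ ν : Set (Fin n)} (hμ : μ ∈ Bgt ω t ∪ {∅})
    (hν : ν ∈ Bgt ω t ∪ {Set.univ}) (hμν : μ ⊂ ν) :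
    KConn (↥(orderComplex {σ | σ ∈ Bgt ω t ∧ μ ⊂ σ ∧ σ ⊂ ν}))
      ((ν.ncard : ℤ) - (μ.ncard : ℤ) - 3) := by
  classical
  let N := ↥(ν \ μ)
  let T : Set (Fin n) → Set N := fun σ => Subtype.val ⁻¹' σ
  have hunion : ∀ σ, μ ⊆ σ → σ ⊆ ν → μ ∪ Subtype.val '' T σ = σ := fun σ h1 h2 => by
    ext e
    constructor
    · rintro (he | ⟨r, hr, rfl⟩)
      exacts [h1 he, hr]
    · intro he
      by_cases heμ : e ∈ μ
      exacts [Or.inl heμ, Or.inr ⟨⟨e, h2 he, heμ⟩, he, rfl⟩]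
  have hTunion : ∀ S : Set N, T (μ ∪ Subtype.val '' S) = S := fun S => by
    ext e
    refine ⟨?_, fun he => Or.inr ⟨e, he, rfl⟩⟩
    rintro (he | ⟨r, hr, hre⟩)
    exacts [absurd he e.2.2, Subtype.val_injective hre ▸ hr]
  have hsum : ∀ σ, μ ⊆ σ → σ ⊆ ν →
      ∑ e, (T σ).indicator (fun e : N => ω e) e = wsum ω σ - wsum ω μ := fun σ h1 h2 => by
    rw [eq_sub_iff_add_eq', ← wsum_union_image_val, hunion σ h1 h2]
  have hT : ∀ σ ∈ {σ | σ ∈ Bgt ω t ∧ μ ⊂ σ ∧ σ ⊂ ν}, ∀ τ ∈ {σ | σ ∈ Bgt ω t ∧ μ ⊂ σ ∧ σ ⊂ ν},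
      σ ≤ τ ↔ T σ ⊆ T τ := fun σ hσ τ hτ => by
    refine ⟨fun h => Set.preimage_mono h, fun h => ?_⟩
    rw [← hunion σ hσ.2.1.1 hσ.2.2.1, ← hunion τ hτ.2.1.1 hτ.2.2.1]
    exact Set.union_subset_union_right _ (Set.image_mono h)
  have hne : ∀ σ ∈ {σ | σ ∈ Bgt ω t ∧ μ ⊂ σ ∧ σ ⊂ ν}, (T σ).Nonempty := fun σ hσ => by
    obtain ⟨e, he, he'⟩ := Set.exists_of_ssubset hσ.2.1
    exact ⟨⟨e, hσ.2.2.1 he, he'⟩, he⟩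
  have hne' : ∀ σ ∈ {σ | σ ∈ Bgt ω t ∧ μ ⊂ σ ∧ σ ⊂ ν}, (T σ)ᶜ.Nonempty := fun σ hσ => by
    obtain ⟨e, he, he'⟩ := Set.exists_of_ssubset hσ.2.2
    exact ⟨⟨e, he, fun h => he' (hσ.2.1.1 h)⟩, he'⟩
  have hQ : ∀ S : Set N, S.Nonempty → Sᶜ.Nonempty →
      t - wsum ω μ < ∑ e, S.indicator (fun e : N => ω e) e →
        ∃ σ ∈ {σ | σ ∈ Bgt ω t ∧ μ ⊂ σ ∧ σ ⊂ ν}, T σ = S := by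
    rintro S ⟨p, hp⟩ ⟨q, hq⟩ hS
    have hpS : p.1 ∈ μ ∪ Subtype.val '' S := Or.inr ⟨p, hp, rfl⟩
    have hqS : q.1 ∉ μ ∪ Subtype.val '' S := by
      rintro (h | ⟨r, hr, hrq⟩)
      · exact q.2.2 h
      · exact hq (Subtype.val_injective hrq ▸ hr)
    refine ⟨μ ∪ Subtype.val '' S, ⟨⟨⟨p, hpS⟩, fun h => hqS (h ▸ Set.mem_univ _), ?_⟩,
      ⟨Set.subset_union_left, fun h => p.2.2 (h hpS)⟩, ?_, fun h => hqS (h q.2.1)⟩, hTunion S⟩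
    · rw [wsum_union_image_val]
      linarith
    · rintro e (he | ⟨r, -, rfl⟩)
      exacts [hμν.1 he, r.2.1]
  by_cases hall : ∀ S : Set N, S.Nonempty → Sᶜ.Nonempty →
      t - wsum ω μ < ∑ e, S.indicator (fun e : N => ω e) e
  · have hcard : (Fintype.card N : ℤ) = (ν.ncard : ℤ) - (μ.ncard : ℤ) := by
      rw [← Nat.card_eq_fintype_card, Nat.card_coe_set_eq, eq_sub_iff_add_eq]
      exact_mod_cast Set.ncard_sdiff_add_ncard_of_subset hμν.1
    rw [← hcard]
    exact kconn_orderComplex_of_forall hT hne hne' fun S h h' => hQ S h h' (hall S h h')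
  · push Not at hall
    obtain ⟨P, hP, hP', hPt⟩ := hall
    refine kconn_orderComplex_of_exists_le hT hne hne' (fun σ hσ => ?_) hQ
      (sub_nonpos.2 (le_wsum_of_mem_bot ht hμ)) ?_ hP hP' hPt ?_ _
    · rw [hsum σ hσ.2.1.1 hσ.2.2.1]
      exact sub_lt_sub_right hσ.1.2.2 _
    · have h := hsum ν hμν.1 subset_rfl
      rw [show T ν = Set.univ from Set.eq_univ_of_forall fun e => e.2.1, Set.indicator_univ] at h
      rw [h]
      exact sub_le_sub_right (le_wsum_of_mem_top ht hν) _
    · rw [← wsum_image_val]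
      obtain ⟨p, hp⟩ := hP
      refine hgen _ (hP'.image _) fun h => ?_
      obtain ⟨r, hr, hrp⟩ := h ▸ Set.mem_univ p.1
      exact hr (Subtype.val_injective hrp ▸ hp)

/-- The filtered Boolean lattice has no gaps: between two members whose cardinalities differ by at
least two there is a third. -/
theorem exists_mem_Bgt_between
    (hgen : ∀ σ : Set (Fin n), σ.Nonempty → σ ≠ Set.univ → wsum ω σ ≠ 0)
    (ht : t ≤ min 0 (wsum ω Set.univ)) {μ ν : Set (Fin n)} (hμ : μ ∈ Bgt ω t ∪ {∅})
    (hν : ν ∈ Bgt ω t ∪ {Set.univ}) (hμν : μ ⊆ ν) (hcard : μ.ncard + 2 ≤ ν.ncard) :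
    ∃ σ ∈ Bgt ω t, μ ⊂ σ ∧ σ ⊂ ν := by
  have hdiff := Set.ncard_sdiff_add_ncard_of_subset hμν
  obtain ⟨p, hp, q, hq, hpq⟩ := (Set.one_lt_ncard (Set.toFinite (ν \ μ))).1 (by omega)
  by_cases hpos : 0 < ω p
  · have hqσ : q ∉ insert p μ := by
      rintro (h | h)
      exacts [hpq h.symm, hq.2 h]
    refine ⟨insert p μ, ⟨⟨p, Set.mem_insert _ _⟩, fun h => hqσ (h ▸ Set.mem_univ q), ?_⟩,
      Set.ssubset_insert hp.2, Set.insert_subset hp.1 hμν, fun h => hqσ (h hq.1)⟩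
    rw [Set.insert_eq, wsum_union _ (Set.disjoint_singleton_left.2 hp.2), wsum_singleton]
    linarith [le_wsum_of_mem_bot ht hμ]
  · have hneg : ω p < 0 := by
      refine lt_of_le_of_ne (not_lt.1 hpos) fun h => hgen {p} ⟨p, rfl⟩ (fun h' => ?_) ?_
      · exact hpq (h' ▸ Set.mem_univ q : q ∈ ({p} : Set (Fin n))).symm
      · rw [wsum_singleton, h]
    refine ⟨ν \ {p}, ⟨⟨q, hq.1, hpq.symm⟩, fun h => (h ▸ Set.mem_univ p : p ∈ ν \ {p}).2 rfl, ?_⟩,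
      ⟨fun e he => ⟨hμν he, fun h => hp.2 (h ▸ he)⟩, fun h => hq.2 (h ⟨hq.1, hpq.symm⟩)⟩,
      Set.sdiff_subset, fun h => (h hp.1).2 rfl⟩
    have h := wsum_union ω (Set.disjoint_sdiff_left (s := {p}) (t := ν))
    rw [Set.sdiff_union_of_subset (Set.singleton_subset_iff.2 hp.1), wsum_singleton] at h
    linarith [le_wsum_of_mem_top ht hν]

theorem IsChain.subset_of_ncard_le {β : Type*} [Finite β] {C : Set (Set β)}
    (hC : IsChain (· ⊆ ·) C) {σ τ : Set β} (hσ : σ ∈ C) (hτ : τ ∈ C) (h : σ.ncard ≤ τ.ncard) :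
    σ ⊆ τ :=
  (hC.total hσ hτ).elim id fun h' => (Set.eq_of_subset_of_ncard_le h' h).ge

theorem ncard_of_maximal_isChain_Bgt (hn : 2 ≤ n)
    (hgen : ∀ σ : Set (Fin n), σ.Nonempty → σ ≠ Set.univ → wsum ω σ ≠ 0)
    (ht : t ≤ min 0 (wsum ω Set.univ)) {C : Set (Set (Fin n))} (hCB : C ⊆ Bgt ω t)
    (hC : IsChain (· ⊆ ·) C)
    (hmax : ∀ C', C' ⊆ Bgt ω t → IsChain (· ⊆ ·) C' → C ⊆ C' → C = C') :
    C.ncard = n - 1 := by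
  have hinj : Set.InjOn Set.ncard C := fun σ hσ τ hτ h =>
    (hC.subset_of_ncard_le hσ hτ h.le).antisymm (hC.subset_of_ncard_le hτ hσ h.ge)
  have huniv : (Set.univ : Set (Fin n)).ncard = n := by simp [Set.ncard_univ]
  have hD : IsChain (· ⊆ ·) (insert Set.univ (insert ∅ C)) :=
    (hC.insert fun σ _ _ => Or.inl (Set.empty_subset σ)).insert
      fun σ _ _ => Or.inr (Set.subset_univ σ)
  suffices h : Set.ncard '' C = Set.Icc 1 (n - 1) by
    rw [← hinj.ncard_image, h]
    simp [Set.ncard_eq_toFinset_card']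
  apply Set.Subset.antisymm
  · rintro _ ⟨σ, hσ, rfl⟩
    have h1 := (Set.ncard_pos σ.toFinite).2 (hCB hσ).1
    have h2 := Set.ncard_lt_ncard (Set.ssubset_univ_iff.2 (hCB hσ).2.1)
    rw [huniv] at h2
    exact ⟨h1, by omega⟩
  · rintro k ⟨hk1, hkn⟩
    by_contra hk
    have hk' : ∀ τ ∈ C, τ.ncard < k ∨ k < τ.ncard := fun τ hτ =>
      lt_or_gt_of_ne fun h => hk ⟨τ, hτ, h⟩
    obtain ⟨μ, ⟨hμ, hμk⟩, hμmax⟩ := Set.exists_max_image {σ ∈ insert ∅ C | σ.ncard < k} Set.ncard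
      (Set.toFinite _) ⟨∅, Set.mem_insert _ _, by rw [Set.ncard_empty]; omega⟩
    obtain ⟨ν, ⟨hν, hνk⟩, hνmin⟩ := Set.exists_min_image {σ ∈ insert Set.univ C | k < σ.ncard}
      Set.ncard (Set.toFinite _) ⟨Set.univ, Set.mem_insert _ _, by rw [huniv]; omega⟩
    have hμD : μ ∈ insert Set.univ (insert ∅ C) := Or.inr hμ
    have hνD : ν ∈ insert Set.univ (insert ∅ C) := hν.imp id Or.inr
    have hμB : μ ∈ Bgt ω t ∪ {∅} := hμ.elim Or.inr fun h => Or.inl (hCB h)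
    have hνB : ν ∈ Bgt ω t ∪ {Set.univ} := hν.elim Or.inr fun h => Or.inl (hCB h)
    obtain ⟨σ, hσ, hμσ, hσν⟩ := exists_mem_Bgt_between hgen ht hμB hνB
      (hD.subset_of_ncard_le hμD hνD (by omega)) (by omega)
    have hσC : σ ∈ C := by
      rw [hmax (insert σ C) (Set.insert_subset hσ hCB) (hC.insert fun τ hτ _ => ?_)
        (Set.subset_insert _ _)]
      · exact Set.mem_insert _ _
      · rcases hk' τ hτ with h | h
        · exact Or.inr ((hD.subset_of_ncard_le (Or.inr (Or.inr hτ)) hμD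
            (hμmax τ ⟨Or.inr hτ, h⟩)).trans hμσ.1)
        · exact Or.inl (hσν.1.trans (hD.subset_of_ncard_le hνD (Or.inr (Or.inr hτ))
            (hνmin τ ⟨Or.inr hτ, h⟩)))
    rcases hk' σ hσC with h | h
    · exact absurd (hμmax σ ⟨Or.inr hσC, h⟩) (not_le.2 (Set.ncard_lt_ncard hμσ))
    · exact absurd (hνmin σ ⟨Or.inr hσC, h⟩) (not_le.2 (Set.ncard_lt_ncard hσν))

end FilteredLattice

/-- **Filtered Boolean lattices are homotopy Cohen–Macaulay.** For `n ≥ 2`, a generic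
weight `ω` and `t ≤ min {0, ω·{1,…,n}}`:  (i) every maximal chain of `B^{>t}` has
exactly `n - 1` elements, (ii) every open interval of `B^{>t} ∪ {∅̂, 1̂}` is
`(|ν| - |μ| - 3)`-connected, and in particular `|Δ(B^{>t})|` is `(n-3)`-connected. -/
theorem filtered_boolean_lattice_homotopy_CM
    {n : ℕ} (hn : 2 ≤ n) (ω : Fin n → ℝ)
    (hgen : ∀ σ : Set (Fin n), σ.Nonempty → σ ≠ Set.univ → wsum ω σ ≠ 0)
    (t : ℝ) (ht : t ≤ min 0 (wsum ω Set.univ)) :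
    (∀ C : Set (Set (Fin n)),
        C ⊆ Bgt ω t → IsChain (· ⊆ ·) C →
        (∀ C', C' ⊆ Bgt ω t → IsChain (· ⊆ ·) C' → C ⊆ C' → C = C') →
        C.ncard = n - 1) ∧
    (∀ μ ∈ Bgt ω t ∪ {(∅ : Set (Fin n))},
      ∀ ν ∈ Bgt ω t ∪ {(Set.univ : Set (Fin n))}, μ ⊂ ν →
        KConn (↥(orderComplex {σ | σ ∈ Bgt ω t ∧ μ ⊂ σ ∧ σ ⊂ ν}))
          ((ν.ncard : ℤ) - (μ.ncard : ℤ) - 3)) ∧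
    KConn (↥(orderComplex (Bgt ω t))) ((n : ℤ) - 3) := by
  refine ⟨fun C hCB hC hmax => ncard_of_maximal_isChain_Bgt hn hgen ht hCB hC hmax,
    fun μ hμ ν hν hμν => kconn_orderComplex_interval hgen ht hμ hν hμν, ?_⟩
  have : Nonempty (Fin n) := ⟨⟨0, by omega⟩⟩
  have h := kconn_orderComplex_interval hgen ht (Or.inr rfl) (Or.inr rfl)
    (Set.ssubset_univ_iff.2 Set.empty_ne_univ)
  have hset : {σ | σ ∈ Bgt ω t ∧ ∅ ⊂ σ ∧ σ ⊂ Set.univ} = Bgt ω t := by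
    ext σ
    refine ⟨fun hσ => hσ.1, fun hσ => ⟨hσ, ?_, Set.ssubset_univ_iff.2 hσ.2.1⟩⟩
    exact Set.empty_ssubset.2 hσ.1
  rw [hset] at h
  simpa [Set.ncard_univ] using h
end
end

section
/- Let P and Q be finite posets and let φ: P → Q be an order-preserving map. Suppose that for every x ∈ Q there are integers m_x, ℓ_x ≥ −2 such that |Δ(φ^{−1}({p ∈ P : φ(p) ≤ x}))| is m_x-connected and |Δ({y ∈ Q : y > x})| is ℓ_x-connected. Set k = min_{x∈Q}(m_x + ℓ_x) + 2. Then |Δ(P)| is k-connected if and only if |Δ(Q)| is k-connected. -/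
open Function

noncomputable section

open Set Metric

/-- The restriction of `f` to the unit sphere extends to a map from the unit ball to `X`. -/
def ExtendsInto {D E : Type} [NormedAddCommGroup D] [TopologicalSpace E]
    (X : Set E) (f : D → E) : Prop :=
  ∃ g : D → E, Continuous g ∧ EqOn g f (sphere 0 1) ∧ MapsTo g (closedBall 0 1) X

/-- Every map from the unit sphere of `D` to `X` extends to the unit ball. -/
def Fills (D : Type) {E : Type} [NormedAddCommGroup D] [TopologicalSpace E] (X : Set E) : Prop :=
  ∀ f : D → E, Continuous f → MapsTo f (sphere 0 1) X → ExtendsInto X f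

/-- Spheres of dimension at most `n - 2` can be filled in `X`, i.e. `X` is `(n - 2)`-connected. -/
def FillsBelow (n : ℕ) {E : Type} [TopologicalSpace E] (X : Set E) : Prop :=
  ∀ j < n, Fills (Fin j → ℝ) X

section Extension

variable {D D' E E' : Type} [NormedAddCommGroup D] [NormedAddCommGroup D']
  [TopologicalSpace E] [TopologicalSpace E']

theorem ExtendsInto.congr {X : Set E} {f g : D → E} (h : ExtendsInto X f)
    (hfg : EqOn f g (sphere 0 1)) : ExtendsInto X g := by
  obtain ⟨k, hk, hkf, hkX⟩ := h
  exact ⟨k, hk, hkf.trans hfg, hkX⟩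

theorem fills_singleton (x : E) : Fills D ({x} : Set E) := fun _ _ hf =>
  ⟨fun _ => x, continuous_const, fun _ hz => (hf hz).symm, fun _ _ => rfl⟩

theorem Fills.of_linear {X : Set E} [NormedSpace ℝ D] [NormedSpace ℝ D']
    (e : D' ≃L[ℝ] D) (he : ∀ z, ‖e z‖ = ‖z‖) (h : Fills D X) : Fills D' X := by
  have he' : ∀ z, ‖e.symm z‖ = ‖z‖ := fun z => by rw [← he, e.apply_symm_apply]
  intro f hf hfX
  obtain ⟨g, hg, hgf, hgX⟩ := h (f ∘ e.symm) (hf.comp e.symm.continuous)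
    fun z hz => hfX (by simpa [he'] using hz)
  refine ⟨g ∘ e, hg.comp e.continuous, fun z hz => ?_, fun z hz => hgX (by simpa [he] using hz)⟩
  have := hgf (x := e z) (by simpa [he] using hz)
  simpa using this

theorem FillsBelow.fills {X : Set E} {n : ℕ} (h : FillsBelow n X) {κ : Type} [Fintype κ]
    (hκ : Fintype.card κ < n) : Fills (κ → ℝ) X := by
  let e := Fintype.equivFin κ
  refine Fills.of_linear (ContinuousLinearEquiv.piCongrLeft ℝ (fun _ => ℝ) e) ?_ (h _ hκ)
  intro z
  have hz : ∀ i, ContinuousLinearEquiv.piCongrLeft ℝ (fun _ => ℝ) e z i = z (e.symm i) := by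
    intro i
    obtain ⟨j, rfl⟩ := e.surjective i
    simp [ContinuousLinearEquiv.piCongrLeft]
  apply le_antisymm
  · refine (pi_norm_le_iff_of_nonneg (norm_nonneg _)).2 fun i => ?_
    rw [hz]; exact norm_le_pi_norm z _
  · refine (pi_norm_le_iff_of_nonneg (norm_nonneg _)).2 fun i => ?_
    have := norm_le_pi_norm (ContinuousLinearEquiv.piCongrLeft ℝ (fun _ => ℝ) e z) (e i)
    rwa [hz, e.symm_apply_apply] at this

variable [TietzeExtension.{0} E] [TietzeExtension.{0} E']

theorem exists_continuous_eqOn {Z : Type} [TopologicalSpace Z] [NormalSpace Z] {s : Set Z}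
    (hs : IsClosed s) {f : Z → E} (hf : ContinuousOn f s) :
    ∃ g : Z → E, Continuous g ∧ EqOn g f s := by
  obtain ⟨g, hg⟩ := ContinuousMap.exists_restrict_eq hs ⟨s.domRestrict f, hf.domRestrict⟩
  refine ⟨g, g.continuous, fun x hx => ?_⟩
  exact congrArg (fun k : C(s, E) => k ⟨x, hx⟩) hg

theorem Fills.extendsInto {X : Set E} (h : Fills D X) {f : D → E}
    (hf : ContinuousOn f (sphere 0 1)) (hX : MapsTo f (sphere 0 1) X) : ExtendsInto X f := by
  obtain ⟨g, hg, hgf⟩ := exists_continuous_eqOn isClosed_sphere hf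
  exact (h g hg (hX.congr hgf.symm)).congr hgf

/-- Homotopy extension: extendability over the ball is invariant under homotopy. -/
theorem ExtendsInto.of_homotopy [NormedSpace ℝ D] {X : Set E} {H : ℝ × D → E}
    (hc : ContinuousOn H (Icc 0 1 ×ˢ sphere 0 1)) (hX : MapsTo H (Icc 0 1 ×ˢ sphere 0 1) X)
    (h : ExtendsInto X fun z => H (1, z)) : ExtendsInto X fun z => H (0, z) := by
  obtain ⟨K, hK, hKH⟩ := exists_continuous_eqOn (isClosed_Icc.prod isClosed_sphere) hc
  obtain ⟨g, hg, hgH, hgX⟩ := h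
  have hsph : ∀ z : D, 1 / 2 ≤ ‖z‖ → (max ‖z‖ (1 / 2))⁻¹ • z ∈ sphere (0 : D) 1 := by
    intro z hz
    have hz0 : ‖z‖ ≠ 0 := by linarith
    rw [mem_sphere_zero_iff_norm, norm_smul, max_eq_left hz]
    simp [hz0]
  refine ⟨fun z => if ‖z‖ ≤ 1 / 2 then g ((2 : ℝ) • z) else
    K (2 - 2 * ‖z‖, (max ‖z‖ (1 / 2))⁻¹ • z), ?_, ?_, ?_⟩
  · refine Continuous.if_le (by fun_prop) ?_ (by fun_prop) (by fun_prop) ?_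
    · refine hK.comp (Continuous.prodMk (by fun_prop) (Continuous.smul ?_ continuous_id))
      refine Continuous.inv₀ (by fun_prop) fun z => ?_
      have : (1 / 2 : ℝ) ≤ max ‖z‖ (1 / 2) := le_max_right _ _
      linarith
    · intro z hz
      have h2 : (max ‖z‖ (1 / 2))⁻¹ • z = (2 : ℝ) • z := by rw [hz]; norm_num
      have hs := hsph z hz.ge
      rw [h2] at hs
      rw [h2, hgH hs, hz]
      norm_num
      exact (hKH ⟨by norm_num, hs⟩).symm
  · intro z hz
    have hz1 : ‖z‖ = 1 := by simpa using hz
    have hm : max ‖z‖ (1 / 2) = 1 := by rw [hz1]; norm_num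
    have : ¬ ‖z‖ ≤ 1 / 2 := by rw [hz1]; norm_num
    norm_num [hz1]
    exact hKH ⟨by norm_num, hz⟩
  · intro z hz
    have hz1 : ‖z‖ ≤ 1 := by simpa using hz
    by_cases h : ‖z‖ ≤ 1 / 2
    · simp only [h, if_true]
      apply hgX
      rw [mem_closedBall_zero_iff, norm_smul]
      norm_num
      linarith
    · simp only [h, if_false]
      have hm : (2 - 2 * ‖z‖, (max ‖z‖ (1 / 2))⁻¹ • z) ∈ Icc (0 : ℝ) 1 ×ˢ sphere (0 : D) 1 :=
        ⟨⟨by linarith, by linarith⟩, hsph z (by linarith)⟩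
      rw [hKH hm]
      exact hX hm

/-- A domination `r ∘ i = id` transfers fillability. -/
theorem Fills.of_retract {X : Set E} {Y : Set E'} {i : E → E'} {r : E' → E}
    (hi : ContinuousOn i X) (hr : ContinuousOn r Y) (hiX : MapsTo i X Y) (hrY : MapsTo r Y X)
    (hri : ∀ x ∈ X, r (i x) = x) (h : Fills D Y) : Fills D X := by
  intro f hf hfX
  obtain ⟨g, hg, hgf, hgY⟩ := h.extendsInto (f := i ∘ f) (hi.comp hf.continuousOn hfX)
    (hiX.comp hfX)
  obtain ⟨k, hk, hkg⟩ := exists_continuous_eqOn isClosed_closedBall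
    (hr.comp hg.continuousOn hgY)
  refine ⟨k, hk, fun z hz => ?_, (hrY.comp hgY).congr hkg.symm⟩
  rw [hkg (sphere_subset_closedBall hz), comp_apply, hgf hz]
  exact hri _ (hfX hz)

/-- If `X` deforms inside itself into `Y ⊆ X`, fillability in `Y` implies fillability in `X`. -/
theorem Fills.of_deformation [NormedSpace ℝ D] {X Y : Set E} (hYX : Y ⊆ X) {r : ℝ × E → E}
    (hc : ContinuousOn r (Icc 0 1 ×ˢ X)) (h0 : ∀ x ∈ X, r (0, x) = x)
    (hX : MapsTo r (Icc 0 1 ×ˢ X) X) (h1 : ∀ x ∈ X, r (1, x) ∈ Y) (h : Fills D Y) :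
    Fills D X := by
  intro f hf hfX
  have hm : MapsTo (fun p : ℝ × D => (p.1, f p.2)) (Icc 0 1 ×ˢ sphere 0 1) (Icc 0 1 ×ˢ X) :=
    fun p hp => ⟨hp.1, hfX hp.2⟩
  have hH : ContinuousOn (fun p : ℝ × D => r (p.1, f p.2)) (Icc 0 1 ×ˢ sphere 0 1) :=
    hc.comp (by fun_prop) hm
  have hone : ExtendsInto Y fun z => r (1, f z) := by
    refine h.extendsInto ?_ fun z hz => h1 _ (hfX hz)
    exact hH.comp (f := fun z : D => ((1 : ℝ), z)) (by fun_prop) fun z hz => ⟨by simp, hz⟩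
  obtain ⟨g, hg, hgf, hgY⟩ := hone
  refine (ExtendsInto.of_homotopy hH (hX.comp hm) ⟨g, hg, hgf, hgY.mono_right hYX⟩).congr ?_
  exact fun z hz => h0 _ (hfX hz)

end Extension

section Grid

variable {ι : Type}

/-- The closed cell with index `e` of the cubical grid whose vertices are the even multiples
of `δ`: the coordinate `i` is `e i * δ` if `e i` is even, and within `δ` of it otherwise. -/
def gridCell (δ : ℝ) (e : ι → ℤ) : Set (ι → ℝ) :=
  {x | ∀ i, |x i - e i * δ| ≤ if Odd (e i) then δ else 0}

/-- `IsGridFace c e` means that the cell with index `c` is a face of the one with index `e`. -/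
def IsGridFace (c e : ι → ℤ) : Prop :=
  ∀ i, c i = e i ∨ (Odd (e i) ∧ |c i - e i| = 1)

/-- The index of the smallest closed cell containing a real number (for `δ = 1`). -/
def minIndex (t : ℝ) : ℤ := if (2 * ⌊t / 2⌋ : ℤ) = t then 2 * ⌊t / 2⌋ else 2 * ⌊t / 2⌋ + 1

/-- The index of the smallest closed cell containing a point. -/
def minCell (δ : ℝ) (x : ι → ℝ) : ι → ℤ := fun i => minIndex (x i / δ)

theorem abs_sub_minIndex_le (t : ℝ) :
    |t - minIndex t| ≤ if Odd (minIndex t) then 1 else 0 := by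
  unfold minIndex
  have h1 := Int.floor_le (t / 2)
  have h2 := Int.lt_floor_add_one (t / 2)
  split_ifs with h h' h'
  · rw [h]; simp
  · rw [h]; simp
  · push_cast
    rw [abs_le]; constructor <;> linarith
  · exact absurd (by simp) h'

theorem minIndex_eq_or {t : ℝ} {e : ℤ} (h : |t - e| ≤ if Odd e then 1 else 0) :
    minIndex t = e ∨ (Odd e ∧ |minIndex t - e| = 1 ∧ |t - e| = 1) := by
  split_ifs at h with ho
  · obtain ⟨k, rfl⟩ := ho
    rw [abs_le] at h
    push_cast at h
    by_cases h1 : t = 2 * k + 2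
    · right
      have hf : ⌊t / 2⌋ = k + 1 := by
        rw [Int.floor_eq_iff]; push_cast; constructor <;> linarith
      refine ⟨by simp, ?_, ?_⟩
      · rw [minIndex, if_pos (by rw [hf, h1]; push_cast; ring), hf]
        ring_nf; simp
      · rw [h1]; push_cast; ring_nf; simp
    · have hlt : t < 2 * k + 2 := lt_of_le_of_ne (by linarith) h1
      have hf : ⌊t / 2⌋ = k := by
        rw [Int.floor_eq_iff]; constructor <;> linarith
      by_cases h2 : t = 2 * k
      · right
        refine ⟨by simp, ?_, ?_⟩
        · rw [minIndex, if_pos (by rw [hf, h2]; push_cast; ring), hf]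
          ring_nf; simp
        · rw [h2]; push_cast; ring_nf; simp
      · left
        rw [minIndex, if_neg (by rw [hf]; push_cast; exact fun h => h2 h.symm), hf]
  · left
    have ht : t = e := by
      have := abs_nonpos_iff.1 h
      linarith
    obtain ⟨k, rfl⟩ := Int.not_odd_iff_even.1 ho
    have hf : ⌊t / 2⌋ = k := by
      rw [Int.floor_eq_iff, ht]; push_cast; constructor <;> linarith
    rw [minIndex, if_pos (by rw [hf, ht]; push_cast; ring), hf]
    ring

theorem mem_gridCell_iff {δ : ℝ} (hδ : 0 < δ) {e : ι → ℤ} {x : ι → ℝ} :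
    x ∈ gridCell δ e ↔ ∀ i, |x i / δ - e i| ≤ if Odd (e i) then 1 else 0 := by
  refine forall_congr' fun i => ?_
  have : x i / δ - e i = (x i - e i * δ) / δ := by field_simp
  rw [this, abs_div, abs_of_pos hδ, div_le_iff₀ hδ]
  split_ifs <;> simp

theorem mem_gridCell_minCell {δ : ℝ} (hδ : 0 < δ) (x : ι → ℝ) : x ∈ gridCell δ (minCell δ x) :=
  (mem_gridCell_iff hδ).2 fun _ => abs_sub_minIndex_le _

theorem isGridFace_minCell {δ : ℝ} (hδ : 0 < δ) {e : ι → ℤ} {x : ι → ℝ}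
    (hx : x ∈ gridCell δ e) : IsGridFace (minCell δ x) e := fun i =>
  (minIndex_eq_or ((mem_gridCell_iff hδ).1 hx i)).imp id fun h => ⟨h.1, h.2.1⟩

theorem IsGridFace.odd {c e : ι → ℤ} (h : IsGridFace c e) {i : ι} (hi : Odd (c i)) :
    Odd (e i) ∧ c i = e i := by
  rcases h i with h | ⟨ho, h⟩
  · exact ⟨h ▸ hi, h⟩
  · rcases (abs_eq one_pos.le).1 h with h | h <;> grind

theorem IsGridFace.gridCell_subset {δ : ℝ} (hδ : 0 < δ) {c e : ι → ℤ} (h : IsGridFace c e) :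
    gridCell δ c ⊆ gridCell δ e := by
  intro x hx i
  have hxi := hx i
  rcases h i with h | ⟨ho, h⟩
  · rw [← h]; exact hxi
  · have hne : ¬ Odd (c i) := by
      rcases (abs_eq one_pos.le).1 h with h | h <;> grind
    rw [if_neg hne] at hxi
    have hx0 : x i = c i * δ := by
      have := abs_nonpos_iff.1 hxi
      linarith
    have : x i - e i * δ = ((c i - e i : ℤ) : ℝ) * δ := by rw [hx0]; push_cast; ring
    rw [if_pos ho, this, abs_mul, ← Int.cast_abs, h, abs_of_pos hδ]
    simp

theorem isClosed_gridCell (δ : ℝ) (e : ι → ℤ) : IsClosed (gridCell δ e) := by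
  have : gridCell δ e = ⋂ i, {x : ι → ℝ | |x i - e i * δ| ≤ if Odd (e i) then δ else 0} := by
    ext x; simp [gridCell]
  rw [this]
  exact isClosed_iInter fun i => isClosed_le (by fun_prop) continuous_const

theorem convex_gridCell (δ : ℝ) (e : ι → ℤ) : Convex ℝ (gridCell δ e) := by
  have : gridCell δ e = ⋂ i, {x : ι → ℝ | x i ∈ closedBall ((e i : ℝ) * δ)
      (if Odd (e i) then δ else 0)} := by
    ext x; simp [gridCell, Real.dist_eq]
  rw [this]
  exact convex_iInter fun i =>
    (convex_closedBall _ _).linear_preimage (LinearMap.proj i : (ι → ℝ) →ₗ[ℝ] ℝ)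

theorem dist_le_of_mem_gridCell [Fintype ι] {δ : ℝ} (hδ : 0 < δ) {e : ι → ℤ} {x y : ι → ℝ}
    (hx : x ∈ gridCell δ e) (hy : y ∈ gridCell δ e) : dist x y ≤ 2 * δ := by
  refine (dist_pi_le_iff (by linarith)).2 fun i => ?_
  have h1 : |x i - e i * δ| ≤ δ := (hx i).trans (by split_ifs <;> linarith)
  have h2 : |y i - e i * δ| ≤ δ := (hy i).trans (by split_ifs <;> linarith)
  rw [abs_le] at h1 h2
  rw [Real.dist_eq, abs_le]
  constructor <;> linarith

/-- The relative boundary of a cell. -/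
def gridBoundary (δ : ℝ) (e : ι → ℤ) : Set (ι → ℝ) :=
  {x | x ∈ gridCell δ e ∧ ∃ i, Odd (e i) ∧ |x i - e i * δ| = δ}

theorem mem_gridBoundary_iff {δ : ℝ} (hδ : 0 < δ) {e : ι → ℤ} {x : ι → ℝ}
    (hx : x ∈ gridCell δ e) : x ∈ gridBoundary δ e ↔ minCell δ x ≠ e := by
  classical
  have key : ∀ i, |x i - e i * δ| = δ ↔ |x i / δ - e i| = 1 := fun i => by
    have : x i / δ - e i = (x i - e i * δ) / δ := by field_simp
    rw [this, abs_div, abs_of_pos hδ, div_eq_one_iff_eq hδ.ne']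
  constructor
  · rintro ⟨-, i, ho, hi⟩ h
    have hmem := mem_gridCell_minCell hδ x
    rw [key] at hi
    have hce : IsGridFace (Function.update e i (e i + 1)) e ∧
        IsGridFace (Function.update e i (e i - 1)) e := by
      constructor <;> intro j <;> by_cases hj : j = i
      · subst hj; right; simp [ho]
      · left; simp [hj]
      · subst hj; right; simp [ho]
      · left; simp [hj]
    have hupd : ∀ c : ℤ, ¬ Odd c → x i / δ = c → False := by
      intro c hc hxc
      have hx' : x ∈ gridCell δ (Function.update e i c) := by
        rw [mem_gridCell_iff hδ] at hx ⊢
        intro j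
        by_cases hj : j = i
        · subst hj; simp [hc, hxc]
        · simpa [hj] using hx j
      have := isGridFace_minCell hδ hx' i
      rw [h] at this
      simp only [Function.update_self] at this
      rcases this with h1 | h1
      · exact hc (h1 ▸ ho)
      · exact hc h1.1
    rcases (abs_eq one_pos.le).1 hi with hi | hi
    · exact hupd (e i + 1) (by grind) (by push_cast; linarith)
    · exact hupd (e i - 1) (by grind) (by push_cast; linarith)
  · intro h
    obtain ⟨i, hi⟩ : ∃ i, minCell δ x i ≠ e i := by
      by_contra! hcon
      exact h (funext hcon)
    rcases minIndex_eq_or ((mem_gridCell_iff hδ).1 hx i) with h1 | h1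
    · exact absurd h1 hi
    · exact ⟨hx, i, h1.1, (key i).2 h1.2.2⟩

theorem minCell_of_eq {δ : ℝ} (hδ : 0 < δ) {x : ι → ℝ} {i : ι} {c : ℤ} (hc : Even c)
    (hx : x i = c * δ) : minCell δ x i = c := by
  have h : |x i / δ - c| ≤ if Odd c then 1 else 0 := by
    rw [hx, mul_div_cancel_right₀ _ hδ.ne', sub_self, abs_zero]
    split_ifs <;> norm_num
  rcases minIndex_eq_or h with h | h
  · exact h
  · exact absurd h.1 (Int.not_odd_iff_even.2 hc)

/-- The finite set of cells of `[-n δ, n δ]^ι`. -/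
def gridBall [Fintype ι] (n : ℕ) : Finset (ι → ℤ) := by
  classical exact Fintype.piFinset fun _ => Finset.Icc (-(n : ℤ)) n

theorem mem_gridBall [Fintype ι] {n : ℕ} {e : ι → ℤ} :
    e ∈ gridBall n ↔ ∀ i, |e i| ≤ n := by
  simp [gridBall, abs_le]

section Ball

variable [Fintype ι] {n : ℕ} {δ : ℝ}

theorem IsGridFace.mem_gridBall (hn : Even n) {c e : ι → ℤ} (h : IsGridFace c e)
    (he : e ∈ gridBall n) : c ∈ gridBall n := by
  rw [_root_.mem_gridBall] at he ⊢
  intro i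
  have hi := he i
  rw [abs_le] at hi ⊢
  rcases h i with h | ⟨ho, h⟩
  · rwa [h]
  · obtain ⟨k, rfl⟩ := hn
    obtain ⟨l, hl⟩ := ho
    rcases (abs_eq one_pos.le).1 h with h | h <;> omega

theorem gridCell_subset_closedBall (hn : Even n) (hδ : 0 < δ) (hnδ : n * δ = 1) {e : ι → ℤ}
    (he : e ∈ gridBall n) : gridCell δ e ⊆ closedBall 0 1 := by
  intro x hx
  rw [mem_closedBall_zero_iff, pi_norm_le_iff_of_nonneg zero_le_one]
  intro i
  have hi := mem_gridBall.1 he i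
  have hxi := hx i
  rw [abs_le] at hi
  rw [Real.norm_eq_abs, abs_le]
  split_ifs at hxi with ho
  · have h1 : (-n + 1 : ℤ) ≤ e i ∧ e i ≤ n - 1 := by
      obtain ⟨k, rfl⟩ := hn
      obtain ⟨l, hl⟩ := ho
      omega
    have h2 : (-n + 1 : ℝ) ≤ e i ∧ (e i : ℝ) ≤ n - 1 := by exact_mod_cast h1
    rw [abs_le] at hxi
    constructor <;> nlinarith
  · have h2 : (-n : ℝ) ≤ e i ∧ (e i : ℝ) ≤ n := by exact_mod_cast hi
    have := abs_nonpos_iff.1 hxi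
    constructor <;> nlinarith

theorem minCell_mem_gridBall (hn : Even n) (hδ : 0 < δ) (hnδ : n * δ = 1) {x : ι → ℝ}
    (hx : x ∈ closedBall 0 1) : minCell δ x ∈ gridBall n := by
  rw [mem_gridBall]
  intro i
  have hxi : |x i| ≤ 1 := (norm_le_pi_norm x i).trans (by simpa using hx)
  have hmem := mem_gridCell_minCell hδ x i
  have hn' : Even (n : ℤ) := by exact_mod_cast hn
  by_cases h1 : x i = n * δ
  · rw [minCell_of_eq (c := n) hδ hn' (by simpa using h1)]; simp
  by_cases h2 : x i = -n * δ
  · rw [minCell_of_eq (c := -n) hδ hn'.neg (by simpa using h2)]; simp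
  rw [abs_le] at hxi
  have h1' : x i < n * δ := lt_of_le_of_ne (by linarith) h1
  have h2' : -n * δ < x i := lt_of_le_of_ne (by linarith) (Ne.symm h2)
  have hmem' : |x i - minCell δ x i * δ| ≤ δ := hmem.trans (by split_ifs <;> linarith)
  rw [abs_le] at hmem'
  rw [abs_le]
  have ha : (minCell δ x i : ℝ) * δ < (n + 1) * δ := by linarith
  have hb : (-n - 1) * δ < (minCell δ x i : ℝ) * δ := by linarith
  have ha' : (minCell δ x i : ℝ) < n + 1 := lt_of_mul_lt_mul_right ha hδ.le
  have hb' : (-n - 1 : ℝ) < minCell δ x i := lt_of_mul_lt_mul_right hb hδ.le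
  have ha'' : minCell δ x i < n + 1 := by exact_mod_cast ha'
  have hb'' : -n - 1 < minCell δ x i := by exact_mod_cast hb'
  omega

/-- The cells on the boundary of the cube. -/
def gridSphere (n : ℕ) : Finset (ι → ℤ) := by
  classical exact (gridBall n).filter fun e => ∃ i, |e i| = n

theorem mem_gridSphere {e : ι → ℤ} :
    e ∈ gridSphere n ↔ e ∈ gridBall n ∧ ∃ i, |e i| = n := by
  simp [gridSphere]

theorem IsGridFace.mem_gridSphere (hn : Even n) {c e : ι → ℤ} (h : IsGridFace c e)
    (he : e ∈ gridSphere n) : c ∈ gridSphere n := by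
  rw [_root_.mem_gridSphere] at he ⊢
  obtain ⟨he, i, hi⟩ := he
  refine ⟨h.mem_gridBall hn he, i, ?_⟩
  rcases h i with h | ⟨ho, h⟩
  · rwa [h]
  · obtain ⟨k, rfl⟩ := hn
    obtain ⟨l, hl⟩ := ho
    rcases (abs_eq (by positivity)).1 hi with h | h <;> push_cast at h <;> omega

theorem gridCell_subset_sphere (hn : Even n) (hδ : 0 < δ) (hnδ : n * δ = 1) {e : ι → ℤ}
    (he : e ∈ gridSphere n) : gridCell δ e ⊆ sphere 0 1 := by
  intro x hx
  obtain ⟨he, i, hi⟩ := mem_gridSphere.1 he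
  have h1 := gridCell_subset_closedBall hn hδ hnδ he hx
  rw [mem_closedBall_zero_iff] at h1
  rw [mem_sphere_zero_iff_norm]
  refine le_antisymm h1 ?_
  have hev : ¬ Odd (e i) := by
    rw [Int.not_odd_iff_even, ← even_abs, hi]; exact_mod_cast hn
  have hxi := hx i
  rw [if_neg hev] at hxi
  have hxe : x i = e i * δ := by
    have := abs_nonpos_iff.1 hxi
    linarith
  have : ‖x i‖ = 1 := by
    rw [hxe, Real.norm_eq_abs, abs_mul, ← Int.cast_abs, hi, abs_of_pos hδ]
    exact_mod_cast hnδ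
  rw [← this]; exact norm_le_pi_norm x i

theorem minCell_mem_gridSphere (hn : Even n) (hδ : 0 < δ) (hnδ : n * δ = 1) {x : ι → ℝ}
    (hx : x ∈ sphere 0 1) : minCell δ x ∈ gridSphere n := by
  refine mem_gridSphere.2 ⟨minCell_mem_gridBall hn hδ hnδ (sphere_subset_closedBall hx), ?_⟩
  have hn' : Even (n : ℤ) := by exact_mod_cast hn
  have hx1 : ‖x‖ = 1 := by simpa using hx
  obtain ⟨i, hi⟩ : ∃ i, 1 ≤ |x i| := by
    by_contra! hcon
    have : ‖x‖ < 1 := (pi_norm_lt_iff zero_lt_one).2 hcon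
    linarith
  have hle : |x i| ≤ 1 := (norm_le_pi_norm x i).trans hx1.le
  refine ⟨i, ?_⟩
  rcases (abs_eq zero_le_one).1 (le_antisymm hle hi) with h | h
  · rw [minCell_of_eq (c := n) hδ hn' (by simpa [hnδ] using h)]; simp
  · rw [minCell_of_eq (c := -n) hδ hn'.neg (by simpa [hnδ] using h)]; simp

/-- A grid that is fine with respect to a given open cover of a compact set. -/
theorem exists_fine_grid {s : Set (ι → ℝ)} (hs : IsCompact s) {κ : Type} [Nonempty κ]
    {c : κ → Set (ι → ℝ)} (hc : ∀ k, IsOpen (c k)) (hsc : s ⊆ ⋃ k, c k) :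
    ∃ (n : ℕ) (δ : ℝ), 4 ∣ n ∧ 0 < δ ∧ n * δ = 1 ∧
      ∀ e, ∃ k, gridCell δ e ∩ s ⊆ c k := by
  obtain ⟨ε, hε, h⟩ := lebesgue_number_lemma_of_metric hs hc hsc
  obtain ⟨N, hN⟩ := exists_nat_gt (1 / ε)
  have hN0 : (0 : ℝ) < N := lt_trans (by positivity) hN
  refine ⟨4 * N, 1 / (4 * N), ⟨N, rfl⟩, by positivity, by push_cast; field_simp, fun e => ?_⟩
  rcases (gridCell (1 / (4 * (N : ℝ))) e ∩ s).eq_empty_or_nonempty with h0 | ⟨x, hxe, hxs⟩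
  · exact ⟨Classical.arbitrary κ, by rw [h0]; exact empty_subset _⟩
  · obtain ⟨k, hk⟩ := h x hxs
    refine ⟨k, fun y hy => hk ?_⟩
    rw [mem_ball]
    refine (dist_le_of_mem_gridCell (by positivity) hy.1 hxe).trans_lt ?_
    rw [div_lt_iff₀ hε] at hN
    rw [mul_one_div, div_lt_iff₀ (by positivity)]
    linarith

end Ball

end Grid

section Carrier

variable {ι E : Type} [Fintype ι] [TopologicalSpace E] [TietzeExtension.{0} E]

/-- Extension of a map over one more cell. -/
theorem exists_extension_gridCell {δ : ℝ} (hδ : 0 < δ) {e : ι → ℤ} {C : Set (ι → ℝ)}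
    (hC : IsClosed C) (hCe : C ∩ gridCell δ e ⊆ gridBoundary δ e)
    {Y : Set E} (hY : Fills ({i // Odd (e i)} → ℝ) Y) {g : (ι → ℝ) → E} (hg : Continuous g)
    (hgY : MapsTo g (gridBoundary δ e) Y) :
    ∃ g' : (ι → ℝ) → E, Continuous g' ∧ EqOn g' g C ∧ MapsTo g' (gridCell δ e) Y := by
  classical
  let Φ : ({i // Odd (e i)} → ℝ) → ι → ℝ := fun y i =>
    if h : Odd (e i) then e i * δ + δ * y ⟨i, h⟩ else e i * δ
  let Ψ : (ι → ℝ) → {i // Odd (e i)} → ℝ := fun x j => (x j - e j * δ) / δ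
  have hΦ : Continuous Φ := by
    refine continuous_pi fun i => ?_
    by_cases h : Odd (e i)
    · simp only [Φ, h, dif_pos]; fun_prop
    · simp only [Φ, h, dif_neg, not_false_iff]; fun_prop
  have hΨ : Continuous Ψ := by
    refine continuous_pi fun j => ?_
    simp only [Ψ]; fun_prop
  have hΦΨ : ∀ x ∈ gridCell δ e, Φ (Ψ x) = x := by
    intro x hx
    funext i
    by_cases h : Odd (e i)
    · simp only [Φ, Ψ, h, dif_pos]; field_simp; ring
    · simp only [Φ, h, dif_neg, not_false_iff]
      have := hx i
      rw [if_neg h, abs_nonpos_iff] at this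
      linarith
  have hΦs : MapsTo Φ (sphere 0 1) (gridBoundary δ e) := by
    intro y hy
    have hy1 : ‖y‖ = 1 := by simpa using hy
    have hyle : ∀ i, |y i| ≤ 1 := fun i => (norm_le_pi_norm y i).trans hy1.le
    obtain ⟨j, hj⟩ : ∃ i, 1 ≤ |y i| := by
      by_contra! hcon
      have : ‖y‖ < 1 := (pi_norm_lt_iff zero_lt_one).2 hcon
      linarith
    refine ⟨fun i => ?_, j, j.2, ?_⟩
    · by_cases h : Odd (e i)
      · simp only [Φ, h, dif_pos, if_true, add_sub_cancel_left, abs_mul, abs_of_pos hδ]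
        have := hyle ⟨i, h⟩
        nlinarith
      · simp [Φ, h]
    · simp only [Φ, j.2, dif_pos, add_sub_cancel_left, abs_mul, abs_of_pos hδ]
      rw [le_antisymm (hyle j) hj, mul_one]
  have hΨb : ∀ x ∈ gridCell δ e, Ψ x ∈ closedBall 0 1 := by
    intro x hx
    rw [mem_closedBall_zero_iff, pi_norm_le_iff_of_nonneg zero_le_one]
    intro j
    have := hx j
    rw [if_pos j.2] at this
    rw [Real.norm_eq_abs, abs_div, abs_of_pos hδ, div_le_one hδ]
    exact this
  have hΨs : ∀ x ∈ gridBoundary δ e, Ψ x ∈ sphere 0 1 := by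
    rintro x ⟨hx, i, ho, hi⟩
    have h1 := hΨb x hx
    rw [mem_closedBall_zero_iff] at h1
    rw [mem_sphere_zero_iff_norm]
    refine le_antisymm h1 ?_
    have h2 : ‖Ψ x ⟨i, ho⟩‖ = 1 := by
      simp only [Ψ]
      rw [Real.norm_eq_abs, abs_div, abs_of_pos hδ, hi, div_self hδ.ne']
    rw [← h2]
    exact norm_le_pi_norm _ _
  obtain ⟨k, hk, hkg, hkY⟩ := hY (g ∘ Φ) (hg.comp hΦ) (hgY.comp hΦs)
  let G : (ι → ℝ) → E := fun x => if x ∈ C then g x else k (Ψ x)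
  have hGC : EqOn G g C := fun x hx => if_pos hx
  have hGe : EqOn G (k ∘ Ψ) (gridCell δ e) := by
    intro x hx
    by_cases hxC : x ∈ C
    · have hb := hCe ⟨hxC, hx⟩
      rw [hGC hxC, comp_apply, hkg (hΨs x hb), comp_apply, hΦΨ x hx]
    · exact if_neg hxC
  have hG : ContinuousOn G (C ∪ gridCell δ e) :=
    (hg.continuousOn.congr hGC).union_of_isClosed
      ((hk.comp hΨ).continuousOn.congr hGe) hC (isClosed_gridCell δ e)
  obtain ⟨g', hg', hgG⟩ := exists_continuous_eqOn (hC.union (isClosed_gridCell δ e)) hG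
  refine ⟨g', hg', fun x hx => (hgG (Or.inl hx)).trans (hGC hx), fun x hx => ?_⟩
  rw [hgG (Or.inr hx), hGe hx]
  exact hkY (hΨb x hx)

theorem IsGridFace.card_lt {c e : ι → ℤ} (h : IsGridFace c e) (hne : c ≠ e) :
    Fintype.card {i // Odd (c i)} < Fintype.card {i // Odd (e i)} := by
  obtain ⟨i, hi⟩ := Function.ne_iff.1 hne
  have hio : Odd (e i) := ((h i).resolve_left hi).1
  refine Fintype.card_lt_of_injective_of_notMem
    (fun j : {i // Odd (c i)} => (⟨j.1, (h.odd j.2).1⟩ : {i // Odd (e i)}))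
    (fun a b hab => Subtype.ext (congrArg (fun z : {i // Odd (e i)} => z.1) hab))
    (b := ⟨i, hio⟩) ?_
  rintro ⟨⟨j, hj⟩, hji⟩
  have : j = i := congrArg (fun z : {i // Odd (e i)} => z.1) hji
  subst this
  exact hi (h.odd hj).2

/-- Extension of a map from a subcomplex `L` of the grid to `L ∪ K`, subject to a carrier `F`. -/
theorem exists_extension_carrier {δ : ℝ} (hδ : 0 < δ) (L : Finset (ι → ℤ))
    (hL : ∀ e ∈ L, ∀ c, IsGridFace c e → c ∈ L) (F : (ι → ℤ) → Set E) {g : (ι → ℝ) → E}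
    (hg : Continuous g) (hgF : ∀ e ∈ L, MapsTo g (gridCell δ e) (F e)) (K : Finset (ι → ℤ))
    (hK : ∀ e ∈ K, ∀ c, IsGridFace c e → c ∈ L ∨ c ∈ K)
    (hF : ∀ e ∈ K, ∀ c, IsGridFace c e → F c ⊆ F e)
    (hfill : ∀ e ∈ K, Fills ({i // Odd (e i)} → ℝ) (F e)) :
    ∃ g' : (ι → ℝ) → E, Continuous g' ∧ (∀ e ∈ L, EqOn g' g (gridCell δ e)) ∧
      ∀ e, e ∈ L ∨ e ∈ K → MapsTo g' (gridCell δ e) (F e) := by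
  classical
  induction hcard : K.card generalizing K with
  | zero =>
    rw [Finset.card_eq_zero] at hcard
    subst hcard
    exact ⟨g, hg, fun _ _ => eqOn_refl _ _, fun e he => hgF e (by simpa using he)⟩
  | succ n ih =>
    have hne : K.Nonempty := Finset.card_pos.1 (by omega)
    obtain ⟨e, heK, hmax⟩ :=
      Finset.exists_max_image K (fun e => Fintype.card {i // Odd (e i)}) hne
    have hK' : ∀ a ∈ K.erase e, ∀ c, IsGridFace c a → c ∈ L ∨ c ∈ K.erase e := by
      intro a ha c hca
      have haK := Finset.mem_of_mem_erase ha
      refine (hK a haK c hca).imp id fun hc => Finset.mem_erase.2 ⟨?_, hc⟩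
      rintro rfl
      have h1 := hca.card_lt (Finset.ne_of_mem_erase ha).symm
      have h2 := hmax a haK
      omega
    obtain ⟨g₁, hg₁, hg₁L, hg₁F⟩ := ih (K.erase e) hK'
      (fun a ha => hF a (Finset.mem_of_mem_erase ha))
      (fun a ha => hfill a (Finset.mem_of_mem_erase ha))
      (by rw [Finset.card_erase_of_mem heK]; omega)
    by_cases heL : e ∈ L
    · refine ⟨g₁, hg₁, hg₁L, fun a ha => hg₁F a ?_⟩
      by_cases hae : a = e
      · exact Or.inl (hae ▸ heL)
      · exact ha.imp id fun h => Finset.mem_erase.2 ⟨hae, h⟩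
    let S := L ∪ K.erase e
    have hS : ∀ a, a ∈ S ↔ a ∈ L ∨ a ∈ K.erase e := fun a => Finset.mem_union
    have heS : e ∉ S := by simp [hS, heL]
    let C : Set (ι → ℝ) := ⋃ a ∈ S, gridCell δ a
    have hC : IsClosed C := isClosed_biUnion_finset fun a _ => isClosed_gridCell δ a
    have hSface : ∀ a ∈ S, ∀ c, IsGridFace c a → c ∈ S := fun a ha c hca =>
      (hS c).2 (((hS a).1 ha).elim (fun h => Or.inl (hL a h c hca)) fun h => hK' a h c hca)
    have hbd : ∀ x ∈ gridBoundary δ e, minCell δ x ∈ S ∧ IsGridFace (minCell δ x) e := by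
      intro x hx
      have hf := isGridFace_minCell hδ hx.1
      have hxne := (mem_gridBoundary_iff hδ hx.1).1 hx
      exact ⟨(hS _).2 ((hK e heK _ hf).imp id fun h => Finset.mem_erase.2 ⟨hxne, h⟩), hf⟩
    obtain ⟨g₂, hg₂, hg₂C, hg₂e⟩ := exists_extension_gridCell hδ (e := e) hC
      (by
        rintro x ⟨hxC, hxe⟩
        obtain ⟨a, ha, hxa⟩ := mem_iUnion₂.1 hxC
        refine (mem_gridBoundary_iff hδ hxe).2 fun h => heS ?_
        rw [← h]
        exact hSface a ha _ (isGridFace_minCell hδ hxa))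
      (hfill e heK) hg₁
      (fun x hx => hF e heK _ (hbd x hx).2
        (hg₁F _ ((hS _).1 (hbd x hx).1) (mem_gridCell_minCell hδ x)))
    have hCa : ∀ a ∈ S, gridCell δ a ⊆ C := fun a ha => subset_biUnion_of_mem (u := gridCell δ) ha
    refine ⟨g₂, hg₂, fun a ha => ?_, fun a ha => ?_⟩
    · exact (hg₂C.mono (hCa a ((hS a).2 (Or.inl ha)))).trans (hg₁L a ha)
    · by_cases hae : a = e
      · rw [hae]; exact hg₂e
      · have haS : a ∈ L ∨ a ∈ K.erase e := ha.imp id fun h => Finset.mem_erase.2 ⟨hae, h⟩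
        exact (hg₁F a haS).congr (hg₂C.mono (hCa a ((hS a).2 haS))).symm

end Carrier

section Cover

variable {E : Type} [TopologicalSpace E] [TietzeExtension.{0} E] {X O₁ O₂ : Set E} {n : ℕ}

theorem card_odd_lt {j : ℕ} (hj : j < n) (e : Fin j → ℤ) : Fintype.card {i // Odd (e i)} < n :=
  (Fintype.card_subtype_le _).trans_lt (by simpa using hj)

/-- If two open sets cover `X` and the pieces and their intersection are highly connected,
then so is `X`. -/
theorem FillsBelow.of_open_cover (h₁ : IsOpen O₁) (h₂ : IsOpen O₂) (hX : X ⊆ O₁ ∪ O₂)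
    (hf₁ : FillsBelow n (X ∩ O₁)) (hf₂ : FillsBelow n (X ∩ O₂))
    (hf : FillsBelow n (X ∩ (O₁ ∩ O₂))) : FillsBelow n X := by
  classical
  intro j hj f hfc hfX
  obtain ⟨N, δ, hN4, hδ, hNδ, hfine⟩ := exists_fine_grid (isCompact_sphere (0 : Fin j → ℝ) 1)
    (c := fun b : Bool => f ⁻¹' (cond b O₁ O₂))
    (fun b => by cases b <;> [exact h₂.preimage hfc; exact h₁.preimage hfc])
    (fun x hx => mem_iUnion.2 ((hX (hfX hx)).elim (fun h => ⟨true, h⟩) fun h => ⟨false, h⟩))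
  have hN : Even N := even_iff_two_dvd.2 (dvd_trans (by norm_num) hN4)
  let T : (Fin j → ℤ) → Set E → Prop := fun e O =>
    ∀ x ∈ gridCell δ e, x ∈ sphere (0 : Fin j → ℝ) 1 → f x ∈ O
  have hT : ∀ e, T e O₁ ∨ T e O₂ := by
    intro e
    obtain ⟨b, hb⟩ := hfine e
    cases b
    · exact Or.inr fun x hx hxs => hb ⟨hx, hxs⟩
    · exact Or.inl fun x hx hxs => hb ⟨hx, hxs⟩
  have hTm : ∀ c e O, IsGridFace c e → T e O → T c O := fun c e O hce h x hx =>
    h x (hce.gridCell_subset hδ hx)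
  let F : (Fin j → ℤ) → Set E := fun e =>
    {y | y ∈ X ∧ (T e O₁ → y ∈ O₁) ∧ (T e O₂ → y ∈ O₂)}
  obtain ⟨g, hg, hgL, hgF⟩ := exists_extension_carrier hδ (gridSphere N)
    (fun e he c hc => hc.mem_gridSphere hN he) F hfc
    (fun e he x hx => by
      have hxs := gridCell_subset_sphere hN hδ hNδ he hx
      exact ⟨hfX hxs, fun h => h x hx hxs, fun h => h x hx hxs⟩)
    (gridBall N) (fun e he c hc => Or.inr (hc.mem_gridBall hN he))
    (fun e he c hc y hy => ⟨hy.1, fun h => hy.2.1 (hTm c e _ hc h),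
      fun h => hy.2.2 (hTm c e _ hc h)⟩)
    (fun e he => by
      by_cases t₁ : T e O₁ <;> by_cases t₂ : T e O₂
      · have : F e = X ∩ (O₁ ∩ O₂) := by ext y; simp [F, t₁, t₂]; tauto
        rw [this]; exact hf.fills (card_odd_lt hj e)
      · have : F e = X ∩ O₁ := by ext y; simp [F, t₁, t₂]; tauto
        rw [this]; exact hf₁.fills (card_odd_lt hj e)
      · have : F e = X ∩ O₂ := by ext y; simp [F, t₁, t₂]
        rw [this]; exact hf₂.fills (card_odd_lt hj e)
      · exact absurd (hT e) (by simp [t₁, t₂]))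
  refine ⟨g, hg, fun x hx => ?_, fun x hx => ?_⟩
  · exact hgL _ (minCell_mem_gridSphere hN hδ hNδ hx) (mem_gridCell_minCell hδ x)
  · exact (hgF _ (Or.inr (minCell_mem_gridBall hN hδ hNδ hx)) (mem_gridCell_minCell hδ x)).1

/-- If two open sets cover a highly connected `X` and their intersection with `X` is highly
connected, then so is the second piece. (Excision of a highly connected pair.) -/
theorem FillsBelow.of_inter (h₁ : IsOpen O₁) (h₂ : IsOpen O₂) (hX : X ⊆ O₁ ∪ O₂)
    (hf : FillsBelow n (X ∩ (O₁ ∩ O₂))) (hfX : FillsBelow n X) : FillsBelow n (X ∩ O₂) := by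
  classical
  intro j hj f hfc hfX₂
  obtain ⟨G, hG, hGf, hGX⟩ := hfX j hj f hfc fun x hx => (hfX₂ hx).1
  obtain ⟨N, δ, hN4, hδ, hNδ, hfine⟩ := exists_fine_grid
    (isCompact_closedBall (0 : Fin j → ℝ) 1) (c := fun b : Bool => G ⁻¹' (cond b O₁ O₂))
    (fun b => by cases b <;> [exact h₂.preimage hG; exact h₁.preimage hG])
    (fun x hx => mem_iUnion.2 ((hX (hGX hx)).elim (fun h => ⟨true, h⟩) fun h => ⟨false, h⟩))
  have hN : Even N := even_iff_two_dvd.2 (dvd_trans (by norm_num) hN4)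
  have hball : ∀ e ∈ (gridBall N : Finset (Fin j → ℤ)), gridCell δ e ⊆ closedBall 0 1 := fun e he =>
    gridCell_subset_closedBall hN hδ hNδ he
  let T : (Fin j → ℤ) → Set E → Prop := fun e O => MapsTo G (gridCell δ e) O
  have hT : ∀ e ∈ (gridBall N : Finset (Fin j → ℤ)), ¬ T e O₂ → T e O₁ := by
    intro e he h
    obtain ⟨b, hb⟩ := hfine e
    cases b
    · exact absurd (fun x hx => hb ⟨hx, hball e he hx⟩) h
    · exact fun x hx => hb ⟨hx, hball e he hx⟩
  have hTm : ∀ c e O, IsGridFace c e → T e O → T c O := fun c e O hce h =>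
    h.mono_left (hce.gridCell_subset hδ)
  let F : (Fin j → ℤ) → Set E := fun e => {y | y ∈ X ∩ O₂ ∧ (T e O₁ → y ∈ O₁)}
  obtain ⟨g, hg, hgL, hgF⟩ := exists_extension_carrier hδ ((gridBall N).filter fun e => T e O₂)
    (fun e he c hc => by
      rw [Finset.mem_filter] at he ⊢
      exact ⟨hc.mem_gridBall hN he.1, hTm c e _ hc he.2⟩) F hG
    (fun e he x hx => by
      rw [Finset.mem_filter] at he
      exact ⟨⟨hGX (hball e he.1 hx), he.2 hx⟩, fun h => h hx⟩)
    ((gridBall N).filter fun e => ¬ T e O₂)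
    (fun e he c hc => by
      simp only [Finset.mem_filter] at he ⊢
      have := hc.mem_gridBall hN he.1
      tauto)
    (fun e he c hc y hy => ⟨hy.1, fun h => hy.2 (hTm c e _ hc h)⟩)
    (fun e he => by
      rw [Finset.mem_filter] at he
      have : F e = X ∩ (O₁ ∩ O₂) := by
        ext y
        simp only [F, hT e he.1 he.2, true_imp_iff, mem_ofPred_eq, mem_inter_iff]
        tauto
      rw [this]; exact hf.fills (card_odd_lt hj e))
  refine ⟨g, hg, fun x hx => ?_, fun x hx => ?_⟩
  · have hs := minCell_mem_gridSphere hN hδ hNδ hx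
    rw [hgL (minCell δ x) (Finset.mem_filter.2 ⟨(mem_gridSphere.1 hs).1, fun y hy => ?_⟩)
      (mem_gridCell_minCell hδ x), hGf hx]
    have hys := gridCell_subset_sphere hN hδ hNδ hs hy
    rw [hGf hys]
    exact (hfX₂ hys).2
  · have hb := minCell_mem_gridBall hN hδ hNδ hx
    refine (hgF (minCell δ x) ?_ (mem_gridCell_minCell hδ x)).1
    simp only [Finset.mem_filter]
    tauto

end Cover

section Away

variable {α : Type} [DecidableEq α] {x : α} {f : α → ℝ}

theorem eq_of_single_ne_zero {x y : α}
    (h : (Pi.single x 1 : α → ℝ) y ≠ 0) : y = x := by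
  by_contra hne
  exact h (Pi.single_eq_of_ne hne _)

/-- Normalised restriction of `f` to the complement of the vertex `x`. -/
def awayFrom (x : α) (f : α → ℝ) : α → ℝ :=
  (1 - f x)⁻¹ • (f - f x • Pi.single x 1)

theorem continuousOn_awayFrom : ContinuousOn (awayFrom x) {f : α → ℝ | f x < 1} := by
  unfold awayFrom
  have h : ContinuousOn (fun f : α → ℝ => 1 - f x) {f | f x < 1} := by fun_prop
  refine ContinuousOn.smul (h.inv₀ fun f hf => ?_) (by fun_prop)
  have : f x < 1 := hf
  linarith

theorem awayFrom_apply_self : awayFrom x f x = 0 := by simp [awayFrom]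

theorem awayFrom_apply_of_ne {y : α} (h : y ≠ x) : awayFrom x f y = (1 - f x)⁻¹ * f y := by
  simp [awayFrom, h]

theorem ne_zero_of_awayFrom_ne_zero {y : α} (h : awayFrom x f y ≠ 0) : y ≠ x ∧ f y ≠ 0 := by
  have hyx : y ≠ x := by rintro rfl; exact h awayFrom_apply_self
  rw [awayFrom_apply_of_ne hyx] at h
  exact ⟨hyx, right_ne_zero_of_mul h⟩

theorem awayFrom_of_apply_eq_zero (h : f x = 0) : awayFrom x f = f := by simp [awayFrom, h]

end Away

section OrderComplex

variable {α : Type} [PartialOrder α] {S T : Set α} {f g : α → ℝ}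

theorem orderComplex_mono (h : S ⊆ T) : orderComplex S ⊆ orderComplex T :=
  fun _ hf => ⟨hf.1, hf.2.1, hf.2.2.1.trans h, hf.2.2.2⟩

variable [Fintype α]

theorem mem_orderComplex_iff : f ∈ orderComplex S ↔ (∀ x, 0 ≤ f x) ∧ (∀ x, f x ≠ 0 → x ∈ S) ∧
    (∀ x y, f x ≠ 0 → f y ≠ 0 → x ≤ y ∨ y ≤ x) ∧ ∑ x, f x = 1 := by
  have hchain : IsChain (· ≤ ·) (support f) ↔ ∀ x y, f x ≠ 0 → f y ≠ 0 → x ≤ y ∨ y ≤ x := by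
    constructor
    · intro h x y hx hy
      exact h.total hx hy
    · intro h x hx y hy _
      exact h x y hx hy
  rw [← hchain, ← finsum_eq_sum_of_fintype]
  exact ⟨fun h => ⟨h.1, fun x hx => h.2.2.1 hx, h.2.2.2⟩,
    fun h => ⟨h.1, Set.toFinite _, fun x hx => h.2.1 x hx, h.2.2⟩⟩

theorem add_smul_mem_orderComplex {a b : ℝ} (ha : 0 ≤ a) (hb : 0 ≤ b) (hab : a + b = 1)
    (hf : a ≠ 0 → f ∈ orderComplex S) (hg : b ≠ 0 → g ∈ orderComplex S)
    (hc : a ≠ 0 → b ≠ 0 → ∀ u v, f u ≠ 0 → g v ≠ 0 → u ≤ v ∨ v ≤ u) :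
    a • f + b • g ∈ orderComplex S := by
  rcases eq_or_ne a 0 with rfl | ha0
  · obtain rfl : b = 1 := by linarith
    simpa using hg one_ne_zero
  rcases eq_or_ne b 0 with rfl | hb0
  · obtain rfl : a = 1 := by linarith
    simpa using hf one_ne_zero
  have hf := mem_orderComplex_iff.1 (hf ha0)
  have hg := mem_orderComplex_iff.1 (hg hb0)
  have hc := hc ha0 hb0
  have hsupp : ∀ u, (a • f + b • g) u ≠ 0 → f u ≠ 0 ∨ g u ≠ 0 := by
    intro u hu
    by_contra! h
    simp [h.1, h.2] at hu
  refine mem_orderComplex_iff.2 ⟨fun x => ?_, fun x hx => ?_, fun x y hx hy => ?_, ?_⟩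
  · have := hf.1 x
    have := hg.1 x
    simp only [Pi.add_apply, Pi.smul_apply, smul_eq_mul]
    positivity
  · exact (hsupp x hx).elim (hf.2.1 x) (hg.2.1 x)
  · rcases hsupp x hx with hx | hx <;> rcases hsupp y hy with hy | hy
    · exact hf.2.2.1 x y hx hy
    · exact hc x y hx hy
    · exact (hc y x hy hx).symm
    · exact hg.2.2.1 x y hx hy
  · simp only [Pi.add_apply, Pi.smul_apply, smul_eq_mul, Finset.sum_add_distrib,
      ← Finset.mul_sum, hf.2.2.2, hg.2.2.2, mul_one, hab]

theorem single_mem_orderComplex [DecidableEq α] {x : α} (hx : x ∈ S) :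
    (Pi.single x 1 : α → ℝ) ∈ orderComplex S := by
  refine mem_orderComplex_iff.2 ⟨fun y => ?_, fun y hy => eq_of_single_ne_zero hy ▸ hx, fun y z hy hz => ?_, by simp⟩
  · by_cases hy : y = x
    · subst hy; simp
    · simp [hy]
  · rw [eq_of_single_ne_zero hy, eq_of_single_ne_zero hz]; simp

/-- The order complex of a cone is contractible. -/
theorem fills_orderComplex_of_cone {D : Type} [NormedAddCommGroup D] [NormedSpace ℝ D] {c : α}
    (hc : c ∈ S) (h : ∀ x ∈ S, x ≤ c ∨ c ≤ x) : Fills D (orderComplex S) := by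
  classical
  refine (fills_singleton (Pi.single c 1 : α → ℝ)).of_deformation
    (r := fun p => (1 - p.1) • p.2 + p.1 • Pi.single c 1)
    (singleton_subset_iff.2 (single_mem_orderComplex hc)) (by fun_prop) (by simp) ?_ (by simp)
  rintro ⟨t, f⟩ ⟨⟨ht0, ht1⟩, hf⟩
  refine add_smul_mem_orderComplex (by simpa using ht1) ht0 (by simp) (fun _ => hf)
    (fun _ => single_mem_orderComplex hc) fun _ _ u v hu hv => ?_
  rw [eq_of_single_ne_zero hv]
  exact h u ((mem_orderComplex_iff.1 hf).2.1 u hu)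

theorem awayFrom_mem [DecidableEq α] {x : α} (hf : f ∈ orderComplex S) (hx : f x < 1)
    (hT : ∀ y, y ≠ x → f y ≠ 0 → y ∈ T) : awayFrom x f ∈ orderComplex T := by
  rw [mem_orderComplex_iff] at hf
  refine mem_orderComplex_iff.2 ⟨fun y => ?_, fun y hy => ?_, fun y z hy hz => ?_, ?_⟩
  · by_cases hy : y = x
    · rw [hy, awayFrom_apply_self]
    · rw [awayFrom_apply_of_ne hy]
      exact mul_nonneg (inv_nonneg.2 (by linarith)) (hf.1 y)
  · exact hT y (ne_zero_of_awayFrom_ne_zero hy).1 (ne_zero_of_awayFrom_ne_zero hy).2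
  · exact hf.2.2.1 y z (ne_zero_of_awayFrom_ne_zero hy).2 (ne_zero_of_awayFrom_ne_zero hz).2
  · have : (1 - f x) ≠ 0 := by linarith
    simp [awayFrom, ← Finset.mul_sum, Finset.sum_sub_distrib, hf.2.2.2, this]

/-- Adding a vertex whose link is highly connected does not change high connectedness. -/
theorem fillsBelow_insert_iff {x : α} (hx : x ∉ S) {n : ℕ}
    (hlink : FillsBelow n (orderComplex {y | y ∈ S ∧ (y ≤ x ∨ x ≤ y)})) :
    FillsBelow n (orderComplex (insert x S)) ↔ FillsBelow n (orderComplex S) := by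
  classical
  let X := orderComplex (insert x S)
  let O₁ : Set (α → ℝ) := {f | 0 < f x}
  let O₂ : Set (α → ℝ) := {f | f x < 1}
  let Λ : Set α := {y | y ∈ S ∧ (y ≤ x ∨ x ≤ y)}
  have h₁ : IsOpen O₁ := isOpen_lt continuous_const (continuous_apply x)
  have h₂ : IsOpen O₂ := isOpen_lt (continuous_apply x) continuous_const
  have hX : X ⊆ O₁ ∪ O₂ := by
    intro f _
    by_cases h : 0 < f x
    · exact Or.inl h
    · exact Or.inr (by simp only [O₂, mem_ofPred_eq]; linarith)
  have hne : ∀ {f : α → ℝ} {y}, f ∈ X → y ≠ x → f y ≠ 0 → y ∈ S := fun hf hyx hy =>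
    ((mem_orderComplex_iff.1 hf).2.1 _ hy).resolve_left hyx
  have hSx : ∀ f ∈ orderComplex S, f x = 0 := fun f hf => by
    by_contra h
    exact hx ((mem_orderComplex_iff.1 hf).2.1 x h)
  have hSX : orderComplex S ⊆ X ∩ O₂ := fun f hf =>
    ⟨orderComplex_mono (subset_insert _ _) hf, by simp [O₂, hSx f hf]⟩
  have hρ : ∀ f ∈ X ∩ O₂, awayFrom x f ∈ orderComplex S := fun f hf =>
    awayFrom_mem hf.1 hf.2 fun y => hne hf.1
  have hρc : ContinuousOn (awayFrom x) (X ∩ O₂) :=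
    continuousOn_awayFrom.mono inter_subset_right
  have hδ : (Pi.single x 1 : α → ℝ) ∈ X := single_mem_orderComplex (mem_insert _ _)
  have hf₁ : FillsBelow n (X ∩ O₁) := by
    intro j _
    refine (fills_singleton (Pi.single x 1 : α → ℝ)).of_deformation
      (r := fun p => (1 - p.1) • p.2 + p.1 • Pi.single x 1)
      (singleton_subset_iff.2 ⟨hδ, by simp [O₁]⟩) (by fun_prop) (by simp) ?_ (by simp)
    rintro ⟨t, f⟩ ⟨⟨ht0, ht1⟩, hf, hfx⟩
    refine ⟨add_smul_mem_orderComplex (by simpa using ht1) ht0 (by simp) (fun _ => hf)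
      (fun _ => hδ) fun _ _ u v hu hv => ?_, ?_⟩
    · rw [eq_of_single_ne_zero hv]
      exact (mem_orderComplex_iff.1 hf).2.2.1 _ _ hu (ne_of_gt hfx)
    · have hfx : 0 < f x := hfx
      simp only [O₁, mem_ofPred_eq, Pi.add_apply, Pi.smul_apply, smul_eq_mul, Pi.single_eq_same]
      simp only at ht0 ht1
      rcases ht0.eq_or_lt with rfl | ht
      · rwa [sub_zero, one_mul, zero_mul, add_zero]
      · nlinarith [mul_nonneg (sub_nonneg.2 ht1) hfx.le]
  have hf₂ : FillsBelow n (X ∩ O₂) ↔ FillsBelow n (orderComplex S) := by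
    constructor
    · intro h j hj
      exact (h j hj).of_retract (i := id) continuousOn_id hρc hSX hρ
        fun f hf => awayFrom_of_apply_eq_zero (hSx f hf)
    · intro h j hj
      refine (h j hj).of_deformation
        (r := fun p => (1 - p.1) • p.2 + p.1 • awayFrom x p.2) hSX ?_ (by simp) ?_
        (fun f hf => by simpa using hρ f hf)
      · have : ContinuousOn (fun p : ℝ × (α → ℝ) => awayFrom x p.2) (Icc 0 1 ×ˢ (X ∩ O₂)) :=
          hρc.comp (by fun_prop) fun p hp => hp.2
        fun_prop
      rintro ⟨t, f⟩ ⟨⟨ht0, ht1⟩, hf⟩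
      refine ⟨add_smul_mem_orderComplex (by simpa using ht1) ht0 (by simp) (fun _ => hf.1)
        (fun _ => (hSX (hρ f hf)).1) fun _ _ u v hu hv => ?_, ?_⟩
      · exact (mem_orderComplex_iff.1 hf.1).2.2.1 _ _ hu (ne_zero_of_awayFrom_ne_zero hv).2
      · have hfx : f x < 1 := hf.2
        have hfx0 := (mem_orderComplex_iff.1 hf.1).1 x
        simp only [O₂, mem_ofPred_eq, Pi.add_apply, Pi.smul_apply, smul_eq_mul,
          awayFrom_apply_self]
        simp only at ht0 ht1
        nlinarith
  have hΛX : orderComplex Λ ⊆ X :=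
    orderComplex_mono fun y hy => mem_insert_of_mem _ hy.1
  have hmid : ∀ l ∈ orderComplex Λ,
      (1 / 2 : ℝ) • l + (1 / 2 : ℝ) • (Pi.single x 1 : α → ℝ) ∈ X ∩ (O₁ ∩ O₂) := by
    intro l hl
    have hlx : l x = 0 := by
      by_contra h
      exact hx ((mem_orderComplex_iff.1 hl).2.1 x h).1
    refine ⟨add_smul_mem_orderComplex (by norm_num) (by norm_num) (by norm_num)
      (fun _ => hΛX hl) (fun _ => hδ) fun _ _ u v hu hv => ?_, ?_, ?_⟩
    · rw [eq_of_single_ne_zero hv]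
      exact ((mem_orderComplex_iff.1 hl).2.1 u hu).2
    · simp [O₁, hlx]
    · norm_num [O₂, hlx]
  have hρΛ : ∀ f ∈ X ∩ (O₁ ∩ O₂), awayFrom x f ∈ orderComplex Λ := by
    intro f hf
    have hfx : 0 < f x := hf.2.1
    refine awayFrom_mem hf.1 hf.2.2 fun y hyx hy => ⟨hne hf.1 hyx hy, ?_⟩
    exact (mem_orderComplex_iff.1 hf.1).2.2.1 y x hy hfx.ne'
  have hf₁₂ : FillsBelow n (X ∩ (O₁ ∩ O₂)) := by
    intro j hj
    let Y := (fun l => (1 / 2 : ℝ) • l + (1 / 2 : ℝ) • (Pi.single x 1 : α → ℝ)) '' orderComplex Λ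
    have hY : Fills (Fin j → ℝ) Y := by
      refine (hlink j hj).of_retract (i := fun f => (2 : ℝ) • f - Pi.single x 1)
        (r := fun l => (1 / 2 : ℝ) • l + (1 / 2 : ℝ) • (Pi.single x 1 : α → ℝ)) (by fun_prop)
        (by fun_prop) ?_ (mapsTo_image _ _) ?_
      · rintro _ ⟨l, hl, rfl⟩
        simp only [smul_add, smul_smul]
        norm_num
        exact hl
      · rintro f -
        simp only [smul_sub, smul_smul]
        norm_num
    refine hY.of_deformation (r := fun p => (1 - p.1) • p.2 +
      p.1 • ((1 / 2 : ℝ) • awayFrom x p.2 + (1 / 2 : ℝ) • (Pi.single x 1 : α → ℝ))) ?_ ?_ (by simp) ?_ ?_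
    · rintro _ ⟨l, hl, rfl⟩
      exact hmid l hl
    · have : ContinuousOn (fun p : ℝ × (α → ℝ) => awayFrom x p.2)
          (Icc 0 1 ×ˢ (X ∩ (O₁ ∩ O₂))) :=
        hρc.comp (by fun_prop) fun p hp => ⟨hp.2.1, hp.2.2.2⟩
      fun_prop
    swap
    · exact fun f hf => ⟨_, hρΛ f hf, by simp⟩
    rintro ⟨t, f⟩ ⟨⟨ht0, ht1⟩, hf⟩
    have hfx : 0 < f x := hf.2.1
    have hfx1 : f x < 1 := hf.2.2
    simp only at ht0 ht1
    refine ⟨add_smul_mem_orderComplex (by simpa using ht1) ht0 (by simp) (fun _ => hf.1)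
      (fun _ => (hmid _ (hρΛ f hf)).1) fun _ _ u v hu hv => ?_, ?_, ?_⟩
    · refine (mem_orderComplex_iff.1 hf.1).2.2.1 _ _ hu ?_
      by_cases hvx : v = x
      · rw [hvx]; exact hfx.ne'
      · refine (ne_zero_of_awayFrom_ne_zero (x := x) (y := v) ?_).2
        simpa [hvx] using hv
    · simp only [O₁, mem_ofPred_eq, Pi.add_apply, Pi.smul_apply, smul_eq_mul,
        awayFrom_apply_self, Pi.single_eq_same]
      nlinarith
    · simp only [O₂, mem_ofPred_eq, Pi.add_apply, Pi.smul_apply, smul_eq_mul,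
        awayFrom_apply_self, Pi.single_eq_same]
      nlinarith
  exact ⟨fun h => hf₂.1 (FillsBelow.of_inter h₁ h₂ hX hf₁₂ h),
    fun h => FillsBelow.of_open_cover h₁ h₂ hX hf₁ (hf₂.2 h) hf₁₂⟩

end OrderComplex

section Fold

/-- A reparametrisation of a real line, `4`-periodic up to translation, given on `[0, 4]` by `v`. -/
def foldLine (v : ℝ → ℝ) (t : ℝ) : ℝ :=
  (fun u => v (4 * u) - 4 * u) (Int.fract (t / 4)) + t

theorem foldLine_eq (v : ℝ → ℝ) (t : ℝ) :
    foldLine v t = 4 * ⌊t / 4⌋ + v (4 * Int.fract (t / 4)) := by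
  have := Int.floor_add_fract (t / 4)
  simp only [foldLine]
  linarith

theorem continuous_foldLine {v : ℝ → ℝ} (hv : Continuous v) (h0 : v 0 = 0) (h4 : v 4 = 4) :
    Continuous (foldLine v) := by
  have h : Continuous ((fun u => v (4 * u) - 4 * u) ∘ Int.fract) :=
    ContinuousOn.comp_fract'' (by fun_prop) (by simp [h0, h4])
  exact (h.comp (continuous_id.div_const 4)).add continuous_id

theorem abs_foldLine_sub_le {v : ℝ → ℝ} (h0 : v 0 = 0) (h2 : MapsTo v (Icc 0 2) (Icc 0 2))
    (h4 : MapsTo v (Icc 2 4) (Icc 2 4)) {t : ℝ} {e : ℤ} (h : |t - e| ≤ if Odd e then 1 else 0) :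
    |foldLine v t - e| ≤ if Odd e then 1 else 0 := by
  rw [foldLine_eq]
  have hk := Int.floor_add_fract (t / 4)
  have hu0 := Int.fract_nonneg (t / 4)
  have hu1 := Int.fract_lt_one (t / 4)
  set k := ⌊t / 4⌋
  set u := Int.fract (t / 4)
  have ht : t = 4 * k + 4 * u := by linarith
  split_ifs at h ⊢ with ho
  · obtain ⟨r, rfl⟩ := ho
    push_cast at h ⊢
    rw [abs_le] at h ⊢
    have hr1 : ((r : ℤ) : ℝ) < ((2 * k + 2 : ℤ) : ℝ) := by push_cast; linarith
    have hr2 : ((2 * k - 2 : ℤ) : ℝ) < (r : ℤ) := by push_cast; linarith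
    have hr1 := Int.cast_lt.1 hr1
    have hr2 := Int.cast_lt.1 hr2
    obtain rfl | rfl | rfl : r = 2 * k - 1 ∨ r = 2 * k ∨ r = 2 * k + 1 := by omega
    · push_cast at h ⊢
      have : 4 * u = 0 := by linarith
      rw [this, h0]
      constructor <;> linarith
    · push_cast at h ⊢
      have := h2 (x := 4 * u) ⟨by linarith, by linarith⟩
      constructor <;> linarith [this.1, this.2]
    · push_cast at h ⊢
      have := h4 (x := 4 * u) ⟨by linarith, by linarith⟩
      constructor <;> linarith [this.1, this.2]
  · obtain ⟨r, rfl⟩ := Int.not_odd_iff_even.1 ho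
    push_cast at h ⊢
    rw [abs_nonpos_iff] at h ⊢
    have hr1 : ((r : ℤ) : ℝ) < ((2 * k + 2 : ℤ) : ℝ) := by push_cast; linarith
    have hr2 : ((2 * k - 1 : ℤ) : ℝ) < (r : ℤ) := by push_cast; linarith
    have hr1 := Int.cast_lt.1 hr1
    have hr2 := Int.cast_lt.1 hr2
    obtain rfl | rfl : r = 2 * k ∨ r = 2 * k + 1 := by omega
    · push_cast at h ⊢
      have : 4 * u = 0 := by linarith
      rw [this, h0]
      linarith
    · push_cast at h ⊢
      have hu : 4 * u = 2 := by linarith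
      have h2' := h2 (x := 2) (by norm_num)
      have h4' := h4 (x := 2) (by norm_num)
      rw [hu, le_antisymm h2'.2 h4'.1]
      linarith

/-- Coordinatewise application of `foldLine v`, in units of `δ`. -/
def foldMap {ι : Type} (v : ℝ → ℝ) (δ : ℝ) (x : ι → ℝ) : ι → ℝ :=
  fun i => foldLine v (x i / δ) * δ

theorem continuous_foldMap {ι : Type} {v : ℝ → ℝ} (hv : Continuous v) (h0 : v 0 = 0)
    (h4 : v 4 = 4) (δ : ℝ) : Continuous (foldMap (ι := ι) v δ) := by
  have := continuous_foldLine hv h0 h4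
  unfold foldMap
  fun_prop

theorem foldMap_mem_gridCell {ι : Type} {v : ℝ → ℝ} (h0 : v 0 = 0)
    (h2 : MapsTo v (Icc 0 2) (Icc 0 2)) (h4 : MapsTo v (Icc 2 4) (Icc 2 4)) {δ : ℝ} (hδ : 0 < δ)
    {e : ι → ℤ} {x : ι → ℝ} (hx : x ∈ gridCell δ e) : foldMap v δ x ∈ gridCell δ e := by
  rw [mem_gridCell_iff hδ] at hx ⊢
  intro i
  rw [foldMap, mul_div_cancel_right₀ _ hδ.ne']
  exact abs_foldLine_sub_le h0 h2 h4 (hx i)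

theorem minCell_foldMap {ι : Type} {v : ℝ → ℝ} {δ : ℝ} (hδ : 0 < δ) {x : ι → ℝ} {i : ι} {c : ℤ}
    (hc : Even c) (h : v (4 * Int.fract (x i / δ / 4)) = c) :
    minCell δ (foldMap v δ x) i = 4 * ⌊x i / δ / 4⌋ + c := by
  refine minCell_of_eq hδ (Even.add ⟨2 * ⌊x i / δ / 4⌋, by ring⟩ hc) ?_
  rw [foldMap, foldLine_eq, h]
  push_cast
  rfl

/-- Collapses a neighbourhood of the multiples of `4`. -/
def collapseEnds (s : ℝ) : ℝ := max 0 (min 4 (4 * s - 6))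

/-- Collapses the complement of a neighbourhood of the multiples of `4`. -/
def collapseMiddle (s : ℝ) : ℝ := min (4 * s) 2 + max 0 (4 * s - 14)

/-- The distance to the nearest multiple of `4`. -/
def distFour (t : ℝ) : ℝ := (fun u => min (4 * u) (4 - 4 * u)) (Int.fract (t / 4))

theorem continuous_distFour : Continuous distFour := by
  have h : Continuous ((fun u : ℝ => min (4 * u) (4 - 4 * u)) ∘ Int.fract) :=
    ContinuousOn.comp_fract'' (by fun_prop) (by norm_num)
  exact h.comp (continuous_id.div_const 4)

theorem collapseEnds_mapsTo_left : MapsTo collapseEnds (Icc 0 2) (Icc 0 2) := by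
  rintro s ⟨h0, h2⟩
  unfold collapseEnds
  refine ⟨le_max_left _ _, max_le (by norm_num) ((min_le_right _ _).trans (by linarith))⟩

theorem collapseEnds_mapsTo_right : MapsTo collapseEnds (Icc 2 4) (Icc 2 4) := by
  rintro s ⟨h0, h2⟩
  unfold collapseEnds
  refine ⟨le_max_of_le_right (le_min (by norm_num) (by linarith)), ?_⟩
  exact max_le (by norm_num) (min_le_left _ _)

theorem collapseMiddle_mapsTo_left : MapsTo collapseMiddle (Icc 0 2) (Icc 0 2) := by
  rintro s ⟨h0, h2⟩
  unfold collapseMiddle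
  rw [max_eq_left (by linarith), add_zero]
  exact ⟨le_min (by linarith) (by norm_num), min_le_right _ _⟩

theorem collapseMiddle_mapsTo_right : MapsTo collapseMiddle (Icc 2 4) (Icc 2 4) := by
  rintro s ⟨h0, h2⟩
  unfold collapseMiddle
  rw [min_eq_right (by linarith)]
  have h1 := le_max_left 0 (4 * s - 14)
  have h2 : max 0 (4 * s - 14) ≤ 2 := max_le (by norm_num) (by linarith)
  exact ⟨by linarith, by linarith⟩

theorem four_dvd_minCell_foldMap {ι : Type} {δ : ℝ} (hδ : 0 < δ) {x : ι → ℝ} {i : ι}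
    (h : distFour (x i / δ) < 3 / 2) : 4 ∣ minCell δ (foldMap collapseEnds δ x) i := by
  simp only [distFour] at h
  rcases min_lt_iff.1 h with h | h
  · rw [minCell_foldMap hδ (c := 0) (by decide)]
    · omega
    · rw [collapseEnds, min_eq_right (by linarith), max_eq_left (by linarith)]; simp
  · rw [minCell_foldMap hδ (c := 4) (by decide)]
    · omega
    · rw [collapseEnds, min_eq_left (by linarith), max_eq_right (by linarith)]; simp

theorem minCell_foldMap_emod_four {ι : Type} {δ : ℝ} (hδ : 0 < δ) {x : ι → ℝ} {i : ι}
    (h : 1 / 2 < distFour (x i / δ)) : minCell δ (foldMap collapseMiddle δ x) i % 4 = 2 := by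
  simp only [distFour, lt_min_iff] at h
  rw [minCell_foldMap hδ (c := 2) (by decide)]
  · omega
  · rw [collapseMiddle, min_eq_right (by linarith), max_eq_left (by linarith)]; simp

end Fold

section FoldWeight

variable {ι : Type} [Fintype ι]

/-- A nonnegative weight which is positive exactly where at least `k` of the functions `h i` are
positive. -/
def countWeight (k : ℕ) (h : ι → ℝ) : ℝ :=
  ∑ s : Finset ι with k ≤ s.card, ∏ i ∈ s, max 0 (h i)

theorem continuous_countWeight (k : ℕ) : Continuous (countWeight (ι := ι) k) := by
  unfold countWeight
  fun_prop

theorem countWeight_nonneg (k : ℕ) (h : ι → ℝ) : 0 ≤ countWeight k h :=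
  Finset.sum_nonneg fun _ _ => Finset.prod_nonneg fun _ _ => le_max_left _ _

theorem countWeight_ne_zero_iff {k : ℕ} {h : ι → ℝ} :
    countWeight k h ≠ 0 ↔ ∃ s : Finset ι, k ≤ s.card ∧ ∀ i ∈ s, 0 < h i := by
  rw [countWeight, Ne, Finset.sum_eq_zero_iff_of_nonneg
    fun _ _ => Finset.prod_nonneg fun _ _ => le_max_left _ _]
  push Not
  refine exists_congr fun s => ?_
  simp only [Finset.mem_filter_univ, Finset.prod_ne_zero_iff]
  refine and_congr_right fun _ => forall₂_congr fun i _ => ?_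
  rw [Ne, max_eq_left_iff, not_le]

end FoldWeight

section Join

variable {α : Type} [Fintype α]

/-- The total weight of `f` on `A`. -/
def mass (A : Set α) (f : α → ℝ) : ℝ := ∑ y, A.indicator f y

/-- The normalised restriction of `f` to `A`. -/
def restrictTo (A : Set α) (f : α → ℝ) : α → ℝ := (mass A f)⁻¹ • A.indicator f

theorem continuous_indicator_apply {α : Type} (A : Set α) : Continuous fun f : α → ℝ => A.indicator f := by
  classical
  refine continuous_pi fun y => ?_
  by_cases hy : y ∈ A
  · simpa [hy] using continuous_apply y
  · simpa [hy] using continuous_const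

theorem continuous_mass (A : Set α) : Continuous (mass A) := by
  unfold mass
  exact continuous_finsetSum _ fun y _ => (continuous_apply y).comp (continuous_indicator_apply A)

theorem continuousOn_restrictTo (A : Set α) : ContinuousOn (restrictTo A) {f | mass A f ≠ 0} :=
  ((continuous_mass A).continuousOn.inv₀ fun _ hf => hf).smul
    (continuous_indicator_apply A).continuousOn

theorem ne_zero_of_restrictTo_ne_zero {A : Set α} {f : α → ℝ} {y : α}
    (h : restrictTo A f y ≠ 0) : y ∈ A ∧ f y ≠ 0 :=
  indicator_apply_ne_zero.1 (right_ne_zero_of_mul h)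

variable [PartialOrder α]

theorem restrictTo_mem {A S : Set α} {f : α → ℝ} (hf : f ∈ orderComplex S) (h : 0 < mass A f) :
    restrictTo A f ∈ orderComplex A := by
  rw [mem_orderComplex_iff] at hf
  refine mem_orderComplex_iff.2 ⟨fun y => ?_, fun y hy => ?_, fun y z hy hz => ?_, ?_⟩
  · exact mul_nonneg (inv_nonneg.2 h.le) (indicator_nonneg (fun y _ => hf.1 y) y)
  · exact (ne_zero_of_restrictTo_ne_zero hy).1
  · exact hf.2.2.1 y z (ne_zero_of_restrictTo_ne_zero hy).2 (ne_zero_of_restrictTo_ne_zero hz).2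
  · simp only [restrictTo, Pi.smul_apply, smul_eq_mul, ← Finset.mul_sum]
    exact inv_mul_cancel₀ h.ne'

theorem mass_add_mass {A B : Set α} (hAB : Disjoint A B) {f : α → ℝ}
    (hf : f ∈ orderComplex (A ∪ B)) : mass A f + mass B f = 1 := by
  classical
  rw [mem_orderComplex_iff] at hf
  rw [mass, mass, ← Finset.sum_add_distrib, ← hf.2.2.2]
  refine Finset.sum_congr rfl fun y _ => ?_
  rw [← congrFun (indicator_union_of_disjoint hAB f) y, indicator_apply]
  split_ifs with h
  · rfl
  · by_contra h'
    exact h (hf.2.1 y (Ne.symm h'))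

/-- The part of `f` lying in the join factor `A` extends over a subcomplex of small dimension. -/
theorem exists_restrictTo_extension {A S : Set α} {j n p : ℕ} {δ : ℝ} (hN : Even n) (hδ : 0 < δ)
    (hnδ : n * δ = 1) (hA : FillsBelow p (orderComplex A)) {f : (Fin j → ℝ) → α → ℝ}
    (hf : Continuous f) (hfS : MapsTo f (sphere 0 1) (orderComplex S)) (K : Finset (Fin j → ℤ))
    (hK : ∀ e ∈ K, ∀ c, IsGridFace c e → c ∈ K)
    (hKp : ∀ e ∈ K, Fintype.card {i // Odd (e i)} < p) :
    ∃ a : (Fin j → ℝ) → α → ℝ, Continuous a ∧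
      (∀ e ∈ gridSphere n, (∀ x ∈ gridCell δ e, 0 < mass A (f x)) →
        EqOn a (restrictTo A ∘ f) (gridCell δ e)) ∧
      ∀ e ∈ K, MapsTo a (gridCell δ e) (orderComplex A) := by
  classical
  let L := (gridSphere (ι := Fin j) n).filter fun e => ∀ x ∈ gridCell δ e, 0 < mass A (f x)
  have hL : ∀ e, e ∈ L ↔ e ∈ gridSphere n ∧ ∀ x ∈ gridCell δ e, 0 < mass A (f x) :=
    fun e => Finset.mem_filter
  have hcont : ContinuousOn (restrictTo A ∘ f) (⋃ e ∈ L, gridCell δ e) := by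
    refine (continuousOn_restrictTo A).comp hf.continuousOn fun x hx => ?_
    obtain ⟨e, he, hxe⟩ := mem_iUnion₂.1 hx
    exact (((hL e).1 he).2 x hxe).ne'
  obtain ⟨a₀, ha₀, ha₀f⟩ := exists_continuous_eqOn
    (isClosed_biUnion_finset fun e _ => isClosed_gridCell δ e) hcont
  have ha₀L : ∀ e ∈ L, EqOn a₀ (restrictTo A ∘ f) (gridCell δ e) := fun e he =>
    ha₀f.mono (subset_biUnion_of_mem (u := gridCell δ) he)
  obtain ⟨a, ha, haL, haK⟩ := exists_extension_carrier hδ L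
    (fun e he c hc => (hL c).2 ⟨hc.mem_gridSphere hN ((hL e).1 he).1,
      fun x hx => ((hL e).1 he).2 x (hc.gridCell_subset hδ hx)⟩)
    (fun _ => orderComplex A) ha₀
    (fun e he x hx => by
      rw [ha₀L e he hx]
      exact restrictTo_mem (hfS (gridCell_subset_sphere hN hδ hnδ ((hL e).1 he).1 hx))
        (((hL e).1 he).2 x hx))
    K (fun e he c hc => Or.inr (hK e he c hc)) (fun _ _ _ _ => Subset.rfl)
    (fun e he => hA.fills (hKp e he))
  exact ⟨a, ha, fun e he h => (haL e ((hL e).2 ⟨he, h⟩)).trans (ha₀L e ((hL e).2 ⟨he, h⟩)),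
    fun e he => haK e (Or.inr he)⟩

/-- The join of a `(p - 2)`-connected and a `(q - 2)`-connected order complex is
`(p + q - 2)`-connected. -/
theorem FillsBelow.join {A B : Set α} (hAB : Disjoint A B)
    (hcomp : ∀ a ∈ A, ∀ b ∈ B, a ≤ b ∨ b ≤ a) {p q : ℕ} (hA : FillsBelow p (orderComplex A))
    (hB : FillsBelow q (orderComplex B)) : FillsBelow (p + q) (orderComplex (A ∪ B)) := by
  classical
  intro j hj f hf hfX
  obtain ⟨N, δ, hN4, hδ, hNδ, hfine⟩ := exists_fine_grid (isCompact_sphere (0 : Fin j → ℝ) 1)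
    (c := fun k : Fin 3 => (fun x => mass A (f x)) ⁻¹'
      (![Iio (1 / 3), Ioo 0 1, Ioi (2 / 3)] k))
    (fun k => by
      have hc : Continuous fun x => mass A (f x) := (continuous_mass A).comp hf
      fin_cases k
      · exact isOpen_Iio.preimage hc
      · exact isOpen_Ioo.preimage hc
      · exact isOpen_Ioi.preimage hc)
    (fun x _ => by
      rw [mem_iUnion]
      by_cases h1 : mass A (f x) < 1 / 3
      · exact ⟨0, h1⟩
      by_cases h2 : 2 / 3 < mass A (f x)
      · exact ⟨2, h2⟩
      · exact ⟨1, by constructor <;> linarith⟩)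
  have hN : Even N := even_iff_two_dvd.2 (dvd_trans (by norm_num) hN4)
  have hmass : ∀ x ∈ sphere (0 : Fin j → ℝ) 1, mass A (f x) + mass B (f x) = 1 :=
    fun x hx => mass_add_mass hAB (hfX hx)
  -- the two subcomplexes over which the factors are extended
  let K₁ := (gridBall (ι := Fin j) N).filter fun e =>
    j < (Finset.univ.filter fun i => 4 ∣ e i).card + p
  let K₂ := (gridBall (ι := Fin j) N).filter fun e =>
    p ≤ (Finset.univ.filter fun i => e i % 4 = 2).card
  obtain ⟨a, ha, haL, haK⟩ := exists_restrictTo_extension hN hδ hNδ hA hf hfX K₁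
    (fun e he c hc => by
      rw [Finset.mem_filter] at he ⊢
      refine ⟨hc.mem_gridBall hN he.1, he.2.trans_le (Nat.add_le_add_right
        (Finset.card_le_card fun i hi => ?_) p)⟩
      rw [Finset.mem_filter_univ] at hi ⊢
      rcases hc i with h | ⟨ho, -⟩
      · rwa [h]
      · obtain ⟨r, hr⟩ := ho; omega)
    (fun e he => by
      rw [Finset.mem_filter] at he
      rw [Fintype.card_subtype]
      have hd : Disjoint (Finset.univ.filter fun i => Odd (e i))
          (Finset.univ.filter fun i => 4 ∣ e i) := by
        rw [Finset.disjoint_filter]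
        rintro i - ⟨r, hr⟩ h
        omega
      have := (Finset.card_union_of_disjoint hd).symm.le.trans (Finset.card_le_univ _)
      rw [Fintype.card_fin] at this
      omega)
  obtain ⟨b, hb, hbL, hbK⟩ := exists_restrictTo_extension hN hδ hNδ hB hf hfX K₂
    (fun e he c hc => by
      rw [Finset.mem_filter] at he ⊢
      refine ⟨hc.mem_gridBall hN he.1, he.2.trans (Finset.card_le_card fun i hi => ?_)⟩
      rw [Finset.mem_filter_univ] at hi ⊢
      rcases hc i with h | ⟨ho, -⟩
      · rwa [h]
      · obtain ⟨r, hr⟩ := ho; omega)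
    (fun e he => by
      rw [Finset.mem_filter] at he
      rw [Fintype.card_subtype]
      have hd : Disjoint (Finset.univ.filter fun i => Odd (e i))
          (Finset.univ.filter fun i => e i % 4 = 2) := by
        rw [Finset.disjoint_filter]
        rintro i - ⟨r, hr⟩ h
        omega
      have := (Finset.card_union_of_disjoint hd).symm.le.trans (Finset.card_le_univ _)
      rw [Fintype.card_fin] at this
      omega)
  let θ : (Fin j → ℝ) → ℝ := fun x => max 0 (min 1 (3 * mass A (f x) - 1))
  have hθ : Continuous θ := by
    have := continuous_mass A
    fun_prop
  have hθ01 : ∀ x, 0 ≤ θ x ∧ θ x ≤ 1 := fun x =>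
    ⟨le_max_left _ _, max_le zero_le_one (min_le_left _ _)⟩
  have hθa : ∀ e ∈ gridSphere (ι := Fin j) N, ∀ x ∈ gridCell δ e, θ x ≠ 0 →
      ∀ y ∈ gridCell δ e, 0 < mass A (f y) := by
    intro e he x hx hθx y hy
    have hs := gridCell_subset_sphere hN hδ hNδ he
    obtain ⟨k, hk⟩ := hfine e
    have hkx := hk ⟨hx, hs hx⟩
    have hky := hk ⟨hy, hs hy⟩
    fin_cases k
    · have hkx : mass A (f x) < 1 / 3 := hkx
      refine absurd (max_eq_left ((min_le_right _ _).trans ?_)) hθx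
      linarith
    · exact hky.1
    · have hky : 2 / 3 < mass A (f y) := hky
      linarith
  have hθb : ∀ e ∈ gridSphere (ι := Fin j) N, ∀ x ∈ gridCell δ e, 1 - θ x ≠ 0 →
      ∀ y ∈ gridCell δ e, 0 < mass B (f y) := by
    intro e he x hx hθx y hy
    have hs := gridCell_subset_sphere hN hδ hNδ he
    have hm := hmass y (hs hy)
    obtain ⟨k, hk⟩ := hfine e
    have hkx := hk ⟨hx, hs hx⟩
    have hky := hk ⟨hy, hs hy⟩
    fin_cases k
    · have hky : mass A (f y) < 1 / 3 := hky
      linarith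
    · have hky : mass A (f y) < 1 := hky.2
      linarith
    · have hkx : 2 / 3 < mass A (f x) := hkx
      have : θ x = 1 := by
        simp only [θ]
        rw [min_eq_left (by linarith), max_eq_right zero_le_one]
      exact absurd (by rw [this, sub_self]) hθx
  have haX : ∀ e ∈ gridSphere (ι := Fin j) N, (∀ y ∈ gridCell δ e, 0 < mass A (f y)) →
      ∀ y ∈ gridCell δ e, a y ∈ orderComplex A := fun e he h y hy => by
    rw [haL e he h hy]
    exact restrictTo_mem (hfX (gridCell_subset_sphere hN hδ hNδ he hy)) (h y hy)
  have hbX : ∀ e ∈ gridSphere (ι := Fin j) N, (∀ y ∈ gridCell δ e, 0 < mass B (f y)) →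
      ∀ y ∈ gridCell δ e, b y ∈ orderComplex B := fun e he h y hy => by
    rw [hbL e he h hy]
    exact restrictTo_mem (hfX (gridCell_subset_sphere hN hδ hNδ he hy)) (h y hy)
  have hJ : ∀ (s : ℝ) (u v : α → ℝ), 0 ≤ s ∧ s ≤ 1 → (s ≠ 0 → u ∈ orderComplex A) →
      (1 - s ≠ 0 → v ∈ orderComplex B) → s • u + (1 - s) • v ∈ orderComplex (A ∪ B) := by
    intro s u v hs hu hv
    refine add_smul_mem_orderComplex hs.1 (by linarith [hs.2]) (by ring)
      (fun h => orderComplex_mono subset_union_left (hu h))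
      (fun h => orderComplex_mono subset_union_right (hv h)) fun h h' y z hy hz => ?_
    exact hcomp y ((mem_orderComplex_iff.1 (hu h)).2.1 y hy) z
      ((mem_orderComplex_iff.1 (hv h')).2.1 z hz)
  -- the two foldings
  let ρ₀ : (Fin j → ℝ) → Fin j → ℝ := foldMap collapseEnds δ
  let ρ₁ : (Fin j → ℝ) → Fin j → ℝ := foldMap collapseMiddle δ
  have hρ₀ : Continuous ρ₀ := continuous_foldMap (by unfold collapseEnds; fun_prop)
    (by norm_num [collapseEnds]) (by norm_num [collapseEnds]) δ
  have hρ₁ : Continuous ρ₁ := continuous_foldMap (by unfold collapseMiddle; fun_prop)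
    (by norm_num [collapseMiddle]) (by norm_num [collapseMiddle]) δ
  have hρ₀c : ∀ e, MapsTo ρ₀ (gridCell δ e) (gridCell δ e) := fun e x hx =>
    foldMap_mem_gridCell (by norm_num [collapseEnds]) collapseEnds_mapsTo_left
      collapseEnds_mapsTo_right hδ hx
  have hρ₁c : ∀ e, MapsTo ρ₁ (gridCell δ e) (gridCell δ e) := fun e x hx =>
    foldMap_mem_gridCell (by norm_num [collapseMiddle]) collapseMiddle_mapsTo_left
      collapseMiddle_mapsTo_right hδ hx
  have hball : ∀ ρ : (Fin j → ℝ) → Fin j → ℝ, (∀ e, MapsTo ρ (gridCell δ e) (gridCell δ e)) →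
      ∀ x ∈ closedBall (0 : Fin j → ℝ) 1, minCell δ (ρ x) ∈ gridBall N := fun ρ hρ x hx =>
    minCell_mem_gridBall hN hδ hNδ (gridCell_subset_closedBall hN hδ hNδ
      (minCell_mem_gridBall hN hδ hNδ hx) (hρ _ (mem_gridCell_minCell hδ x)))
  -- the weights on the ball
  let P : (Fin j → ℝ) → ℝ := fun x => countWeight (j + 1 - p) fun i => 3 / 2 - distFour (x i / δ)
  let Q : (Fin j → ℝ) → ℝ := fun x => countWeight p fun i => distFour (x i / δ) - 1 / 2
  have hd := continuous_distFour
  have hP : Continuous P := (continuous_countWeight _).comp (by fun_prop)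
  have hQ : Continuous Q := (continuous_countWeight _).comp (by fun_prop)
  have hP0 : ∀ x, 0 ≤ P x := fun x => countWeight_nonneg _ _
  have hQ0 : ∀ x, 0 ≤ Q x := fun x => countWeight_nonneg _ _
  have hPQ : ∀ x, P x ≠ 0 ∨ Q x ≠ 0 := by
    intro x
    let s : Finset (Fin j) := Finset.univ.filter fun i => distFour (x i / δ) < 3 / 2
    have hs : s.card + sᶜ.card = j := by simp
    by_cases h : j + 1 - p ≤ s.card
    · refine Or.inl (countWeight_ne_zero_iff.2 ⟨s, h, fun i hi => ?_⟩)
      exact sub_pos.2 ((Finset.mem_filter_univ i).1 hi)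
    · refine Or.inr (countWeight_ne_zero_iff.2 ⟨sᶜ, by omega, fun i hi => ?_⟩)
      rw [Finset.mem_compl, Finset.mem_filter_univ] at hi
      linarith
  have hPQpos : ∀ x, 0 < P x + Q x := fun x => by
    rcases hPQ x with h | h
    · exact add_pos_of_pos_of_nonneg (lt_of_le_of_ne (hP0 x) h.symm) (hQ0 x)
    · exact add_pos_of_nonneg_of_pos (hP0 x) (lt_of_le_of_ne (hQ0 x) h.symm)
  let Θ : (Fin j → ℝ) → ℝ := fun x => P x / (P x + Q x)
  have hΘ : Continuous Θ := hP.div (hP.add hQ) fun x => (hPQpos x).ne'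
  have hΘ01 : ∀ x, 0 ≤ Θ x ∧ Θ x ≤ 1 := fun x =>
    ⟨div_nonneg (hP0 x) (hPQpos x).le, (div_le_one (hPQpos x)).2 (by linarith [hQ0 x])⟩
  have hΘa : ∀ x ∈ closedBall (0 : Fin j → ℝ) 1, Θ x ≠ 0 → a (ρ₀ x) ∈ orderComplex A := by
    intro x hx h
    obtain ⟨s, hs, hsd⟩ := countWeight_ne_zero_iff.1 (left_ne_zero_of_mul h)
    refine haK (minCell δ (ρ₀ x)) (Finset.mem_filter.2 ⟨hball ρ₀ hρ₀c x hx, ?_⟩)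
      (mem_gridCell_minCell hδ _)
    have : s.card ≤ (Finset.univ.filter fun i => 4 ∣ minCell δ (ρ₀ x) i).card :=
      Finset.card_le_card fun i hi => (Finset.mem_filter_univ i).2
        (four_dvd_minCell_foldMap hδ (by linarith [hsd i hi]))
    omega
  have hΘb : ∀ x ∈ closedBall (0 : Fin j → ℝ) 1, 1 - Θ x ≠ 0 → b (ρ₁ x) ∈ orderComplex B := by
    intro x hx h
    have hΘQ : 1 - Θ x = Q x / (P x + Q x) := by
      have := (hPQpos x).ne'
      simp only [Θ]
      field_simp
      ring
    rw [hΘQ] at h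
    obtain ⟨s, hs, hsd⟩ := countWeight_ne_zero_iff.1 (left_ne_zero_of_mul h)
    refine hbK (minCell δ (ρ₁ x)) (Finset.mem_filter.2 ⟨hball ρ₁ hρ₁c x hx, hs.trans ?_⟩)
      (mem_gridCell_minCell hδ _)
    exact Finset.card_le_card fun i hi => (Finset.mem_filter_univ i).2
      (minCell_foldMap_emod_four hδ (by linarith [hsd i hi]))
  have hext : ExtendsInto (orderComplex (A ∪ B)) fun x => Θ x • a (ρ₀ x) + (1 - Θ x) • b (ρ₁ x) :=
    ⟨_, by fun_prop, fun _ _ => rfl, fun x hx => hJ _ _ _ (hΘ01 x) (hΘa x hx) (hΘb x hx)⟩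
  have hcell : ∀ x ∈ sphere (0 : Fin j → ℝ) 1, minCell δ x ∈ gridSphere N := fun x hx =>
    minCell_mem_gridSphere hN hδ hNδ hx
  have hmem := mem_gridCell_minCell (ι := Fin j) hδ
  have hconv : ∀ u v t : ℝ, (0 ≤ u ∧ u ≤ 1) → (0 ≤ v ∧ v ≤ 1) → (0 ≤ t ∧ t ≤ 1) →
      0 ≤ (1 - t) * u + t * v ∧ (1 - t) * u + t * v ≤ 1 := fun u v t hu hv ht =>
    ⟨by nlinarith [mul_nonneg (sub_nonneg.2 ht.2) hu.1, mul_nonneg ht.1 hv.1],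
      by nlinarith [mul_nonneg (sub_nonneg.2 ht.2) (sub_nonneg.2 hu.2),
        mul_nonneg ht.1 (sub_nonneg.2 hv.2)]⟩
  have hext₁ : ExtendsInto (orderComplex (A ∪ B)) fun x =>
      θ x • a (ρ₀ x) + (1 - θ x) • b (ρ₁ x) := by
    let H : ℝ × (Fin j → ℝ) → α → ℝ := fun z =>
      ((1 - z.1) * θ z.2 + z.1 * Θ z.2) • a (ρ₀ z.2) +
        (1 - ((1 - z.1) * θ z.2 + z.1 * Θ z.2)) • b (ρ₁ z.2)
    refine (ExtendsInto.of_homotopy (H := H) (by fun_prop) ?_ ?_).congr fun x _ => ?_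
    · rintro ⟨t, x⟩ ⟨ht, hx⟩
      have hxb := sphere_subset_closedBall hx
      have hc := hcell x hx
      refine hJ _ _ _ (hconv _ _ _ (hθ01 x) (hΘ01 x) ht) (fun h => ?_) fun h => ?_
      · by_cases h0 : θ x = 0
        · exact hΘa x hxb fun h1 => h (by simp [h0, h1])
        · exact haX _ hc (hθa _ hc x (hmem x) h0) _ (hρ₀c _ (hmem x))
      · by_cases h0 : 1 - θ x = 0
        · refine hΘb x hxb fun h1 => h ?_
          have h0 : θ x = 1 := by linarith
          have h1 : Θ x = 1 := by linarith
          simp only [h0, h1]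
          ring
        · exact hbX _ hc (hθb _ hc x (hmem x) h0) _ (hρ₁c _ (hmem x))
    · exact hext.congr fun x _ => by simp [H]
    · simp [H]
  have hext₂ : ExtendsInto (orderComplex (A ∪ B)) fun x => θ x • a x + (1 - θ x) • b x := by
    let H : ℝ × (Fin j → ℝ) → α → ℝ := fun z =>
      θ z.2 • a ((1 - z.1) • z.2 + z.1 • ρ₀ z.2) +
        (1 - θ z.2) • b ((1 - z.1) • z.2 + z.1 • ρ₁ z.2)
    refine (ExtendsInto.of_homotopy (H := H) (by fun_prop) ?_ ?_).congr fun x _ => ?_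
    · rintro ⟨t, x⟩ ⟨ht, hx⟩
      have hc := hcell x hx
      have hseg : ∀ y ∈ gridCell δ (minCell δ x), (1 - t) • x + t • y ∈ gridCell δ (minCell δ x) :=
        fun y hy => convex_gridCell δ _ (hmem x) hy (sub_nonneg.2 ht.2) ht.1 (by simp)
      exact hJ _ _ _ (hθ01 x)
        (fun h => haX _ hc (hθa _ hc x (hmem x) h) _ (hseg _ (hρ₀c _ (hmem x))))
        (fun h => hbX _ hc (hθb _ hc x (hmem x) h) _ (hseg _ (hρ₁c _ (hmem x))))
    · exact hext₁.congr fun x _ => by simp [H]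
    · simp [H]
  let H : ℝ × (Fin j → ℝ) → α → ℝ := fun z =>
    (1 - z.1) • f z.2 + z.1 • (θ z.2 • a z.2 + (1 - θ z.2) • b z.2)
  refine (ExtendsInto.of_homotopy (H := H) (by fun_prop) ?_ ?_).congr fun x _ => ?_
  · rintro ⟨t, x⟩ ⟨ht, hx⟩
    have hc := hcell x hx
    refine add_smul_mem_orderComplex (sub_nonneg.2 ht.2) ht.1 (by simp) (fun _ => hfX hx)
      (fun _ => hJ _ _ _ (hθ01 x) (fun h => haX _ hc (hθa _ hc x (hmem x) h) _ (hmem x))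
        fun h => hbX _ hc (hθb _ hc x (hmem x) h) _ (hmem x)) fun _ _ u v hu hv => ?_
    refine (mem_orderComplex_iff.1 (hfX hx)).2.2.1 u v hu ?_
    by_cases h : θ x • a x v = 0
    · have hv' : (1 - θ x) • b x v ≠ 0 := by
        intro h'
        exact hv (by rw [Pi.add_apply, Pi.smul_apply, Pi.smul_apply, h, h', add_zero])
      have h1 := left_ne_zero_of_smul hv'
      have h2 := right_ne_zero_of_smul hv'
      rw [hbL _ hc (hθb _ hc x (hmem x) h1) (hmem x)] at h2
      exact (ne_zero_of_restrictTo_ne_zero h2).2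
    · have h1 := left_ne_zero_of_smul h
      have h2 := right_ne_zero_of_smul h
      rw [haL _ hc (hθa _ hc x (hmem x) h1) (hmem x)] at h2
      exact (ne_zero_of_restrictTo_ne_zero h2).2
  · exact hext₂.congr fun x _ => by simp [H]
  · simp [H]

end Join

theorem FillsBelow.mono {E : Type} [TopologicalSpace E] {X : Set E} {m n : ℕ} (h : FillsBelow n X)
    (hmn : m ≤ n) : FillsBelow m X := fun j hj => h j (hj.trans_le hmn)

section Transfer

theorem extend_zero_eq_zero {α β : Type} {i : α → β} {f : α → ℝ} {y : β}
    (hy : y ∉ range i) : extend i f (0 : β → ℝ) y = 0 :=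
  extend_apply' f (0 : β → ℝ) y hy

theorem continuous_extend_zero {α β : Type} {i : α → β} (hi : Injective i) :
    Continuous fun f : α → ℝ => extend i f (0 : β → ℝ) := by
  refine continuous_pi fun y => ?_
  by_cases hy : y ∈ range i
  · obtain ⟨x, rfl⟩ := hy
    simpa only [hi.extend_apply] using continuous_apply x
  · simpa only [extend_zero_eq_zero hy] using continuous_const

variable {α β : Type} [PartialOrder α] [PartialOrder β] [Fintype α] [Fintype β] {n : ℕ}

theorem fillsBelow_orderComplex_image_iff (i : α ↪o β) (S : Set α) :
    FillsBelow n (orderComplex (i '' S)) ↔ FillsBelow n (orderComplex S) := by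
  have hpush : MapsTo (fun f : α → ℝ => extend i f 0) (orderComplex S)
      (orderComplex (i '' S)) := by
    intro f hf
    rw [mem_orderComplex_iff] at hf
    have hrange : ∀ y, extend i f 0 y ≠ 0 → ∃ x, i x = y ∧ f x ≠ 0 := by
      intro y hy
      by_cases h : y ∈ range i
      · obtain ⟨x, rfl⟩ := h
        exact ⟨x, rfl, by rwa [i.injective.extend_apply] at hy⟩
      · exact absurd (extend_zero_eq_zero h) hy
    refine mem_orderComplex_iff.2 ⟨fun y => ?_, fun y hy => ?_, fun y z hy hz => ?_, ?_⟩
    · by_cases h : y ∈ range i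
      · obtain ⟨x, rfl⟩ := h
        simpa [i.injective.extend_apply] using hf.1 x
      · exact (extend_zero_eq_zero h).ge
    · obtain ⟨x, rfl, hx⟩ := hrange y hy
      exact mem_image_of_mem _ (hf.2.1 x hx)
    · obtain ⟨x, rfl, hx⟩ := hrange y hy
      obtain ⟨x', rfl, hx'⟩ := hrange z hz
      simpa using hf.2.2.1 x x' hx hx'
    · rw [← hf.2.2.2]
      exact (Fintype.sum_of_injective i i.injective _ _ (fun y hy => extend_zero_eq_zero hy)
        fun x => (i.injective.extend_apply f 0 x).symm).symm
  have hsupp : ∀ g ∈ orderComplex (i '' S), ∀ y ∉ range i, g y = 0 := by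
    intro g hg y hy
    by_contra h
    obtain ⟨x, -, rfl⟩ := (mem_orderComplex_iff.1 hg).2.1 y h
    exact hy (mem_range_self x)
  have hpull : MapsTo (fun g : β → ℝ => g ∘ i) (orderComplex (i '' S)) (orderComplex S) := by
    intro g hg
    have h0 := hsupp g hg
    rw [mem_orderComplex_iff] at hg
    refine mem_orderComplex_iff.2 ⟨fun x => hg.1 _, fun x hx => ?_, fun x x' hx hx' => ?_, ?_⟩
    · obtain ⟨x', hx', h⟩ := hg.2.1 _ hx
      rwa [← i.injective h]
    · simpa using hg.2.2.1 _ _ hx hx'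
    · rw [← hg.2.2.2]
      exact Fintype.sum_of_injective i i.injective _ _ h0 fun x => rfl
  have hcpull : Continuous fun g : β → ℝ => g ∘ i :=
    continuous_pi fun x => continuous_apply (i x)
  have hcpush := continuous_extend_zero i.injective
  constructor
  · intro h j hj
    exact (h j hj).of_retract hcpush.continuousOn hcpull.continuousOn hpush hpull
      fun f _ => funext fun x => i.injective.extend_apply f 0 x
  · intro h j hj
    refine (h j hj).of_retract hcpull.continuousOn hcpush.continuousOn hpull hpush
      fun g hg => ?_
    funext y
    by_cases hy : y ∈ range i
    · obtain ⟨x, rfl⟩ := hy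
      rw [i.injective.extend_apply, comp_apply]
    · rw [hsupp g hg y hy]
      exact extend_zero_eq_zero hy

/-- Attaching the vertices of `T` one by one, in the order given by `r`, with highly connected
links does not change high connectedness. -/
theorem fillsBelow_union_iff {S : Set α} (T : Finset α) (hST : ∀ x ∈ T, x ∉ S)
    (r : α → α → Prop) [IsTrans α r] [Std.Irrefl r] (hr : ∀ x y, x < y → r x y ∨ r y x)
    (hlink : ∀ x ∈ T, FillsBelow n
      (orderComplex {y | (y ∈ S ∨ (y ∈ T ∧ r x y)) ∧ (y ≤ x ∨ x ≤ y)})) :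
    FillsBelow n (orderComplex (S ∪ T)) ↔ FillsBelow n (orderComplex S) := by
  classical
  induction hcard : T.card generalizing T with
  | zero =>
    rw [Finset.card_eq_zero] at hcard
    simp [hcard]
  | succ k ih =>
    have hne : (T : Set α).Nonempty := by
      rw [Finset.coe_nonempty, ← Finset.card_pos]
      omega
    obtain ⟨x, hxT, hmin⟩ := (Finite.wellFounded_of_trans_of_irrefl r).has_min _ hne
    have hxT : x ∈ T := hxT
    rw [← ih (T.erase x) (fun y hy => hST y (Finset.mem_of_mem_erase hy)) ?_
      (by rw [Finset.card_erase_of_mem hxT]; omega)]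
    · have hins : S ∪ T = insert x (S ∪ (T.erase x : Finset α)) := by
        rw [← union_insert, ← Finset.coe_insert, Finset.insert_erase hxT]
      rw [hins]
      refine fillsBelow_insert_iff (by simp [hST x hxT]) ?_
      convert hlink x hxT using 3
      ext y
      simp only [mem_union, Finset.mem_coe, Finset.mem_erase]
      refine and_congr_left fun hc => or_congr Iff.rfl ⟨fun h => ⟨h.2, ?_⟩, fun h => ⟨?_, h.1⟩⟩
      · have hnr : ¬ r y x := hmin y h.2
        rcases hc with hc | hc
        · exact (hr y x (lt_of_le_of_ne hc h.1)).resolve_left hnr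
        · exact (hr x y (lt_of_le_of_ne hc (Ne.symm h.1))).resolve_right hnr
      · rintro rfl
        exact Std.Irrefl.irrefl (r := r) y h.2
    · intro z hz
      convert hlink z (Finset.mem_of_mem_erase hz) using 3
      ext y
      simp only [Finset.mem_erase]
      refine and_congr_left fun _ => or_congr Iff.rfl (and_congr_left fun h => ?_)
      refine and_iff_right ?_
      rintro rfl
      exact hmin z (Finset.mem_of_mem_erase hz) h

end Transfer

section Cylinder

variable {P Q : Type} [PartialOrder P] [PartialOrder Q]

/-- The mapping cylinder of an order-preserving map: the elements of `P` are placed below those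
of `Q`, by comparing along `φ`. -/
def MappingCylinder (_φ : P →o Q) : Type := P ⊕ Q

variable {φ : P →o Q}

/-- The order of the mapping cylinder. -/
def MappingCylinder.Le : MappingCylinder φ → MappingCylinder φ → Prop
  | .inl p, .inl p' => p ≤ p'
  | .inl p, .inr q => φ p ≤ q
  | .inr _, .inl _ => False
  | .inr q, .inr q' => q ≤ q'

instance : PartialOrder (MappingCylinder φ) where
  le := MappingCylinder.Le
  le_refl a := by
    rcases a with p | q
    · exact le_refl p
    · exact le_refl q
  le_trans a b c hab hbc := by
    rcases a with p | q <;> rcases b with p' | q' <;> rcases c with p'' | q''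
    · exact le_trans (α := P) hab hbc
    · exact le_trans (φ.monotone hab) hbc
    · exact hbc.elim
    · exact le_trans (α := Q) hab hbc
    · exact hab.elim
    · exact hab.elim
    · exact hbc.elim
    · exact le_trans (α := Q) hab hbc
  le_antisymm a b hab hba := by
    rcases a with p | q <;> rcases b with p' | q'
    · exact congrArg Sum.inl (le_antisymm (α := P) hab hba)
    · exact hba.elim
    · exact hab.elim
    · exact congrArg Sum.inr (le_antisymm (α := Q) hab hba)

instance [Fintype P] [Fintype Q] : Fintype (MappingCylinder φ) :=
  inferInstanceAs (Fintype (P ⊕ Q))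

/-- The inclusion of the source in the mapping cylinder. -/
def MappingCylinder.inl (φ : P →o Q) : P ↪o MappingCylinder φ where
  toFun := Sum.inl
  inj' := Sum.inl_injective
  map_rel_iff' := Iff.rfl

/-- The inclusion of the target in the mapping cylinder. -/
def MappingCylinder.inr (φ : P →o Q) : Q ↪o MappingCylinder φ where
  toFun := Sum.inr
  inj' := Sum.inr_injective
  map_rel_iff' := Iff.rfl

open MappingCylinder in
theorem MappingCylinder.exists_eq (a : MappingCylinder φ) :
    (∃ p, inl φ p = a) ∨ ∃ q, inr φ q = a := by
  rcases a with p | q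
  · exact Or.inl ⟨p, rfl⟩
  · exact Or.inr ⟨q, rfl⟩

theorem MappingCylinder.inl_le_inr {p : P} {q : Q} : inl φ p ≤ inr φ q ↔ φ p ≤ q := Iff.rfl

theorem MappingCylinder.not_inr_le_inl {p : P} {q : Q} : ¬ inr φ q ≤ inl φ p := id

theorem MappingCylinder.inl_ne_inr {p : P} {q : Q} : inl φ p ≠ inr φ q := Sum.inl_ne_inr

variable [Fintype P] [Fintype Q] {n : ℕ}

open MappingCylinder in
/-- The target of an order-preserving map is a deformation retract of its mapping cylinder. -/
theorem fillsBelow_cylinder_iff_target :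
    FillsBelow n (orderComplex (univ : Set (MappingCylinder φ))) ↔
      FillsBelow n (orderComplex (univ : Set Q)) := by
  classical
  rw [← fillsBelow_orderComplex_image_iff (inr φ) univ]
  have huniv : (univ : Set (MappingCylinder φ)) =
      inr φ '' univ ∪ (Finset.univ.map (inl φ).toEmbedding : Finset (MappingCylinder φ)) := by
    ext a
    rcases exists_eq a with ⟨p, rfl⟩ | ⟨q, rfl⟩ <;> simp
  rw [huniv]
  refine fillsBelow_union_iff _ ?_ (· > ·) (fun x y h => Or.inr h) ?_
  · simp [inl_ne_inr.symm]
  · simp only [Finset.mem_map, Finset.mem_univ, true_and, forall_exists_index]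
    rintro _ p rfl j -
    refine fills_orderComplex_of_cone (c := inr φ (φ p))
      ⟨Or.inl ⟨_, mem_univ _, rfl⟩, Or.inr (inl_le_inr.2 le_rfl)⟩ ?_
    rintro y ⟨hy | ⟨⟨p', rfl⟩, hy⟩, hc⟩
    · obtain ⟨q, -, rfl⟩ := hy
      refine Or.inr ?_
      rw [OrderEmbedding.le_iff_le, ← inl_le_inr]
      exact hc.resolve_left not_inr_le_inl
    · exact Or.inl (inl_le_inr.2 (φ.monotone ((inl φ).le_iff_le.1 (le_of_lt hy))))

open MappingCylinder in
/-- If fibers and strict upper ideals are highly connected, the source of an order-preserving map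
is as highly connected as its mapping cylinder. -/
theorem fillsBelow_cylinder_iff_source (a b : Q → ℕ) (hn : ∀ x, n ≤ a x + b x)
    (ha : ∀ x, FillsBelow (a x) (orderComplex {p | φ p ≤ x}))
    (hb : ∀ x, FillsBelow (b x) (orderComplex {y | x < y})) :
    FillsBelow n (orderComplex (univ : Set (MappingCylinder φ))) ↔
      FillsBelow n (orderComplex (univ : Set P)) := by
  classical
  rw [← fillsBelow_orderComplex_image_iff (inl φ) univ]
  have huniv : (univ : Set (MappingCylinder φ)) =
      inl φ '' univ ∪ (Finset.univ.map (inr φ).toEmbedding : Finset (MappingCylinder φ)) := by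
    ext a
    rcases exists_eq a with ⟨p, rfl⟩ | ⟨q, rfl⟩ <;> simp
  rw [huniv]
  refine fillsBelow_union_iff _ ?_ (· < ·) (fun x y h => Or.inl h) ?_
  · simp [inl_ne_inr]
  · simp only [Finset.mem_map, Finset.mem_univ, true_and, forall_exists_index]
    rintro _ x rfl
    have hlink : {y | (y ∈ inl φ '' univ ∨ ((∃ q, (inr φ).toEmbedding q = y) ∧
        (inr φ).toEmbedding x < y)) ∧
        (y ≤ (inr φ).toEmbedding x ∨ (inr φ).toEmbedding x ≤ y)} =
        inl φ '' {p | φ p ≤ x} ∪ inr φ '' {y | x < y} := by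
      ext y
      rcases exists_eq y with ⟨p, rfl⟩ | ⟨q, rfl⟩
      · simp [inl_ne_inr.symm, not_inr_le_inl, inl_le_inr]
      · simp only [mem_union, mem_ofPred_eq, mem_image]
        simp [inl_ne_inr]
        exact fun h => Or.inr h.le
    rw [hlink]
    refine (FillsBelow.join ?_ ?_ ((fillsBelow_orderComplex_image_iff _ _).2 (ha x))
      ((fillsBelow_orderComplex_image_iff _ _).2 (hb x))).mono (hn x)
    · rw [Set.disjoint_left]
      rintro _ ⟨p, -, rfl⟩ ⟨q, -, h⟩
      exact inl_ne_inr h.symm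
    · rintro _ ⟨p, hp, rfl⟩ _ ⟨q, hq, rfl⟩
      exact Or.inl (inl_le_inr.2 (le_trans hp (le_of_lt hq)))

end Cylinder

section Cube

open scoped unitInterval Topology.Homotopy

variable {κ : Type} [Fintype κ]

/-- The affine identification of the sup-norm unit ball with the unit cube, extended by clamping
the coordinates. -/
def toCube (y : κ → ℝ) : κ → I := fun k => projIcc 0 1 zero_le_one ((y k + 1) / 2)

/-- The affine identification of the unit cube with the sup-norm unit ball. -/
def ofCube (c : κ → I) : κ → ℝ := fun k => 2 * (c k : ℝ) - 1

omit [Fintype κ] in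
theorem continuous_toCube : Continuous (toCube : (κ → ℝ) → κ → I) := by
  refine continuous_pi fun k => continuous_projIcc.comp ?_
  fun_prop

omit [Fintype κ] in
theorem continuous_ofCube : Continuous (ofCube : (κ → I) → κ → ℝ) := by
  unfold ofCube
  fun_prop

omit [Fintype κ] in
theorem toCube_ofCube (c : κ → I) : toCube (ofCube c) = c := by
  ext k
  simp [toCube, ofCube, projIcc_val]

theorem ofCube_toCube {y : κ → ℝ} (hy : ‖y‖ ≤ 1) : ofCube (toCube y) = y := by
  ext k
  have := abs_le.1 ((norm_le_pi_norm y k).trans hy)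
  rw [ofCube, toCube, projIcc_of_mem zero_le_one (x := (y k + 1) / 2)
    ⟨by linarith, by linarith⟩]
  ring

theorem norm_ofCube_le (c : κ → I) : ‖ofCube c‖ ≤ 1 := by
  refine (pi_norm_le_iff_of_nonneg zero_le_one).2 fun k => abs_le.2 ?_
  have h0 := (c k).2.1
  have h1 := (c k).2.2
  constructor <;> simp only [ofCube] <;> linarith

theorem norm_ofCube_of_mem_boundary {c : κ → I} (hc : c ∈ Cube.boundary κ) : ‖ofCube c‖ = 1 := by
  obtain ⟨k, hk⟩ := hc
  refine le_antisymm (norm_ofCube_le c) ?_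
  refine le_trans ?_ (norm_le_pi_norm _ k)
  rcases hk with hk | hk <;> norm_num [ofCube, hk]

theorem toCube_mem_boundary {y : κ → ℝ} (hy : ‖y‖ = 1) : toCube y ∈ Cube.boundary κ := by
  obtain ⟨k, hk⟩ : ∃ k, ‖y k‖ = 1 := by
    by_contra! h
    exact hy.not_lt ((pi_norm_lt_iff one_pos).2 fun k =>
      lt_of_le_of_ne ((norm_le_pi_norm y k).trans hy.le) (h k))
  refine ⟨k, ?_⟩
  rcases (abs_eq zero_le_one).1 hk with h | h
  · exact Or.inr (by simp [toCube, h])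
  · exact Or.inl (by simp [toCube, h])

end Cube

section Homotopy

open scoped unitInterval Topology.Homotopy

variable {κ : Type} [Fintype κ] {E : Type} [NormedAddCommGroup E] [NormedSpace ℝ E] {X : Set E}

theorem mk_mem_sphere_iff {V : Type} [NormedAddCommGroup V] {t : ℝ} {y : V} :
    (t, y) ∈ sphere (0 : ℝ × V) 1 ↔
      |t| ≤ 1 ∧ ‖y‖ ≤ 1 ∧ (t = 1 ∨ t = -1 ∨ ‖y‖ = 1) := by
  rw [mem_sphere_zero_iff_norm, Prod.norm_mk, Real.norm_eq_abs]
  constructor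
  · intro h
    refine ⟨h ▸ le_max_left _ _, h ▸ le_max_right _ _, ?_⟩
    rcases max_choice |t| ‖y‖ with h' | h'
    · exact ((abs_eq zero_le_one).1 (h'.symm.trans h)).imp_right Or.inl
    · exact Or.inr (Or.inr (h'.symm.trans h))
  · rintro ⟨ht, hy, rfl | rfl | h⟩
    · simp [hy]
    · simp [hy]
    · simp [h, ht]

theorem Fills.subsingleton_homotopyGroup (h : Fills (ℝ × (κ → ℝ)) X) (x : X) :
    Subsingleton (HomotopyGroup κ X x) := by
  refine ⟨fun a b => Quotient.inductionOn₂ a b fun p q => Quotient.sound ?_⟩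
  obtain ⟨g, hg, hgf, hgX⟩ := h
    (fun z => ((1 - z.1) / 2) • (p (toCube z.2) : E) + ((1 + z.1) / 2) • (q (toCube z.2) : E))
    (by
      have hp : Continuous fun z : ℝ × (κ → ℝ) => (p (toCube z.2) : E) :=
        continuous_subtype_val.comp (p.1.continuous.comp (continuous_toCube.comp continuous_snd))
      have hq : Continuous fun z : ℝ × (κ → ℝ) => (q (toCube z.2) : E) :=
        continuous_subtype_val.comp (q.1.continuous.comp (continuous_toCube.comp continuous_snd))
      fun_prop)
    (by
      rintro ⟨t, y⟩ hz
      obtain ⟨-, -, rfl | rfl | hy⟩ := mk_mem_sphere_iff.1 hz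
      · norm_num
      · norm_num
      · simp only [GenLoop.boundary _ _ (toCube_mem_boundary hy), ← add_smul]
        norm_num [← add_div])
  have hball (s : I) (c : κ → I) : g (2 * (s : ℝ) - 1, ofCube c) ∈ X := by
    refine hgX ?_
    rw [mem_closedBall_zero_iff, Prod.norm_mk, max_le_iff]
    exact ⟨abs_le.2 ⟨by linarith [s.2.1], by linarith [s.2.2]⟩, norm_ofCube_le c⟩
  refine ⟨⟨⟨⟨fun z => ⟨g (2 * (z.1 : ℝ) - 1, ofCube z.2), hball z.1 z.2⟩, ?_⟩, ?_, ?_⟩, ?_⟩⟩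
  · refine Continuous.subtype_mk (hg.comp (Continuous.prodMk (by fun_prop)
      (continuous_ofCube.comp continuous_snd))) _
  · intro c
    refine Subtype.ext ?_
    have : g (-1, ofCube c) = _ :=
      hgf (mk_mem_sphere_iff.2 ⟨by norm_num, norm_ofCube_le c, Or.inr (Or.inl rfl)⟩)
    norm_num [toCube_ofCube] at this ⊢
    exact this
  · intro c
    refine Subtype.ext ?_
    have : g (1, ofCube c) = _ :=
      hgf (mk_mem_sphere_iff.2 ⟨by norm_num, norm_ofCube_le c, Or.inl rfl⟩)
    norm_num [toCube_ofCube] at this ⊢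
    exact this
  · intro s c hc
    refine Subtype.ext ?_
    have : g (2 * (s : ℝ) - 1, ofCube c) = _ :=
      hgf (mk_mem_sphere_iff.2 ⟨abs_le.2 ⟨by linarith [s.2.1], by linarith [s.2.2]⟩,
        norm_ofCube_le c, Or.inr (Or.inr (norm_ofCube_of_mem_boundary hc))⟩)
    simp only [toCube_ofCube, GenLoop.boundary _ _ hc, ← add_smul] at this
    refine this.trans ?_
    have hp : p.1 c = x := p.2 c hc
    rw [hp]
    ring_nf
    exact one_smul _ _

/-- A homotopy of the unit sphere of `ℝ × V`, avoiding the origin, which starts at the inclusion and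
moves everything but the top face `t = 1` to the point `(-1, 0)`. -/
def pinch {V : Type} [NormedAddCommGroup V] [NormedSpace ℝ V] (s : ℝ) (z : ℝ × V) : ℝ × V :=
  ((1 - s) * z.1 + s * ((1 + z.1) * (1 - ‖z.2‖) - 1),
    (1 - s + s * ((1 + z.1) * (1 - ‖z.2‖))) • z.2)

theorem pinch_ne_zero {V : Type} [NormedAddCommGroup V] [NormedSpace ℝ V] (s : ℝ)
    {z : ℝ × V} (hz : z ∈ sphere 0 1) : pinch s z ≠ 0 := by
  obtain ⟨t, y⟩ := z
  intro h
  rw [pinch, Prod.mk_eq_zero, smul_eq_zero] at h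
  obtain ⟨h1, h2⟩ := h
  obtain ⟨-, -, rfl | rfl | hy⟩ := mk_mem_sphere_iff.1 hz
  · rcases h2 with h2 | rfl
    · have : s = 0 := by simp only at h1 h2; linarith
      simp [this] at h1
    · simp at h1
  · simp at h1
    linarith
  · rcases h2 with h2 | rfl
    · simp only [hy] at h1 h2
      have : s = 1 := by linarith
      subst this
      norm_num at h1
    · simp at hy

omit [NormedSpace ℝ E] in
theorem fills_of_subsingleton_homotopyGroup [TietzeExtension.{0} E]
    (h : ∀ x : X, Subsingleton (HomotopyGroup κ X x)) : Fills (ℝ × (κ → ℝ)) X := by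
  intro f hf hfX
  let N : ℝ × (κ → ℝ) → ℝ × (κ → ℝ) := fun v => ‖v‖⁻¹ • v
  have hN : ∀ v, v ≠ 0 → N v ∈ sphere 0 1 := fun v hv => by
    rw [mem_sphere_zero_iff_norm, norm_smul, norm_inv, norm_norm,
      inv_mul_cancel₀ (norm_ne_zero_iff.2 hv)]
  have hN1 : ∀ v ∈ sphere (0 : ℝ × (κ → ℝ)) 1, N v = v := fun v hv => by
    simp [N, mem_sphere_zero_iff_norm.1 hv]
  have hNc : ContinuousOn N {v | v ≠ 0} :=
    (continuous_norm.continuousOn.inv₀ fun v hv => norm_ne_zero_iff.2 hv).smul continuousOn_id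
  have hpole : ((-1, 0) : ℝ × (κ → ℝ)) ∈ sphere (0 : ℝ × (κ → ℝ)) 1 := by
    simp
  let x₀ : X := ⟨f (-1, 0), hfX hpole⟩
  have hPball : ∀ c : κ → I, ((1 : ℝ), ofCube c) ∈ sphere (0 : ℝ × (κ → ℝ)) 1 := fun c =>
    mk_mem_sphere_iff.2 ⟨by simp, norm_ofCube_le c, Or.inl rfl⟩
  have hpinch : ∀ (t : ℝ) (y : κ → ℝ), (1 + t) * (1 - ‖y‖) = 0 → N (pinch 1 (t, y)) = (-1, 0) :=
    fun t y hty => by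
      have : pinch 1 (t, y) = (-1, 0) := by simp [pinch, hty]
      rw [this, hN1 _ hpole]
  have hcont : Continuous fun z : ℝ × ℝ × (κ → ℝ) => pinch z.1 z.2 := by
    unfold pinch
    fun_prop
  have hPc : Continuous fun c : κ → I => f (N (pinch 1 (1, ofCube c))) := by
    refine hf.comp (hNc.comp_continuous ?_ fun c => pinch_ne_zero 1 (hPball c))
    exact hcont.comp (continuous_const.prodMk (continuous_const.prodMk continuous_ofCube))
  let p : GenLoop κ X x₀ := ⟨⟨fun c => ⟨f (N (pinch 1 (1, ofCube c))),
    hfX (hN _ (pinch_ne_zero 1 (hPball c)))⟩, hPc.subtype_mk _⟩, fun c hc => by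
      refine Subtype.ext (congrArg f (hpinch _ _ ?_))
      simp [norm_ofCube_of_mem_boundary hc]⟩
  obtain ⟨K⟩ : GenLoop.Homotopic p GenLoop.const :=
    Quotient.exact (s := GenLoop.Homotopic.setoid κ x₀) ((h x₀).elim _ _)
  have key : ExtendsInto X fun z => f (N (pinch 1 z)) := by
    refine ⟨fun z => (K (projIcc 0 1 zero_le_one ((1 - z.1) / 2), toCube z.2) : X), ?_, ?_,
      fun z _ => Subtype.coe_prop _⟩
    · refine continuous_subtype_val.comp (K.continuous.comp (Continuous.prodMk ?_
        (continuous_toCube.comp continuous_snd)))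
      exact continuous_projIcc.comp (by fun_prop)
    · rintro ⟨t, y⟩ hz
      obtain ⟨-, hy1, rfl | rfl | hy⟩ := mk_mem_sphere_iff.1 hz
      · have : projIcc (0 : ℝ) 1 zero_le_one ((1 - 1) / 2) = 0 := by simp
        simp only [this, K.apply_zero]
        change f (N (pinch 1 (1, ofCube (toCube y)))) = _
        rw [ofCube_toCube hy1]
      · have : projIcc (0 : ℝ) 1 zero_le_one ((1 - -1) / 2) = 1 := by norm_num
        simp only [this, K.apply_one]
        exact (congrArg f (hpinch _ _ (by simp))).symm
      · have := K.eq_snd (projIcc 0 1 zero_le_one ((1 - t) / 2)) (toCube_mem_boundary hy)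
        simp only [this]
        exact (congrArg f (hpinch _ _ (by simp [hy]))).symm
  refine ExtendsInto.congr (ExtendsInto.of_homotopy (H := fun z => f (N (pinch z.1 z.2))) ?_ ?_ key)
    fun z hz => ?_
  · exact hf.comp_continuousOn (hNc.comp hcont.continuousOn fun z hz => pinch_ne_zero _ hz.2)
  · exact fun z hz => hfX (hN _ (pinch_ne_zero _ hz.2))
  · have : pinch 0 z = z := by simp [pinch]
    simp only [this, hN1 z hz]

theorem fills_succ_iff [TietzeExtension.{0} E] (i : ℕ) :
    Fills (Fin (i + 1) → ℝ) X ↔ ∀ x : X, Subsingleton (HomotopyGroup (Fin i) X x) := by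
  let e : (ℝ × (Fin i → ℝ)) ≃L[ℝ] (Fin (i + 1) → ℝ) := Fin.consEquivL ℝ fun _ => ℝ
  have he : ∀ z, ‖e z‖ = ‖z‖ := by
    rintro ⟨t, y⟩
    refine eq_of_forall_ge_iff fun r => ?_
    rcases lt_or_ge r 0 with hr | hr
    · simp only [(hr.trans_le (norm_nonneg _)).not_ge]
    · rw [pi_norm_le_iff_of_nonneg hr, Fin.forall_fin_succ, Prod.norm_mk, max_le_iff,
        pi_norm_le_iff_of_nonneg hr]
      rfl
  refine ⟨fun h => (h.of_linear e he).subsingleton_homotopyGroup, fun h =>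
    (fills_of_subsingleton_homotopyGroup h).of_linear e.symm fun z => ?_⟩
  rw [← he, e.apply_symm_apply]

omit [NormedSpace ℝ E] in
theorem fills_zero_iff : Fills (Fin 0 → ℝ) X ↔ X.Nonempty := by
  have hsphere : ∀ z : Fin 0 → ℝ, z ∉ sphere 0 1 := fun z hz => by
    rw [Subsingleton.elim z 0, mem_sphere_zero_iff_norm, norm_zero] at hz
    exact zero_ne_one hz
  constructor
  · intro h
    obtain ⟨g, -, -, hg⟩ := h (fun _ => 0) continuous_const fun z hz => (hsphere z hz).elim
    exact ⟨g 0, hg (by simp)⟩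
  · rintro ⟨x, hx⟩ f - -
    exact ⟨fun _ => x, continuous_const, fun z hz => (hsphere z hz).elim,
      fun _ _ => hx⟩

theorem kConn_iff_fillsBelow [TietzeExtension.{0} E] (k : ℤ) :
    KConn X k ↔ FillsBelow (k + 2).toNat X := by
  by_cases hk : k ≤ -2
  · have : (k + 2).toNat = 0 := by omega
    simp [KConn, hk, FillsBelow, this]
  have hpath (hX : Nonempty X) : PathConnectedSpace X ↔ Fills (Fin 1 → ℝ) X := by
    rw [fills_succ_iff, pathConnectedSpace_iff_zerothHomotopy]
    have : Nonempty (ZerothHomotopy X) := hX.map fun x => Quotient.mk _ x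
    simp only [this, true_and]
    rw [← hX.elim fun x => (forall_const X (b := Subsingleton (ZerothHomotopy X)))]
    exact forall_congr' fun x => HomotopyGroup.pi0EquivZerothHomotopy.subsingleton_congr.symm
  simp only [KConn, hk, false_or]
  constructor
  · rintro ⟨h0, h1, h2⟩ j hj
    match j with
    | 0 => exact fills_zero_iff.2 (nonempty_subtype.1 h0)
    | 1 => exact (hpath h0).1 (h1 (by omega))
    | i + 2 => exact (fills_succ_iff _).2 (h2 (i + 1) (by omega) (by omega))
  · intro h
    have h0 : Nonempty X := nonempty_subtype.2 (fills_zero_iff.1 (h 0 (by omega)))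
    exact ⟨h0, fun hk0 => (hpath h0).2 (h 1 (by omega)),
      fun i hi hik => (fills_succ_iff i).1 (h (i + 1) (by omega))⟩

end Homotopy

/-- **A generalized Quillen fiber lemma.** Let `φ : P → Q` be an order-preserving map
of finite posets.  Suppose for every `x ∈ Q` the fiber `φ⁻¹(Q_{≤x})` is
`m x`-connected and the strict upper ideal `Q_{>x}` is `ℓ x`-connected, and let
`k = min_{x ∈ Q} (m x + ℓ x) + 2`.  Then `|Δ(P)|` is `k`-connected if and only if
`|Δ(Q)|` is `k`-connected. -/
theorem quillen_fiber_lemma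
    {P Q : Type} [PartialOrder P] [PartialOrder Q] [Fintype P] [Fintype Q]
    (φ : P → Q) (hφ : Monotone φ)
    (m ℓ : Q → ℤ) (hm : ∀ x, -2 ≤ m x) (hℓ : ∀ x, -2 ≤ ℓ x)
    (hfiber : ∀ x : Q, KConn (↥(orderComplex {p : P | φ p ≤ x})) (m x))
    (hupper : ∀ x : Q, KConn (↥(orderComplex {y : Q | x < y})) (ℓ x))
    (k : ℤ) (hk_le : ∀ x : Q, k ≤ m x + ℓ x + 2) (hk_eq : ∃ x : Q, k = m x + ℓ x + 2) :
    (KConn (↥(orderComplex (Set.univ : Set P))) k ↔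
      KConn (↥(orderComplex (Set.univ : Set Q))) k) := by
  simp only [kConn_iff_fillsBelow] at hfiber hupper ⊢
  refine (fillsBelow_cylinder_iff_source (φ := ⟨φ, hφ⟩) (fun x => (m x + 2).toNat)
    (fun x => (ℓ x + 2).toNat) (fun x => ?_) hfiber hupper).symm.trans
    fillsBelow_cylinder_iff_target
  have := hk_le x
  have := hm x
  have := hℓ x
  omega
end
end
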